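/- arXiv:2204.12925 — 3 statements merged into one kernel-verified Lean document; each statement's English description precedes it below -/
import Mathlib

section
/- Fix a nonzero complex number z, and consider the function of s given by g_z(s) = ∑_{n=0}^∞ (−1)^n z^n/(n!·(s+n)), meromorphic in s on ℂ with simple poles at s = 0, −1, −2, … (for Re s > 0 and z > 0 real, g_z(s) = z^{−s}γ(s,z), where γ(s,z) is the lower incomplete gamma function). Let Z be the set of zeros of g_z and for ρ ∈ Z let k_ρ be the order of the zero at ρ. Then ∑_{ρ∈Z} k_ρ/ρ² = Ein(z)² − 2·a₂(z) + π²/6, where Ein(z) = ∑_{k=1}^∞ (−1)^{k+1} z^k/(k·k!) and a₂(z) = ∑_{k=1}^∞ (−1)^{k+1} z^k/(k²·k!). -/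
open Complex Real

lemma aux_order_div {U : Set ℂ} (hU : IsOpen U) {a : ℂ} (ha : a ∈ U) (k : ℕ) :
    ∀ f : ℂ → ℂ, DifferentiableOn ℂ f U → analyticOrderAt f a = (k : ℕ∞) →
      ∃ h : ℂ → ℂ, DifferentiableOn ℂ h U ∧ (∀ s, f s = (s - a) ^ k * h s) ∧ h a ≠ 0 := by
  induction k with
  | zero =>
    intro f hf ho
    refine ⟨f, hf, by simp, ?_⟩
    have han : AnalyticAt ℂ f a := hf.analyticAt (hU.mem_nhds ha)
    exact han.analyticOrderAt_eq_zero.1 (by simpa using ho)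
  | succ k ih =>
    intro f hf ho
    have hf0 : f a = 0 := apply_eq_zero_of_analyticOrderAt_ne_zero (by rw [ho]; simp)
    have hd : DifferentiableOn ℂ (dslope f a) U :=
      (Complex.differentiableOn_dslope (hU.mem_nhds ha)).2 hf
    have heq : ∀ s, f s = (s - a) * dslope f a s := by
      intro s
      have := sub_smul_dslope f a s
      rw [hf0, sub_zero, smul_eq_mul] at this
      exact this.symm
    have han : AnalyticAt ℂ (dslope f a) a := hd.analyticAt (hU.mem_nhds ha)
    have hlin : AnalyticAt ℂ (fun s : ℂ => s - a) a := by fun_prop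
    have hlo : analyticOrderAt (fun s : ℂ => s - a) a = 1 := by
      simp
    have ho2 : analyticOrderAt (dslope f a) a = (k : ℕ∞) := by
      have h1 : f = (fun s : ℂ => s - a) * dslope f a := funext heq
      have h2 := analyticOrderAt_mul hlin han
      rw [← h1, ho, hlo] at h2
      push_cast at h2
      rw [add_comm] at h2
      exact ENat.add_right_injective_of_ne_top (n := 1) (by simp) h2.symm
    obtain ⟨h, h1, h2, h3⟩ := ih _ hd ho2
    refine ⟨h, h1, fun s => ?_, h3⟩
    rw [heq s, h2 s]; ring

lemma aux_factor {U : Set ℂ} (hU : IsOpen U) {F : ℂ → ℂ} (hF : DifferentiableOn ℂ F U)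
    (k : ℂ → ℕ) (S : Finset ℂ) (hS : ∀ ρ ∈ S, ρ ∈ U ∧ ρ ≠ 0 ∧ analyticOrderAt F ρ = (k ρ : ℕ∞)) :
    ∃ G : ℂ → ℂ, DifferentiableOn ℂ G U ∧
      (∀ s, F s = (∏ ρ ∈ S, (1 - s / ρ) ^ k ρ) * G s) ∧ ∀ ρ ∈ S, G ρ ≠ 0 := by
  classical
  induction S using Finset.induction_on with
  | empty => exact ⟨F, hF, by simp, by simp⟩
  | insert a S haS ih =>
    obtain ⟨G, hG, hFG, hne⟩ := ih (fun ρ hρ => hS ρ (Finset.mem_insert_of_mem hρ))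
    obtain ⟨haU, ha0, hao⟩ := hS a (Finset.mem_insert_self _ _)
    have hP : AnalyticAt ℂ (fun s : ℂ => ∏ ρ ∈ S, (1 - s / ρ) ^ k ρ) a := by
      apply Differentiable.analyticAt
      fun_prop
    have hP0 : (∏ ρ ∈ S, (1 - a / ρ) ^ k ρ) ≠ 0 := by
      rw [Finset.prod_ne_zero_iff]
      intro ρ hρ
      apply pow_ne_zero
      have hρ0 := (hS ρ (Finset.mem_insert_of_mem hρ)).2.1
      intro h
      have : a = ρ := by
        field_simp at h
        linear_combination -h
      exact haS (this ▸ hρ)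
    have hGa : AnalyticAt ℂ G a := hG.analyticAt (hU.mem_nhds haU)
    have ho : analyticOrderAt G a = (k a : ℕ∞) := by
      have h1 : F = (fun s : ℂ => ∏ ρ ∈ S, (1 - s / ρ) ^ k ρ) * G := funext hFG
      have h2 := analyticOrderAt_mul hP hGa
      rw [← h1, hao, hP.analyticOrderAt_eq_zero.2 hP0, zero_add] at h2
      exact h2.symm
    obtain ⟨h, h1, h2, h3⟩ := aux_order_div hU haU (k a) G hG ho
    refine ⟨fun s => (-a) ^ k a * h s, h1.const_mul _, fun s => ?_, ?_⟩
    · rw [hFG s, h2 s, Finset.prod_insert haS]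
      have : (s - a) ^ k a = (1 - s / a) ^ k a * (-a) ^ k a := by
        rw [← mul_pow]; congr 1; field_simp; ring
      rw [this]; ring
    · intro ρ hρ
      rcases Finset.mem_insert.1 hρ with rfl | hρ
      · exact mul_ne_zero (pow_ne_zero _ (neg_ne_zero.2 ha0)) h3
      · refine mul_ne_zero (pow_ne_zero _ (neg_ne_zero.2 ha0)) ?_
        intro h0
        exact hne ρ hρ (by rw [h2, h0, mul_zero])

lemma aux_log {R B : ℝ} (hR : 0 < R) (hB : 0 < B) {f : ℂ → ℂ}
    (hf : DifferentiableOn ℂ f (Metric.ball 0 R)) (h1 : f 0 = 1)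
    (hne : ∀ s ∈ Metric.ball (0 : ℂ) R, f s ≠ 0)
    (hb : ∀ s ∈ Metric.ball (0 : ℂ) R, ‖f s‖ ≤ Real.exp B) :
    ‖deriv (logDeriv f) 0‖ ≤ 16 * B / R ^ 2 := by
  have hld : DifferentiableOn ℂ (logDeriv f) (Metric.ball 0 R) := by
    have := (hf.deriv Metric.isOpen_ball).div hf hne
    exact this
  obtain ⟨h0, hh0⟩ := hld.isExactOn_ball
  set h : ℂ → ℂ := fun s => h0 s - h0 0 with hh
  have hder : ∀ s ∈ Metric.ball (0 : ℂ) R, HasDerivAt h (logDeriv f s) s :=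
    fun s hs => (hh0 s hs).sub_const _
  have h00 : h 0 = 0 := by simp [hh]
  have hz : (0 : ℂ) ∈ Metric.ball (0 : ℂ) R := Metric.mem_ball_self hR
  have hhd : DifferentiableOn ℂ h (Metric.ball 0 R) :=
    fun s hs => (hder s hs).differentiableAt.differentiableWithinAt
  have hexp : ∀ s ∈ Metric.ball (0 : ℂ) R, f s * Complex.exp (-h s) = 1 := by
    have hE : ∀ s ∈ Metric.ball (0 : ℂ) R,
        HasDerivAt (fun s => f s * Complex.exp (-h s)) 0 s := by
      intro s hs
      have hfs : HasDerivAt f (deriv f s) s :=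
        (hf.differentiableAt (Metric.isOpen_ball.mem_nhds hs)).hasDerivAt
      have := hfs.mul ((hder s hs).neg.cexp)
      refine this.congr_deriv ?_
      rw [logDeriv_apply]
      have := hne s hs
      field_simp
      ring
    have := IsOpen.eqOn_of_deriv_eq (s := Metric.ball (0 : ℂ) R) (x := 0)
      (f := fun s => f s * Complex.exp (-h s)) (g := fun _ => (1 : ℂ)) Metric.isOpen_ball
      (convex_ball (0 : ℂ) R).isPreconnected
      (fun s hs => (hE s hs).differentiableAt.differentiableWithinAt)
      (differentiableOn_const _) (fun s hs => by simp [(hE s hs).deriv]) hz (by simp [h00, h1])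
    exact this
  have hre : Set.MapsTo h (Metric.ball 0 R) {w | w.re ≤ B} := by
    intro s hs
    have h2 := hexp s hs
    have h3 : f s = Complex.exp (h s) := by
      rw [Complex.exp_neg] at h2
      field_simp at h2
      exact h2
    have h4 := hb s hs
    rw [h3, Complex.norm_exp] at h4
    exact Real.exp_le_exp.1 h4
  have hbd : ∀ s ∈ Metric.sphere (0 : ℂ) (R / 2), ‖h s‖ ≤ 2 * B := by
    intro s hs
    have hs' : ‖s‖ = R / 2 := by simpa using hs
    have := Complex.borelCaratheodory_zero hB hhd hre hR
      (by rw [mem_ball_zero_iff, hs']; linarith) h00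
    refine this.trans (le_of_eq ?_)
    rw [hs']; field_simp; ring
  have hdc : DiffContOnCl ℂ h (Metric.ball 0 (R / 2)) := by
    apply DifferentiableOn.diffContOnCl
    apply hhd.mono
    rw [closure_ball _ (by positivity)]
    exact Metric.closedBall_subset_ball (by linarith)
  have key := Complex.norm_iteratedDeriv_le_of_forall_mem_sphere_norm_le 2 (by positivity) hdc hbd
  have h2d : iteratedDeriv 2 h 0 = deriv (logDeriv f) 0 := by
    rw [iteratedDeriv_succ, iteratedDeriv_one]
    apply Filter.EventuallyEq.deriv_eq
    filter_upwards [Metric.isOpen_ball.mem_nhds hz] with s hs using (hder s hs).deriv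
  rw [h2d] at key
  refine key.trans (le_of_eq ?_)
  simp [Nat.factorial]
  field_simp
  ring

lemma aux_main {R T B : ℝ} (hR : 0 < R) (hT : 4 * R < T) (hB : 0 < B) {F : ℂ → ℂ}
    (hF : DifferentiableOn ℂ F (Metric.ball 0 T)) (h1 : F 0 = 1)
    (hb : ∀ s : ℂ, ‖s‖ ≤ 4 * R → ‖F s‖ ≤ Real.exp B)
    (k : ℂ → ℕ) (S : Finset ℂ) (hS : ∀ ρ, ρ ∈ S ↔ ‖ρ‖ ≤ R ∧ F ρ = 0)
    (ho : ∀ ρ ∈ S, analyticOrderAt F ρ = (k ρ : ℕ∞)) :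
    (∑ ρ ∈ S, (k ρ : ℝ)) ≤ B ∧
    ‖deriv (logDeriv F) 0 + ∑ ρ ∈ S, (k ρ : ℂ) / ρ ^ 2‖ ≤ 16 * B / R ^ 2 := by
  have hS0 : ∀ ρ ∈ S, ρ ≠ 0 := by
    rintro ρ hρ rfl
    have := ((hS 0).1 hρ).2
    rw [h1] at this
    exact one_ne_zero this
  obtain ⟨G, hG, hFG, hGne⟩ := aux_factor Metric.isOpen_ball hF k S (fun ρ hρ =>
    ⟨by rw [mem_ball_zero_iff]; have := ((hS ρ).1 hρ).1; linarith, hS0 ρ hρ, ho ρ hρ⟩)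
  have hG0 : G 0 = 1 := by
    have := hFG 0
    simpa [h1] using this.symm
  -- lower bound of the product on the sphere
  have hprod : ∀ s : ℂ, ‖s‖ = 4 * R → (3 : ℝ) ^ (∑ ρ ∈ S, k ρ) ≤
      ‖∏ ρ ∈ S, (1 - s / ρ) ^ k ρ‖ := by
    intro s hs
    rw [norm_prod, ← Finset.prod_pow_eq_pow_sum]
    apply Finset.prod_le_prod (fun _ _ => by positivity)
    intro ρ hρ
    rw [norm_pow]
    apply pow_le_pow_left₀ (by norm_num)
    have h2 : 4 ≤ ‖s / ρ‖ := by
      rw [norm_div, hs, le_div_iff₀ (norm_pos_iff.2 (hS0 ρ hρ))]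
      have := ((hS ρ).1 hρ).1
      linarith
    have h3 := norm_sub_norm_le (s / ρ) 1
    rw [norm_one, norm_sub_rev] at h3
    linarith
  have hGb : ∀ s ∈ Metric.closedBall (0 : ℂ) (4 * R),
      ‖G s‖ ≤ Real.exp B / 3 ^ (∑ ρ ∈ S, k ρ) := by
    have hdc : DiffContOnCl ℂ G (Metric.ball 0 (4 * R)) := by
      apply DifferentiableOn.diffContOnCl
      apply hG.mono
      rw [closure_ball _ (by positivity)]
      exact Metric.closedBall_subset_ball hT
    intro s hs
    refine Complex.norm_le_of_forall_mem_frontier_norm_le Metric.isBounded_ball hdc ?_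
      (by rw [closure_ball _ (by positivity)]; exact hs)
    intro w hw
    rw [frontier_ball _ (by positivity), mem_sphere_zero_iff_norm] at hw
    rw [le_div_iff₀ (by positivity)]
    have h2 := hb w hw.le
    rw [hFG w, norm_mul] at h2
    have h3 := hprod w hw
    calc ‖G w‖ * 3 ^ (∑ ρ ∈ S, k ρ) ≤ ‖G w‖ * ‖∏ ρ ∈ S, (1 - w / ρ) ^ k ρ‖ := by gcongr
      _ ≤ _ := by rw [mul_comm]; exact h2
  constructor
  · have h2 := hGb 0 (by simp; positivity)
    rw [hG0, norm_one, le_div_iff₀ (by positivity), one_mul] at h2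
    have h3 : Real.exp (∑ ρ ∈ S, (k ρ : ℝ)) ≤ Real.exp B := by
      refine le_trans ?_ h2
      have : (∑ ρ ∈ S, (k ρ : ℝ)) = ((∑ ρ ∈ S, k ρ : ℕ) : ℝ) * 1 := by push_cast; ring
      rw [this, Real.exp_nat_mul]
      apply pow_le_pow_left₀ (Real.exp_pos _).le
      have := Real.exp_one_lt_d9
      linarith
    exact Real.exp_le_exp.1 h3
  · have hl := aux_log hR hB (f := G) (hG.mono (Metric.ball_subset_ball (by linarith))) hG0
      (fun s hs h0 => by
        rw [mem_ball_zero_iff] at hs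
        have hFs : F s = 0 := by rw [hFG, h0, mul_zero]
        exact hGne s ((hS s).2 ⟨hs.le, hFs⟩) h0)
      (fun s hs => by
        rw [mem_ball_zero_iff] at hs
        refine (hGb s (by rw [mem_closedBall_zero_iff]; linarith)).trans ?_
        apply div_le_self (Real.exp_pos _).le
        exact one_le_pow₀ (by norm_num))
    convert hl using 2
    have hz : (0 : ℂ) ∈ Metric.ball (0 : ℂ) T := Metric.mem_ball_self (by linarith)
    have hGan : AnalyticAt ℂ G 0 := hG.analyticAt (Metric.isOpen_ball.mem_nhds hz)
    have hlG : DifferentiableAt ℂ (logDeriv G) 0 := by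
      have : AnalyticAt ℂ (logDeriv G) 0 := hGan.deriv.div hGan (by rw [hG0]; simp)
      exact this.differentiableAt
    have hloc : logDeriv F =ᶠ[nhds 0] fun s =>
        (∑ ρ ∈ S, (k ρ : ℂ) * (1 / (s - ρ))) + logDeriv G s := by
      have e1 : ∀ᶠ s in nhds (0 : ℂ), G s ≠ 0 :=
        hGan.continuousAt.eventually_ne (by rw [hG0]; simp)
      have e2 : ∀ᶠ s in nhds (0 : ℂ), ∀ ρ ∈ S, s ≠ ρ := by
        rw [Filter.eventually_all_finset]
        intro ρ hρ
        exact continuousAt_id.eventually_ne (hS0 ρ hρ).symm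
      filter_upwards [e1, e2, Metric.isOpen_ball.mem_nhds hz] with s h1 h2 h3
      have hne : ∀ ρ ∈ S, 1 - s / ρ ≠ 0 := by
        intro ρ hρ h
        have h4 := hS0 ρ hρ
        field_simp at h
        exact h2 ρ hρ (by linear_combination -h)
      have hFe : F = fun s => (∏ ρ ∈ S, (1 - s / ρ) ^ k ρ) * G s := funext hFG
      rw [hFe, logDeriv_mul s (Finset.prod_ne_zero_iff.2 fun ρ hρ => pow_ne_zero _ (hne ρ hρ)) h1
        (by fun_prop) (hG.differentiableAt (Metric.isOpen_ball.mem_nhds h3)),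
        logDeriv_prod (f := fun ρ s => (1 - s / ρ) ^ k ρ) (fun ρ hρ => pow_ne_zero _ (hne ρ hρ)) (fun ρ hρ => by fun_prop)]
      congr 1
      apply Finset.sum_congr rfl
      intro ρ hρ
      rw [logDeriv_fun_pow (by fun_prop)]
      congr 1
      have hd : HasDerivAt (fun s : ℂ => 1 - s / ρ) (-(1 / ρ)) s :=
        ((hasDerivAt_id s).div_const ρ).const_sub 1
      rw [logDeriv_apply, hd.deriv]
      have h4 := hS0 ρ hρ
      have h5 := hne ρ hρ
      have h6 : s - ρ ≠ 0 := sub_ne_zero.2 (h2 ρ hρ)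
      rw [div_eq_div_iff h5 h6]
      field_simp
      ring
    rw [hloc.deriv_eq]
    have hsum : HasDerivAt (fun s : ℂ => ∑ ρ ∈ S, (k ρ : ℂ) * (1 / (s - ρ)))
        (∑ ρ ∈ S, (k ρ : ℂ) * (-1 / ρ ^ 2)) 0 := by
      apply HasDerivAt.fun_sum
      intro ρ hρ
      apply HasDerivAt.const_mul
      have h4 := hS0 ρ hρ
      have := ((hasDerivAt_id (0 : ℂ)).sub_const ρ).fun_inv (by simpa using h4)
      simpa using this
    rw [(hsum.fun_add hlG.hasDerivAt).deriv]
    rw [add_right_comm, ← Finset.sum_add_distrib, Finset.sum_eq_zero, zero_add]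
    intro ρ hρ
    ring

noncomputable def auxQ (N : ℕ) (s : ℂ) : ℂ := ∏ m ∈ Finset.range N, (1 + s / ((m : ℂ) + 1))

noncomputable def auxT (N n : ℕ) (s : ℂ) : ℂ :=
  if n < N then (1 / ((n : ℂ) + 1)) * ∏ m ∈ (Finset.range N).erase n, (1 + s / ((m : ℂ) + 1))
  else auxQ N s / (s + n + 1)

noncomputable def auxC (z : ℂ) (n : ℕ) : ℂ := (-1) ^ (n + 1) * z ^ (n + 1) / (Nat.factorial (n + 1) : ℂ)

noncomputable def auxF (z : ℂ) (N : ℕ) (s : ℂ) : ℂ := auxQ N s + s * ∑' n : ℕ, auxC z n * auxT N n s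

noncomputable def auxH (N : ℕ) : ℝ := ∑ m ∈ Finset.range N, 1 / ((m : ℝ) + 1)

lemma auxH_nonneg (N : ℕ) : 0 ≤ auxH N := Finset.sum_nonneg fun _ _ => by positivity

lemma auxH_le (N : ℕ) : auxH N ≤ 2 * √N := by
  have h := harmonic_le_one_add_log N
  have h2 : auxH N = ((harmonic N : ℚ) : ℝ) := by
    simp [auxH, harmonic]
  rcases Nat.eq_zero_or_pos N with rfl | hN
  · simp [auxH]
  have hs : 0 < √(N : ℝ) := Real.sqrt_pos.2 (by exact_mod_cast hN)
  have h3 : Real.log N = 2 * Real.log (√N) := by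
    rw [Real.log_sqrt (by positivity)]; ring
  have h4 := Real.log_le_sub_one_of_pos hs
  rw [h2]
  linarith

lemma auxC_summable (z : ℂ) : Summable (fun n => ‖auxC z n‖) := by
  have h := (summable_nat_add_iff 1).2 (Real.summable_pow_div_factorial ‖z‖)
  refine h.congr fun n => ?_
  simp [auxC]

lemma nat_succ_ne (m : ℕ) : (m : ℂ) + 1 ≠ 0 := by exact_mod_cast Nat.succ_ne_zero m

lemma auxT_eq {N n : ℕ} {s : ℂ} (h : s + n + 1 ≠ 0) : auxT N n s = auxQ N s / (s + n + 1) := by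
  unfold auxT
  split_ifs with hn
  · rw [auxQ, ← Finset.mul_prod_erase _ _ (Finset.mem_range.2 hn)]
    have h1 := nat_succ_ne n
    field_simp
    ring
  · rfl

lemma aux_fac_le (m : ℕ) (s : ℂ) : ‖1 + s / ((m : ℂ) + 1)‖ ≤ Real.exp (‖s‖ * (1 / ((m : ℝ) + 1))) := by
  have h : ‖(m : ℂ) + 1‖ = (m : ℝ) + 1 := by
    exact_mod_cast Complex.norm_natCast (m + 1)
  calc ‖1 + s / ((m : ℂ) + 1)‖ ≤ ‖(1 : ℂ)‖ + ‖s / ((m : ℂ) + 1)‖ := norm_add_le _ _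
    _ = ‖s‖ * (1 / ((m : ℝ) + 1)) + 1 := by rw [norm_one, norm_div, h]; ring
    _ ≤ _ := Real.add_one_le_exp _

lemma aux_prod_le {N : ℕ} {A : Finset ℕ} (hA : A ⊆ Finset.range N) (s : ℂ) :
    ‖∏ m ∈ A, (1 + s / ((m : ℂ) + 1))‖ ≤ Real.exp (‖s‖ * auxH N) := by
  rw [norm_prod]
  calc ∏ m ∈ A, ‖1 + s / ((m : ℂ) + 1)‖ ≤ ∏ m ∈ A, Real.exp (‖s‖ * (1 / ((m : ℝ) + 1))) :=
        Finset.prod_le_prod (fun _ _ => norm_nonneg _) (fun m _ => aux_fac_le m s)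
    _ = Real.exp (∑ m ∈ A, ‖s‖ * (1 / ((m : ℝ) + 1))) := (Real.exp_sum _ _).symm
    _ ≤ _ := by
      apply Real.exp_le_exp.2
      rw [auxH, Finset.mul_sum]
      exact Finset.sum_le_sum_of_subset_of_nonneg hA (fun _ _ _ => by positivity)

lemma aux_den {N n : ℕ} {s : ℂ} (hs : ‖s‖ < N) (hn : N ≤ n) : 1 ≤ ‖s + n + 1‖ := by
  have h : ‖(n : ℂ) + 1‖ = (n : ℝ) + 1 := by
    exact_mod_cast Complex.norm_natCast (n + 1)
  have h2 := norm_sub_norm_le ((n : ℂ) + 1) (-s)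
  rw [h, norm_neg, sub_neg_eq_add] at h2
  have h3 : (n : ℂ) + 1 + s = s + n + 1 := by ring
  rw [h3] at h2
  have : (N : ℝ) ≤ n := by exact_mod_cast hn
  linarith

lemma auxT_le {N n : ℕ} {s : ℂ} (hs : ‖s‖ < N) : ‖auxT N n s‖ ≤ Real.exp (‖s‖ * auxH N) := by
  unfold auxT
  split_ifs with hn
  · rw [norm_mul]
    have h : ‖(n : ℂ) + 1‖ = (n : ℝ) + 1 := by
      exact_mod_cast Complex.norm_natCast (n + 1)
    have h1 : ‖1 / ((n : ℂ) + 1)‖ ≤ 1 := by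
      rw [norm_div, norm_one, h, div_le_one (by positivity)]
      have : (0 : ℝ) ≤ n := by positivity
      linarith
    calc _ ≤ 1 * Real.exp (‖s‖ * auxH N) := by
          gcongr
          exact aux_prod_le (Finset.erase_subset _ _) s
      _ = _ := one_mul _
  · rw [norm_div]
    have h1 := aux_den hs (not_lt.1 hn)
    exact (div_le_self (norm_nonneg _) h1).trans (aux_prod_le subset_rfl s)

lemma auxQ_diff (N : ℕ) : Differentiable ℂ (auxQ N) := by
  unfold auxQ
  fun_prop

lemma auxT_diff (N n : ℕ) : DifferentiableOn ℂ (auxT N n) (Metric.ball 0 N) := by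
  by_cases hn : n < N
  · have : auxT N n = fun s => (1 / ((n : ℂ) + 1)) *
        ∏ m ∈ (Finset.range N).erase n, (1 + s / ((m : ℂ) + 1)) := by
      funext s; simp [auxT, hn]
    rw [this]
    apply Differentiable.differentiableOn
    fun_prop
  · have : auxT N n = fun s => auxQ N s / (s + n + 1) := by
      funext s; simp [auxT, hn]
    rw [this]
    apply (auxQ_diff N).differentiableOn.div (by fun_prop)
    intro s hs h0
    have := aux_den (mem_ball_zero_iff.1 hs) (not_lt.1 hn)
    rw [h0, norm_zero] at this
    linarith

lemma auxCT_le {z : ℂ} {N n : ℕ} {s : ℂ} (hs : ‖s‖ < N) :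
    ‖auxC z n * auxT N n s‖ ≤ ‖auxC z n‖ * Real.exp (‖s‖ * auxH N) := by
  rw [norm_mul]
  gcongr
  exact auxT_le hs

lemma auxCT_summable (z : ℂ) {N : ℕ} {s : ℂ} (hs : ‖s‖ < N) :
    Summable (fun n => auxC z n * auxT N n s) :=
  Summable.of_norm_bounded ((auxC_summable z).mul_right _) fun _ => auxCT_le hs

lemma auxF_diff (z : ℂ) (N : ℕ) : DifferentiableOn ℂ (auxF z N) (Metric.ball 0 N) := by
  unfold auxF
  apply (auxQ_diff N).differentiableOn.add
  apply differentiableOn_id.mul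
  refine Complex.differentiableOn_tsum_of_summable_norm
    (u := fun n => ‖auxC z n‖ * Real.exp (N * auxH N)) ((auxC_summable z).mul_right _)
    (fun n => (auxT_diff N n).const_mul _) Metric.isOpen_ball ?_
  intro n s hs
  have hs' := mem_ball_zero_iff.1 hs
  refine (auxCT_le hs').trans ?_
  have := auxH_nonneg N
  gcongr

lemma auxF_zero (z : ℂ) (N : ℕ) : auxF z N 0 = 1 := by simp [auxF, auxQ]

lemma auxF_le (z : ℂ) {N : ℕ} {s : ℂ} (hs : ‖s‖ < N) :
    ‖auxF z N s‖ ≤ Real.exp (‖s‖ * (auxH N + ∑' n, ‖auxC z n‖)) := by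
  have h1 : ‖∑' n : ℕ, auxC z n * auxT N n s‖ ≤ (∑' n, ‖auxC z n‖) * Real.exp (‖s‖ * auxH N) := by
    rw [← tsum_mul_right]
    exact tsum_of_norm_bounded ((auxC_summable z).mul_right _).hasSum fun _ => auxCT_le hs
  have h2 : ‖auxQ N s‖ ≤ Real.exp (‖s‖ * auxH N) := aux_prod_le subset_rfl s
  calc ‖auxF z N s‖ ≤ ‖auxQ N s‖ + ‖s‖ * ‖∑' n : ℕ, auxC z n * auxT N n s‖ := by
        unfold auxF
        exact (norm_add_le _ _).trans (by rw [norm_mul])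
    _ ≤ Real.exp (‖s‖ * auxH N) + ‖s‖ * ((∑' n, ‖auxC z n‖) * Real.exp (‖s‖ * auxH N)) := by gcongr
    _ = Real.exp (‖s‖ * auxH N) * (‖s‖ * (∑' n, ‖auxC z n‖) + 1) := by ring
    _ ≤ Real.exp (‖s‖ * auxH N) * Real.exp (‖s‖ * (∑' n, ‖auxC z n‖)) := by
        gcongr
        exact Real.add_one_le_exp _
    _ = _ := by rw [← Real.exp_add]; ring_nf

lemma auxQ_eq_zero {N : ℕ} {s : ℂ} (h : auxQ N s = 0) : ∃ m < N, s = -((m + 1 : ℕ) : ℂ) := by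
  rw [auxQ, Finset.prod_eq_zero_iff] at h
  obtain ⟨m, hm, h⟩ := h
  refine ⟨m, Finset.mem_range.1 hm, ?_⟩
  have h1 := nat_succ_ne m
  field_simp at h
  push_cast
  linear_combination h

noncomputable def auxG (z s : ℂ) : ℂ := ∑' n : ℕ, (-1) ^ n * z ^ n / ((Nat.factorial n : ℂ) * (s + n))

lemma auxF_eq (z : ℂ) {N : ℕ} {s : ℂ} (hs : ‖s‖ < N) (h : ∀ n : ℕ, s ≠ -(n : ℂ)) :
    auxF z N s = s * auxQ N s * auxG z s := by
  have hs0 : s ≠ 0 := by simpa using h 0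
  have hQ : auxQ N s ≠ 0 := by
    intro h0
    obtain ⟨m, _, hm⟩ := auxQ_eq_zero h0
    exact h _ hm
  have hne : ∀ n : ℕ, s + n + 1 ≠ 0 := by
    intro n h0
    apply h (n + 1)
    push_cast
    linear_combination h0
  have hT : ∀ n, auxC z n * auxT N n s = auxQ N s *
      ((-1) ^ (n + 1) * z ^ (n + 1) / ((Nat.factorial (n + 1) : ℂ) * (s + (n + 1 : ℕ)))) := by
    intro n
    rw [auxT_eq (hne n), auxC]
    have h1 := hne n
    have h2 : (Nat.factorial (n + 1) : ℂ) ≠ 0 := by exact_mod_cast Nat.factorial_ne_zero _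
    push_cast
    rw [← add_assoc s]
    field_simp
  have hsum := auxCT_summable z hs
  simp_rw [hT] at hsum
  rw [summable_mul_left_iff hQ] at hsum
  have hsum' := (summable_nat_add_iff (f := fun n : ℕ => (-1) ^ n * z ^ n / ((Nat.factorial n : ℂ) * (s + n))) 1).1 hsum
  unfold auxF auxG
  rw [hsum'.tsum_eq_zero_add]
  simp_rw [hT]
  rw [tsum_mul_left]
  simp
  field_simp

lemma auxF_pole {z : ℂ} (hz : z ≠ 0) {N : ℕ} {s : ℂ} (hs : ‖s‖ < N) (n : ℕ) (h : s = -(n : ℂ)) :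
    auxF z N s ≠ 0 := by
  rcases n with _ | n
  · simp at h
    rw [h, auxF_zero]; simp
  have hn : n < N := by
    rw [h, norm_neg, Complex.norm_natCast] at hs
    have : n + 1 < N := by exact_mod_cast hs
    omega
  have hsn : 1 + s / ((n : ℂ) + 1) = 0 := by
    have := nat_succ_ne n
    rw [h]; push_cast; field_simp; ring
  have hQ : auxQ N s = 0 := by
    rw [auxQ]
    exact Finset.prod_eq_zero (Finset.mem_range.2 hn) hsn
  have hs0 : s ≠ 0 := by
    rw [h]; push_cast; exact neg_ne_zero.2 (nat_succ_ne n)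
  unfold auxF
  rw [hQ, zero_add, tsum_eq_single n]
  · refine mul_ne_zero hs0 (mul_ne_zero ?_ ?_)
    · unfold auxC
      have h2 : (Nat.factorial (n + 1) : ℂ) ≠ 0 := by exact_mod_cast Nat.factorial_ne_zero _
      exact div_ne_zero (mul_ne_zero (pow_ne_zero _ (by simp)) (pow_ne_zero _ hz)) h2
    · rw [auxT, if_pos hn]
      refine mul_ne_zero (one_div_ne_zero (nat_succ_ne n)) ?_
      rw [Finset.prod_ne_zero_iff]
      intro m hm h0
      have h1 := nat_succ_ne m
      rw [h] at h0
      field_simp at h0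
      have : (m : ℂ) = n := by push_cast at h0; linear_combination h0
      exact (Finset.mem_erase.1 hm).1 (by exact_mod_cast this)
  · intro m hm
    rw [auxT_eq, hQ, zero_div, mul_zero]
    intro h0
    rw [h] at h0
    have : (m : ℂ) = n := by push_cast at h0; linear_combination h0
    exact hm (by exact_mod_cast this)

lemma auxF_order {z : ℂ} {N : ℕ} {s : ℂ} (hs : ‖s‖ < N) (h : ∀ n : ℕ, s ≠ -(n : ℂ))
    (hg : AnalyticAt ℂ (auxG z) s) : analyticOrderAt (auxF z N) s = analyticOrderAt (auxG z) s := by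
  have hs0 : s ≠ 0 := by simpa using h 0
  have hQ : auxQ N s ≠ 0 := by
    intro h0
    obtain ⟨m, _, hm⟩ := auxQ_eq_zero h0
    exact h _ hm
  have hsQ : AnalyticAt ℂ (fun w => w * auxQ N w) s := by
    have := auxQ_diff N
    apply Differentiable.analyticAt
    fun_prop
  have hsQ0 : s * auxQ N s ≠ 0 := mul_ne_zero hs0 hQ
  have hev : auxF z N =ᶠ[nhds s] (fun w => w * auxQ N w) * auxG z := by
    have e1 : ∀ᶠ w in nhds s, w * auxQ N w ≠ 0 := hsQ.continuousAt.eventually_ne hsQ0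
    have e2 : ∀ᶠ w in nhds s, ‖w‖ < N := by
      have : ContinuousAt (fun w : ℂ => ‖w‖) s := by fun_prop
      exact this.eventually_lt_const hs
    filter_upwards [e1, e2] with w h1 h2
    refine auxF_eq z h2 ?_
    intro n hn
    apply h1
    rcases n with _ | n
    · simp at hn
      simp [hn]
    have hnN : n < N := by
      rw [hn, norm_neg, Complex.norm_natCast] at h2
      have : n + 1 < N := by exact_mod_cast h2
      omega
    have : auxQ N w = 0 := by
      rw [auxQ]
      refine Finset.prod_eq_zero (Finset.mem_range.2 hnN) ?_
      have := nat_succ_ne n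
      rw [hn]; push_cast; field_simp; ring
    rw [this, mul_zero]
  rw [analyticOrderAt_congr hev, analyticOrderAt_mul hsQ hg,
    hsQ.analyticOrderAt_eq_zero.2 hsQ0, zero_add]

lemma auxF_zero_iff {z : ℂ} (hz : z ≠ 0) {N : ℕ} {s : ℂ} (hs : ‖s‖ < N) :
    auxF z N s = 0 ↔ (∀ n : ℕ, s ≠ -(n : ℂ)) ∧ auxG z s = 0 := by
  constructor
  · intro h0
    have h : ∀ n : ℕ, s ≠ -(n : ℂ) := fun n hn => auxF_pole hz hs n hn h0
    refine ⟨h, ?_⟩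
    rw [auxF_eq z hs h] at h0
    have hs0 : s ≠ 0 := by simpa using h 0
    have hQ : auxQ N s ≠ 0 := by
      intro h0
      obtain ⟨m, _, hm⟩ := auxQ_eq_zero h0
      exact h _ hm
    simpa [hs0, hQ] using h0
  · rintro ⟨h, h0⟩
    rw [auxF_eq z hs h, h0, mul_zero]

noncomputable def auxV (z s : ℂ) : ℂ := ∑' n : ℕ, auxC z n / (s + n + 1)

lemma aux_half {n : ℕ} {s : ℂ} (hs : ‖s‖ < 1 / 2) : 1 / 2 ≤ ‖s + n + 1‖ := by
  have h : ‖(n : ℂ) + 1‖ = (n : ℝ) + 1 := by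
    exact_mod_cast Complex.norm_natCast (n + 1)
  have h2 := norm_sub_norm_le ((n : ℂ) + 1) (-s)
  rw [h, norm_neg, sub_neg_eq_add] at h2
  have h3 : (n : ℂ) + 1 + s = s + n + 1 := by ring
  rw [h3] at h2
  have : (0 : ℝ) ≤ n := by positivity
  linarith

lemma aux_half_ne {n : ℕ} {s : ℂ} (hs : ‖s‖ < 1 / 2) : s + n + 1 ≠ 0 := by
  intro h
  have := aux_half (n := n) hs
  rw [h, norm_zero] at this
  linarith

lemma auxV_terms_diff (z : ℂ) (n : ℕ) :
    DifferentiableOn ℂ (fun s : ℂ => auxC z n / (s + n + 1)) (Metric.ball 0 (1 / 2)) := by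
  apply (differentiableOn_const _).div (by fun_prop)
  intro s hs
  exact aux_half_ne (mem_ball_zero_iff.1 hs)

lemma auxV_terms_le (z : ℂ) (n : ℕ) : ∀ s ∈ Metric.ball (0 : ℂ) (1 / 2),
    ‖auxC z n / (s + n + 1)‖ ≤ ‖auxC z n‖ * 2 := by
  intro s hs
  have := aux_half (n := n) (mem_ball_zero_iff.1 hs)
  rw [norm_div, div_le_iff₀ (by linarith)]
  nlinarith [norm_nonneg (auxC z n)]

lemma auxV_diff (z : ℂ) : DifferentiableOn ℂ (auxV z) (Metric.ball 0 (1 / 2)) :=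
  Complex.differentiableOn_tsum_of_summable_norm ((auxC_summable z).mul_right 2)
    (auxV_terms_diff z) Metric.isOpen_ball (auxV_terms_le z)

lemma auxV_zero (z : ℂ) : auxV z 0 = -∑' k : ℕ, (-1) ^ k * z ^ (k + 1) /
      (((k : ℂ) + 1) * (Nat.factorial (k + 1) : ℂ)) := by
  rw [auxV, ← tsum_neg]
  congr 1
  funext n
  have h1 := nat_succ_ne n
  have h2 : (Nat.factorial (n + 1) : ℂ) ≠ 0 := by exact_mod_cast Nat.factorial_ne_zero _
  rw [auxC, zero_add]
  field_simp
  ring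

lemma auxV_deriv (z : ℂ) : deriv (auxV z) 0 = ∑' k : ℕ, (-1) ^ k * z ^ (k + 1) /
      (((k : ℂ) + 1) ^ 2 * (Nat.factorial (k + 1) : ℂ)) := by
  have h := Complex.hasSum_deriv_of_summable_norm (z := 0) ((auxC_summable z).mul_right 2)
    (auxV_terms_diff z) Metric.isOpen_ball (auxV_terms_le z) (Metric.mem_ball_self (by norm_num))
  change HasSum _ (deriv (auxV z) 0) at h
  rw [← h.tsum_eq]
  congr 1
  funext n
  have h1 := nat_succ_ne n
  have h2 : (Nat.factorial (n + 1) : ℂ) ≠ 0 := by exact_mod_cast Nat.factorial_ne_zero _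
  have hd : HasDerivAt (fun s : ℂ => auxC z n / (s + n + 1)) (-auxC z n / ((n : ℂ) + 1) ^ 2) 0 := by
    have h3 : HasDerivAt (fun s : ℂ => s + n + 1) 1 0 :=
      ((hasDerivAt_id (0 : ℂ)).add_const _).add_const _
    have := (hasDerivAt_const (0 : ℂ) (auxC z n)).fun_div h3 (by simpa using h1)
    simpa using this
  rw [hd.deriv, auxC]
  field_simp
  ring

lemma auxF_near (z : ℂ) (N : ℕ) {s : ℂ} (hs : ‖s‖ < 1 / 2) :
    auxF z N s = auxQ N s * (1 + s * auxV z s) := by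
  unfold auxF auxV
  have : ∀ n, auxC z n * auxT N n s = auxQ N s * (auxC z n / (s + n + 1)) := by
    intro n
    rw [auxT_eq (aux_half_ne hs)]
    ring
  simp_rw [this]
  rw [tsum_mul_left]
  ring

lemma auxU_deriv2 (z : ℂ) : HasDerivAt (logDeriv (fun s => 1 + s * auxV z s))
    (2 * deriv (auxV z) 0 - auxV z 0 ^ 2) 0 := by
  have hmem : Metric.ball (0 : ℂ) (1 / 2) ∈ nhds (0 : ℂ) := Metric.ball_mem_nhds _ (by norm_num)
  have hder : ∀ s ∈ Metric.ball (0 : ℂ) (1 / 2),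
      HasDerivAt (fun s => 1 + s * auxV z s) (auxV z s + s * deriv (auxV z) s) s := by
    intro s hs
    have h1 : HasDerivAt (auxV z) (deriv (auxV z) s) s :=
      ((auxV_diff z).differentiableAt (Metric.isOpen_ball.mem_nhds hs)).hasDerivAt
    have := ((hasDerivAt_id s).fun_mul h1).const_add 1
    simpa using this
  have h0 := hder 0 (Metric.mem_ball_self (by norm_num))
  have hV : HasDerivAt (auxV z) (deriv (auxV z) 0) 0 :=
      ((auxV_diff z).differentiableAt hmem).hasDerivAt
  have hV' : HasDerivAt (deriv (auxV z)) (deriv (deriv (auxV z)) 0) 0 :=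
      (((auxV_diff z).deriv Metric.isOpen_ball).differentiableAt hmem).hasDerivAt
  have hnum := hV.fun_add ((hasDerivAt_id (0 : ℂ)).fun_mul hV')
  have hq := hnum.fun_div h0 (by simp)
  have heq : logDeriv (fun s => 1 + s * auxV z s) =ᶠ[nhds 0]
      fun s => (auxV z s + id s * deriv (auxV z) s) / (1 + s * auxV z s) := by
    filter_upwards [hmem] with s hs
    rw [logDeriv_apply, (hder s hs).deriv]
    rfl
  refine (hq.congr_of_eventuallyEq heq).congr_deriv ?_
  simp
  ring

lemma auxF_deriv2 (z : ℂ) (N : ℕ) : deriv (logDeriv (auxF z N)) 0 =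
    2 * deriv (auxV z) 0 - auxV z 0 ^ 2 - ∑ m ∈ Finset.range N, 1 / ((m : ℂ) + 1) ^ 2 := by
  have hmem : Metric.ball (0 : ℂ) (1 / 2) ∈ nhds (0 : ℂ) := Metric.ball_mem_nhds _ (by norm_num)
  have hud : DifferentiableOn ℂ (fun s => 1 + s * auxV z s) (Metric.ball (0 : ℂ) (1 / 2)) :=
    (differentiableOn_id.mul (auxV_diff z)).const_add 1
  have hFe : auxF z N =ᶠ[nhds 0] fun s => auxQ N s * (1 + s * auxV z s) := by
    filter_upwards [hmem] with s hs using auxF_near z N (mem_ball_zero_iff.1 hs)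
  have e1 : ∀ᶠ s in nhds (0 : ℂ), 1 + s * auxV z s ≠ 0 :=
    (hud.differentiableAt hmem).continuousAt.eventually_ne (by simp)
  have hloc : logDeriv (auxF z N) =ᶠ[nhds 0] fun s =>
      (∑ m ∈ Finset.range N, 1 / (s + m + 1)) + logDeriv (fun s => 1 + s * auxV z s) s := by
    filter_upwards [hFe.eventuallyEq_nhds, hmem, e1] with s h1 h2 h3
    have hs := mem_ball_zero_iff.1 h2
    have hne : ∀ m ∈ Finset.range N, 1 + s / ((m : ℂ) + 1) ≠ 0 := by
      intro m _ h0
      have h4 := nat_succ_ne m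
      field_simp at h0
      exact aux_half_ne (n := m) hs (by linear_combination h0)
    have : logDeriv (auxF z N) s = logDeriv (fun s => auxQ N s * (1 + s * auxV z s)) s := by
      rw [logDeriv_apply, logDeriv_apply, h1.deriv_eq, h1.eq_of_nhds]
    rw [this, logDeriv_mul s (Finset.prod_ne_zero_iff.2 hne) h3 (auxQ_diff N s)
      (hud.differentiableAt (Metric.isOpen_ball.mem_nhds h2))]
    congr 1
    unfold auxQ
    rw [logDeriv_prod (f := fun (m : ℕ) s => 1 + s / ((m : ℂ) + 1)) hne (fun m _ => by fun_prop)]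
    apply Finset.sum_congr rfl
    intro m hm
    have hd : HasDerivAt (fun s : ℂ => 1 + s / ((m : ℂ) + 1)) (1 / ((m : ℂ) + 1)) s :=
        ((hasDerivAt_id s).div_const _).const_add 1
    rw [logDeriv_apply, hd.deriv]
    have h4 := nat_succ_ne m
    have h5 := hne m hm
    have h6 := aux_half_ne (n := m) hs
    rw [div_eq_div_iff h5 h6]
    field_simp
    ring
  rw [hloc.deriv_eq]
  have hsum : HasDerivAt (fun s : ℂ => ∑ m ∈ Finset.range N, 1 / (s + m + 1))
      (∑ m ∈ Finset.range N, (-1 / ((m : ℂ) + 1) ^ 2)) 0 := by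
    apply HasDerivAt.fun_sum
    intro m _
    have h1 := nat_succ_ne m
    have h3 : HasDerivAt (fun s : ℂ => s + m + 1) 1 0 :=
      ((hasDerivAt_id (0 : ℂ)).add_const _).add_const _
    have := h3.fun_inv (by simpa using h1)
    simpa using this
  rw [(hsum.fun_add (auxU_deriv2 z)).deriv]
  have : ∑ m ∈ Finset.range N, (-1 / ((m : ℂ) + 1) ^ 2)
      = - ∑ m ∈ Finset.range N, 1 / ((m : ℂ) + 1) ^ 2 := by
    rw [← Finset.sum_neg_distrib]
    apply Finset.sum_congr rfl
    intro m _
    ring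
  rw [this]
  ring

lemma aux_zeta : Filter.Tendsto (fun N => ∑ m ∈ Finset.range N, 1 / ((m : ℂ) + 1) ^ 2)
    Filter.atTop (nhds ((Real.pi : ℂ) ^ 2 / 6)) := by
  have h := hasSum_zeta_two
  have h2 : HasSum (fun m : ℕ => 1 / ((m : ℝ) + 1) ^ 2) (Real.pi ^ 2 / 6) := by
    have := (hasSum_nat_add_iff' (f := fun n : ℕ => (1 : ℝ) / (n : ℝ) ^ 2) 1).2 h
    simpa using this
  have h3 := Complex.hasSum_ofReal.2 h2
  push_cast at h3
  exact h3.tendsto_sum_nat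

lemma aux_finite {z : ℂ} (hz : z ≠ 0) (R : ℕ) :
    {ρ : ℂ | ‖ρ‖ ≤ R ∧ (∀ n : ℕ, ρ ≠ -(n : ℂ)) ∧ auxG z ρ = 0}.Finite := by
  by_contra hinf
  have hinf : Set.Infinite _ := hinf
  obtain ⟨x, hx, hacc⟩ := hinf.exists_accPt_of_subset_isCompact
    (isCompact_closedBall (0 : ℂ) R) (fun ρ hρ => by simpa using hρ.1)
  set N := R + 1
  have hsub : ∀ w : ℂ, ‖w‖ ≤ R → ‖w‖ < (N : ℝ) := fun w hw => by
    push_cast [N]; linarith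
  have hfr : ∃ᶠ w in nhdsWithin x {x}ᶜ, auxF z N w = 0 := by
    rw [accPt_iff_frequently_nhdsNE] at hacc
    refine hacc.mono fun w hw => ?_
    exact (auxF_zero_iff hz (hsub w hw.1)).2 hw.2
  have hx' : ‖x‖ ≤ R := by simpa using hx
  have han : AnalyticOnNhd ℂ (auxF z N) (Metric.ball 0 N) :=
    (auxF_diff z N).analyticOnNhd Metric.isOpen_ball
  have := han.eqOn_zero_of_preconnected_of_frequently_eq_zero
    (convex_ball (0 : ℂ) N).isPreconnected (mem_ball_zero_iff.2 (hsub x hx')) hfr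
  have h0 := this (Metric.mem_ball_self (by positivity))
  rw [auxF_zero] at h0
  simp at h0

lemma aux_key {z : ℂ} (hz : z ≠ 0) (k : ℂ → ℕ)
    (hk : ∀ ρ : ℂ, ((∀ n : ℕ, ρ ≠ -(n : ℂ)) ∧ auxG z ρ = 0) →
      ∃ _ : AnalyticAt ℂ (auxG z) ρ, analyticOrderAt (auxG z) ρ = (k ρ : ℕ∞)) :
    ∃ D : ℝ, 0 < D ∧ ∀ n : ℕ, ∃ S : Finset ℂ,
      (∀ ρ, ρ ∈ S ↔ ‖ρ‖ ≤ (n + 1 : ℝ) ∧ ((∀ n : ℕ, ρ ≠ -(n : ℂ)) ∧ auxG z ρ = 0)) ∧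
      (∑ ρ ∈ S, (k ρ : ℝ)) ≤ D * ((n + 1 : ℝ) * √(n + 1 : ℝ)) ∧
      ‖deriv (logDeriv (auxF z (5 * (n + 1)))) 0 + ∑ ρ ∈ S, (k ρ : ℂ) / ρ ^ 2‖ ≤
        16 * D / √(n + 1 : ℝ) := by
  set K := ∑' n, ‖auxC z n‖ with hK
  have hK0 : 0 ≤ K := tsum_nonneg fun _ => norm_nonneg _
  refine ⟨4 * (5 + K), by positivity, fun n => ?_⟩
  set R : ℝ := n + 1 with hR
  have hR1 : 1 ≤ R := by rw [hR]; have : (0 : ℝ) ≤ n := by positivity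
                         linarith
  set N := 5 * (n + 1) with hN
  have hNR : (N : ℝ) = 5 * R := by push_cast [hN, hR]; ring
  have hsq1 : 1 ≤ √R := Real.one_le_sqrt.2 hR1
  have hsqR : √R * √R = R := Real.mul_self_sqrt (by linarith)
  have hH : auxH N ≤ 5 * √R := by
    refine (auxH_le N).trans ?_
    rw [hNR, Real.sqrt_mul (by norm_num)]
    have : √(5 : ℝ) ≤ 5 / 2 := by
      rw [Real.sqrt_le_left (by norm_num)]
      norm_num
    nlinarith
  have hmem : ∀ ρ, ρ ∈ (aux_finite hz (n + 1)).toFinset ↔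
      ‖ρ‖ ≤ R ∧ ((∀ n : ℕ, ρ ≠ -(n : ℂ)) ∧ auxG z ρ = 0) := by
    intro ρ
    rw [Set.Finite.mem_toFinset]
    simp [hR]
  have hB : 0 < 4 * (5 + K) * (R * √R) := by positivity
  have main := aux_main (R := R) (T := N) (B := 4 * (5 + K) * (R * √R)) (by linarith)
    (by rw [hNR]; linarith) hB (auxF_diff z N) (auxF_zero z N)
    (fun s hs => by
      refine (auxF_le z (by rw [hNR]; linarith)).trans (Real.exp_le_exp.2 ?_)
      have hh := auxH_nonneg N
      rw [← hK]
      calc ‖s‖ * (auxH N + K) ≤ (4 * R) * (5 * √R + K * √R) := by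
            gcongr
            nlinarith
        _ = _ := by ring)
    k (aux_finite hz (n + 1)).toFinset
    (fun ρ => by
      rw [hmem]
      refine and_congr_right fun h => ?_
      rw [auxF_zero_iff hz (by rw [hNR]; linarith)])
    (fun ρ hρ => by
      rw [hmem] at hρ
      obtain ⟨ha, ho⟩ := hk ρ hρ.2
      rw [auxF_order (by rw [hNR]; linarith) hρ.2.1 ha, ho])
  refine ⟨_, hmem, main.1, main.2.trans (le_of_eq ?_)⟩
  have : R ^ 2 = R * √R * √R := by rw [mul_assoc, hsqR]; ring
  rw [this]
  field_simp

lemma aux_sum (Z : ℂ → Prop) (k : ℂ → ℕ) {D : ℝ} (hD : 0 < D) (S : ℕ → Finset ℂ)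
    (hS : ∀ n ρ, ρ ∈ S n ↔ ‖ρ‖ ≤ (n + 1 : ℝ) ∧ Z ρ)
    (hc : ∀ n : ℕ, (∑ ρ ∈ S n, (k ρ : ℝ)) ≤ D * ((n + 1 : ℝ) * √(n + 1 : ℝ)))
    (c : ℕ → ℂ) (L : ℂ) (hL : Filter.Tendsto c Filter.atTop (nhds L))
    (hd : ∀ n : ℕ, ‖c n + ∑ ρ ∈ S n, (k ρ : ℂ) / ρ ^ 2‖ ≤ 16 * D / √(n + 1 : ℝ)) :
    Summable (fun ρ : {ρ : ℂ // Z ρ} => (k ρ : ℂ) / (ρ : ℂ) ^ 2) ∧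
    ∑' ρ : {ρ : ℂ // Z ρ}, (k ρ : ℂ) / (ρ : ℂ) ^ 2 = -L := by
  classical
  set A : ℕ → Finset {ρ : ℂ // Z ρ} := fun n => (S n).subtype Z with hA
  have hAmem : ∀ n (ρ : {ρ : ℂ // Z ρ}), ρ ∈ A n ↔ ‖(ρ : ℂ)‖ ≤ (n + 1 : ℝ) := by
    intro n ρ
    rw [hA, Finset.mem_subtype, hS]
    exact and_iff_left ρ.2
  have hSZ : ∀ n, ∀ ρ ∈ S n, Z ρ := fun n ρ h => ((hS n ρ).1 h).2
  have hsumm : Summable (fun ρ : {ρ : ℂ // Z ρ} => (k ρ : ℂ) / (ρ : ℂ) ^ 2) := by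
    have hex : ∀ ρ : {ρ : ℂ // Z ρ}, ∃ j : ℕ, ‖(ρ : ℂ)‖ ≤ 2 ^ j := fun ρ =>
      (pow_unbounded_of_one_lt ‖(ρ : ℂ)‖ one_lt_two).imp fun _ h => h.le
    set J : {ρ : ℂ // Z ρ} → ℕ := fun ρ => Nat.find (hex ρ) with hJ
    have hJle : ∀ ρ : {ρ : ℂ // Z ρ}, ‖(ρ : ℂ)‖ ≤ 2 ^ J ρ := fun ρ => Nat.find_spec (hex ρ)
    have hw : Summable (fun ρ : {ρ : ℂ // Z ρ} => (k ρ : ℝ) * (1 / 4) ^ J ρ) := by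
      have hq0 : (0 : ℝ) < √2 := by positivity
      have hgeo : Summable (fun j : ℕ => D * (1 / √2) ^ j) := by
        apply Summable.mul_left
        apply summable_geometric_of_lt_one (by positivity)
        rw [div_lt_one hq0]
        exact Real.lt_sqrt_of_sq_lt (by norm_num)
      refine summable_of_sum_le (c := ∑' j : ℕ, D * (1 / √2) ^ j)
        (fun ρ => by positivity) (fun u => ?_)
      rw [← Finset.sum_fiberwise_of_maps_to (t := u.image J) (g := J)
        (fun x hx => Finset.mem_image_of_mem J hx)]
      refine le_trans (Finset.sum_le_sum fun j _ => ?_)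
        (hgeo.sum_le_tsum (u.image J) (fun j _ => by positivity))
      have h2j : ((2 ^ j - 1 : ℕ) : ℝ) + 1 = 2 ^ j := by
        have : 1 ≤ 2 ^ j := Nat.one_le_two_pow
        push_cast [Nat.cast_sub this]
        ring
      calc ∑ x ∈ u with J x = j, (k x : ℝ) * (1 / 4) ^ J x
          = (∑ x ∈ u with J x = j, (k x : ℝ)) * (1 / 4) ^ j := by
            rw [Finset.sum_mul]
            apply Finset.sum_congr rfl
            intro x hx
            rw [(Finset.mem_filter.1 hx).2]
        _ ≤ (∑ x ∈ A (2 ^ j - 1), (k x : ℝ)) * (1 / 4) ^ j := by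
            gcongr
            intro x hx
            rw [hAmem, h2j]
            have := hJle x
            rwa [(Finset.mem_filter.1 hx).2] at this
        _ = (∑ ρ ∈ S (2 ^ j - 1), (k ρ : ℝ)) * (1 / 4) ^ j := by
            congr 1
            exact Finset.sum_subtype_of_mem (fun ρ : ℂ => (k ρ : ℝ)) (hSZ _)
        _ ≤ (D * ((2 : ℝ) ^ j * √(2 ^ j))) * (1 / 4) ^ j := by
            have := hc (2 ^ j - 1)
            rw [h2j] at this
            gcongr
        _ = _ := by
            have h1 : √((2 : ℝ) ^ j) = √2 ^ j := by
              have : (2 : ℝ) ^ j = (√2 ^ j) ^ 2 := by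
                rw [← pow_mul, mul_comm, pow_mul, Real.sq_sqrt (by norm_num)]
              rw [this, Real.sqrt_sq (by positivity)]
            have h2 : (1 / √2 : ℝ) = 2 * √2 * (1 / 4) := by
              have : √2 * √2 = (2 : ℝ) := Real.mul_self_sqrt (by norm_num)
              field_simp
              linarith
            rw [h1, h2, mul_pow, mul_pow]
            ring
    refine (hw.mul_left 4).of_norm_bounded_eventually ?_
    have hfin : {ρ : {ρ : ℂ // Z ρ} | ¬ (1 < ‖(ρ : ℂ)‖)}.Finite := by
      refine (A 0).finite_toSet.subset ?_
      intro ρ hρ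
      have h1 : ‖(ρ : ℂ)‖ ≤ 1 := not_lt.1 hρ
      rw [Finset.mem_coe, hAmem]
      simpa using h1
    filter_upwards [show ∀ᶠ ρ : {ρ : ℂ // Z ρ} in Filter.cofinite, 1 < ‖(ρ : ℂ)‖ from hfin]
      with ρ hρ
    rw [norm_div, norm_pow, Complex.norm_natCast]
    obtain ⟨i, hi⟩ : ∃ i, J ρ = i + 1 := by
      apply Nat.exists_eq_succ_of_ne_zero
      intro h0
      have := hJle ρ
      rw [h0, pow_zero] at this
      linarith
    have hlt : (2 : ℝ) ^ i < ‖(ρ : ℂ)‖ := by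
      have : i < Nat.find (hex ρ) := by
        have : Nat.find (hex ρ) = i + 1 := hi
        omega
      exact not_le.1 (Nat.find_min (hex ρ) this)
    have h4 : (4 : ℝ) ^ i ≤ ‖(ρ : ℂ)‖ ^ 2 := by
      have : (4 : ℝ) ^ i = (2 ^ i) ^ 2 := by
        rw [← pow_mul, mul_comm, pow_mul]; norm_num
      rw [this]
      gcongr
    rw [hi]
    calc (k ρ : ℝ) / ‖(ρ : ℂ)‖ ^ 2 ≤ (k ρ : ℝ) / 4 ^ i := by gcongr
      _ = _ := by rw [pow_succ, div_pow, one_pow]; ring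
  refine ⟨hsumm, ?_⟩
  have hAt : Filter.Tendsto A Filter.atTop Filter.atTop := by
    apply Filter.tendsto_atTop_finset_of_monotone
    · intro m n hmn ρ hρ
      rw [hAmem] at hρ ⊢
      have : (m : ℝ) ≤ n := by exact_mod_cast hmn
      linarith
    · intro ρ
      obtain ⟨n, hn⟩ := exists_nat_ge ‖(ρ : ℂ)‖
      exact ⟨n, by rw [hAmem]; linarith⟩
  have h1 := hsumm.hasSum.comp hAt
  have h2 : Filter.Tendsto (fun n => c n + ∑ ρ ∈ S n, (k ρ : ℂ) / ρ ^ 2)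
      Filter.atTop (nhds 0) := by
    apply squeeze_zero_norm hd
    apply Filter.Tendsto.div_atTop tendsto_const_nhds
    apply Real.tendsto_sqrt_atTop.comp
    exact Filter.tendsto_atTop_add_const_right _ _ tendsto_natCast_atTop_atTop
  have h3 := h2.sub hL
  refine tendsto_nhds_unique h1 ?_
  have : (fun n => c n + ∑ ρ ∈ S n, (k ρ : ℂ) / ρ ^ 2 - c n) =
      (fun s => ∑ ρ ∈ s, (k (ρ : {ρ : ℂ // Z ρ}) : ℂ) / (ρ : ℂ) ^ 2) ∘ A := by
    funext n
    rw [Function.comp, hA, Finset.sum_subtype_of_mem (fun ρ : ℂ => (k ρ : ℂ) / ρ ^ 2) (hSZ n)]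
    ring
  rw [← this]
  simpa using h3

/-- Equation (3.6): for fixed nonzero `z`, the zeros `ρ` (of order `k_ρ`, all away from the
poles `0, -1, -2, …`) of the meromorphic function `s ↦ ∑_{n≥0} (-1)^n z^n/(n!(s+n))
= z^{-s}γ(s,z)` satisfy `∑_ρ k_ρ/ρ² = Ein(z)² - 2a₂(z) + π²/6`, where
`Ein(z) = ∑_{k≥1} (-1)^{k+1} z^k/(k·k!)` and `a₂(z) = ∑_{k≥1} (-1)^{k+1} z^k/(k²·k!)`. -/
theorem sum_inv_sq_zeros_incomplete_gamma_in_s (z : ℂ) (hz : z ≠ 0)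
    (g : ℂ → ℂ)
    (hg : g = fun s => ∑' n : ℕ, (-1) ^ n * z ^ n / ((Nat.factorial n : ℂ) * (s + n)))
    (Ein a₂ : ℂ)
    (hEin : Ein = ∑' k : ℕ, (-1) ^ k * z ^ (k + 1) /
      (((k : ℂ) + 1) * (Nat.factorial (k + 1) : ℂ)))
    (ha₂ : a₂ = ∑' k : ℕ, (-1) ^ k * z ^ (k + 1) /
      (((k : ℂ) + 1) ^ 2 * (Nat.factorial (k + 1) : ℂ)))
    (k : ℂ → ℕ)
    (hk : ∀ ρ : ℂ, ((∀ n : ℕ, ρ ≠ -(n : ℂ)) ∧ g ρ = 0) →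
      ∃ h : AnalyticAt ℂ g ρ, analyticOrderAt g ρ = (k ρ : ℕ∞)) :
    Summable (fun ρ : {ρ : ℂ // (∀ n : ℕ, ρ ≠ -(n : ℂ)) ∧ g ρ = 0} =>
      (k ρ : ℂ) / (ρ : ℂ) ^ 2) ∧
    ∑' ρ : {ρ : ℂ // (∀ n : ℕ, ρ ≠ -(n : ℂ)) ∧ g ρ = 0}, (k ρ : ℂ) / (ρ : ℂ) ^ 2
      = Ein ^ 2 - 2 * a₂ + (Real.pi : ℂ) ^ 2 / 6 := by
  have hgG : g = auxG z := hg
  subst hgG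
  obtain ⟨D, hD, hkey⟩ := aux_key hz k hk
  choose S hS hc hd using hkey
  have hL : Filter.Tendsto (fun n : ℕ => deriv (logDeriv (auxF z (5 * (n + 1)))) 0) Filter.atTop
      (nhds (2 * deriv (auxV z) 0 - auxV z 0 ^ 2 - (Real.pi : ℂ) ^ 2 / 6)) := by
    simp_rw [auxF_deriv2]
    apply Filter.Tendsto.sub tendsto_const_nhds
    refine aux_zeta.comp (Filter.tendsto_atTop_mono (fun n => ?_) Filter.tendsto_id)
    simp only [id]
    omega
  obtain ⟨h1, h2⟩ := aux_sum (fun ρ => (∀ n : ℕ, ρ ≠ -(n : ℂ)) ∧ auxG z ρ = 0) k hD S hS hc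
    _ _ hL hd
  refine ⟨h1, h2.trans ?_⟩
  rw [auxV_deriv, auxV_zero, ← hEin, ← ha₂]
  ring
end

section
/- Let Z = {ρ ∈ ℂ : ζ(ρ) = 0 and 0 < Re ρ < 1} be the set of nontrivial zeros of the Riemann zeta function, and for ρ ∈ Z let k_ρ be the order of the zero of ζ at ρ. Then the series ∑_{ρ∈Z} k_ρ/ρ² converges absolutely and ∑_{ρ∈Z} k_ρ/ρ² = 1 − π²/8 + γ² + 2γ₁, where γ is the Euler–Mascheroni constant and γ₁ = lim_{N→∞} (∑_{k=1}^N (ln k)/k − (ln N)²/2) is the first Stieltjes constant. -/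
open Complex Real

namespace ZetaSum
open Filter Topology Metric

lemma exists_factor_one {f : ℂ → ℂ} (hf : Differentiable ℂ f) {a : ℂ} {k : ℕ}
    (ho : analyticOrderAt f a = k) :
    ∃ g : ℂ → ℂ, Differentiable ℂ g ∧ (∀ z, f z = (z - a) ^ k * g z) ∧ g a ≠ 0 := by
  have hfa : AnalyticAt ℂ f a := hf.analyticAt a
  obtain ⟨g₀, h1, h2, h3⟩ := hfa.analyticOrderAt_eq_natCast.mp ho
  have h3a := h3.self_of_nhds
  refine ⟨Function.update (fun z => f z / (z - a) ^ k) a (g₀ a), ?_, ?_, by simpa using h2⟩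
  · intro z
    by_cases hz : z = a
    · subst hz
      refine h1.differentiableAt.congr_of_eventuallyEq ?_
      filter_upwards [h3] with w hw
      by_cases hwz : w = z
      · subst hwz; simp
      · rw [Function.update_of_ne hwz, hw, smul_eq_mul,
          mul_div_cancel_left₀ _ (pow_ne_zero _ (sub_ne_zero.mpr hwz))]
    · have : DifferentiableAt ℂ (fun z => f z / (z - a) ^ k) z := by
        refine (hf z).div (by fun_prop) (pow_ne_zero _ (sub_ne_zero.mpr hz))
      refine this.congr_of_eventuallyEq ?_
      filter_upwards [isOpen_ne.mem_nhds hz] with w hw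
      rw [Function.update_of_ne hw]
  · intro z
    by_cases hz : z = a
    · subst hz; simpa using h3a
    · rw [Function.update_of_ne hz, mul_div_cancel₀ _ (pow_ne_zero _ (sub_ne_zero.mpr hz))]

lemma exists_factor {f : ℂ → ℂ} (hf : Differentiable ℂ f) (k : ℂ → ℕ) (S : Finset ℂ)
    (ho : ∀ a ∈ S, analyticOrderAt f a = k a) :
    ∃ g : ℂ → ℂ, Differentiable ℂ g ∧ (∀ z, f z = (∏ a ∈ S, (z - a) ^ k a) * g z) ∧
      ∀ a ∈ S, g a ≠ 0 := by
  classical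
  induction S using Finset.induction_on with
  | empty => exact ⟨f, hf, by simp, by simp⟩
  | insert a S ha ih =>
    obtain ⟨g, hg, hfg, hne⟩ := ih (fun b hb => ho b (Finset.mem_insert_of_mem hb))
    have hP : Differentiable ℂ (fun z : ℂ => ∏ b ∈ S, (z - b) ^ k b) := by fun_prop
    have hPa : (fun z : ℂ => ∏ b ∈ S, (z - b) ^ k b) a ≠ 0 := by
      simp only
      refine Finset.prod_ne_zero_iff.mpr fun b hb => pow_ne_zero _ (sub_ne_zero.mpr ?_)
      rintro rfl; exact ha hb
    have hog : analyticOrderAt g a = k a := by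
      have h1 := ho a (Finset.mem_insert_self _ _)
      have h2 : f = (fun z : ℂ => ∏ b ∈ S, (z - b) ^ k b) * g := by
        ext z; simp [hfg z]
      rw [h2, analyticOrderAt_mul (hP.analyticAt a) (hg.analyticAt a),
        (hP.analyticAt a).analyticOrderAt_eq_zero.mpr hPa, zero_add] at h1
      exact h1
    obtain ⟨g', hg', hgg', hne'⟩ := exists_factor_one hg hog
    refine ⟨g', hg', fun z => ?_, fun b hb => ?_⟩
    · rw [Finset.prod_insert ha, hfg, hgg']; ring
    · rcases Finset.mem_insert.mp hb with rfl | hb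
      · exact hne'
      · intro h0
        apply hne b hb
        rw [hgg', h0, mul_zero]

/-- A nonvanishing function bounded by `exp M` on a disc has small second log derivative. -/
lemma deriv_logDeriv_bound {g : ℂ → ℂ} (hg : Differentiable ℂ g) {R M : ℝ} (hR : 0 < R)
    (hM : 0 < M) (hne : ∀ z ∈ ball (0:ℂ) R, g z ≠ 0) (h0 : g 0 = 1)
    (hb : ∀ z ∈ ball (0:ℂ) R, ‖g z‖ ≤ Real.exp M) :
    ‖deriv (logDeriv g) 0‖ ≤ 16 * M / R ^ 2 := by
  have hdl : DifferentiableOn ℂ (logDeriv g) (ball 0 R) := by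
    intro z hz
    exact ((hg.deriv z).div (hg z) (hne z hz)).differentiableWithinAt
  obtain ⟨h₁, hh₁⟩ := hdl.isExactOn_ball
  set h : ℂ → ℂ := fun z => h₁ z - h₁ 0 with hh
  have hh' : ∀ z ∈ ball (0:ℂ) R, HasDerivAt h (logDeriv g z) z := fun z hz =>
    (hh₁ z hz).sub_const _
  have h00 : h 0 = 0 := by simp [hh]
  have m0 : (0:ℂ) ∈ ball (0:ℂ) R := by simpa using hR
  have hexp : ∀ z ∈ ball (0:ℂ) R, Complex.exp (h z) = g z := by
    have hconst : ∀ z ∈ ball (0:ℂ) R, g z * Complex.exp (- h z) = 1 := by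
      intro z hz
      have hd : ∀ w ∈ ball (0:ℂ) R, HasDerivAt (fun w => g w * Complex.exp (- h w)) 0 w := by
        intro w hw
        have := (hg w).hasDerivAt.mul (hh' w hw).neg.cexp
        refine this.congr_deriv ?_
        rw [logDeriv_apply]
        have := hne w hw
        field_simp
        simp
      have := (convex_ball (0:ℂ) R).is_const_of_fderivWithin_eq_zero (𝕜 := ℂ)
        (f := fun w => g w * Complex.exp (- h w))
        (fun w hw => (hd w hw).differentiableAt.differentiableWithinAt)
        (fun w hw => by
          rw [fderivWithin_of_isOpen isOpen_ball hw]
          have := (hd w hw).hasFDerivAt.fderiv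
          rw [this]; ext; simp) hz m0
      simpa [h00, h0] using this
    intro z hz
    have := hconst z hz
    rw [Complex.exp_neg, mul_inv_eq_one₀ (Complex.exp_ne_zero _)] at this
    exact this.symm
  have hdh : DifferentiableOn ℂ h (ball 0 R) := fun z hz =>
    (hh' z hz).differentiableAt.differentiableWithinAt
  have hre : Set.MapsTo h (ball 0 R) {z | z.re ≤ M} := by
    intro z hz
    have := hb z hz
    rw [← hexp z hz, Complex.norm_exp, Real.exp_le_exp] at this
    exact this
  have hsub : closedBall (0:ℂ) (R/2) ⊆ ball 0 R := closedBall_subset_ball (by linarith)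
  have hbd : ∀ z ∈ sphere (0:ℂ) (R/2), ‖h z‖ ≤ 2 * M := by
    intro z hz
    have hz' := hsub (sphere_subset_closedBall hz)
    have := borelCaratheodory_zero hM hdh hre hR hz' h00
    have hn : ‖z‖ = R / 2 := by simpa using hz
    rw [hn] at this
    refine this.trans (le_of_eq ?_)
    field_simp
    ring
  have hdc : DiffContOnCl ℂ h (ball 0 (R/2)) := by
    apply DifferentiableOn.diffContOnCl
    rw [closure_ball _ (by positivity)]
    exact hdh.mono hsub
  have hC := norm_iteratedDeriv_le_of_forall_mem_sphere_norm_le 2 (by positivity : 0 < R/2) hdc hbd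
  have he : iteratedDeriv 2 h 0 = deriv (logDeriv g) 0 := by
    rw [iteratedDeriv_succ, iteratedDeriv_one]
    apply Filter.EventuallyEq.deriv_eq
    filter_upwards [isOpen_ball.mem_nhds m0] with z hz using (hh' z hz).deriv
  rw [he] at hC
  refine hC.trans (le_of_eq ?_)
  simp [Nat.factorial]
  field_simp
  ring

lemma key_bound {f : ℂ → ℂ} (hf : Differentiable ℂ f) (h0 : f 0 = 1) (k : ℂ → ℕ)
    (S : Finset ℂ) {R M : ℝ} (hR : 0 < R) (hM : 0 < M)
    (hS : ∀ a, a ∈ S ↔ f a = 0 ∧ ‖a‖ ≤ R)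
    (ho : ∀ a ∈ S, analyticOrderAt f a = k a)
    (hb : ∀ z, ‖z‖ ≤ 4 * R → ‖f z‖ ≤ Real.exp M) :
    ‖deriv (logDeriv f) 0 + ∑ a ∈ S, (k a : ℂ) / a ^ 2‖ ≤ 16 * M / R ^ 2 := by
  obtain ⟨g₁, hg₁, hfg₁, hne₁⟩ := exists_factor hf k S ho
  have hS0 : ∀ a ∈ S, a ≠ 0 := by
    rintro a ha rfl
    have := ((hS 0).mp ha).1
    rw [h0] at this; exact one_ne_zero this
  -- normalise
  set c : ℂ := ∏ a ∈ S, (-a) ^ k a with hc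
  have hc0 : c ≠ 0 := Finset.prod_ne_zero_iff.mpr fun a ha =>
    pow_ne_zero _ (neg_ne_zero.mpr (hS0 a ha))
  set g : ℂ → ℂ := fun z => c * g₁ z with hgdef
  have hg : Differentiable ℂ g := hg₁.const_mul c
  have hfg : ∀ z, f z = (∏ a ∈ S, (1 - z / a) ^ k a) * g z := by
    intro z
    rw [hfg₁, hgdef, hc]
    simp only
    rw [← mul_assoc, ← Finset.prod_mul_distrib]
    congr 1
    refine Finset.prod_congr rfl fun a ha => ?_
    rw [← mul_pow]
    congr 1
    field_simp [hS0 a ha]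
    ring
  have hg0 : g 0 = 1 := by
    have := hfg 0
    simpa [h0] using this.symm
  have hne : ∀ z ∈ ball (0:ℂ) R, g z ≠ 0 := by
    intro z hz hgz
    have hfz : f z = 0 := by rw [hfg, hgz, mul_zero]
    have hzS : z ∈ S := (hS z).mpr ⟨hfz, by simpa using (mem_ball_zero_iff.mp hz).le⟩
    rw [hgdef] at hgz
    exact (mul_ne_zero hc0 (hne₁ z hzS)) hgz
  have hbd : ∀ z ∈ closedBall (0:ℂ) (4*R), ‖g z‖ ≤ Real.exp M := by
    intro z hz
    have := Complex.norm_le_of_forall_mem_frontier_norm_le (f := g) (U := ball (0:ℂ) (4*R))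
      (C := Real.exp M) isBounded_ball hg.diffContOnCl ?_
      (z := z) (by rwa [closure_ball _ (by positivity)])
    · exact this
    · intro w hw
      rw [frontier_ball _ (by positivity)] at hw
      have hwn : ‖w‖ = 4 * R := by simpa using hw
      have h1 := hb w hwn.le
      rw [hfg, norm_mul] at h1
      refine le_trans ?_ h1
      refine le_mul_of_one_le_left (norm_nonneg _) ?_
      rw [norm_prod]
      have hall : ∀ a ∈ S, 1 ≤ ‖(1 - w / a) ^ k a‖ := by
        intro a ha
        rw [norm_pow]
        apply one_le_pow₀
        have haR := ((hS a).mp ha).2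
        have hapos : 0 < ‖a‖ := norm_pos_iff.mpr (hS0 a ha)
        have h2 : (4:ℝ) ≤ ‖w / a‖ := by
          rw [norm_div, hwn, le_div_iff₀ hapos]; linarith
        have h3 := norm_sub_norm_le (w / a) 1
        rw [norm_sub_rev, norm_one] at h3
        linarith
      calc (1:ℝ) = ∏ a ∈ S, (1:ℝ) := by simp
        _ ≤ _ := Finset.prod_le_prod (fun _ _ => zero_le_one) hall
  have hB := deriv_logDeriv_bound hg hR hM hne hg0
    (fun z hz => hbd z (ball_subset_closedBall.trans (closedBall_subset_closedBall (by linarith)) hz))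
  have heq : deriv (logDeriv g) 0 = deriv (logDeriv f) 0 + ∑ a ∈ S, (k a : ℂ) / a ^ 2 := by
    have hev : logDeriv f =ᶠ[𝓝 0] fun z => (∑ a ∈ S, (k a : ℂ) * (z - a)⁻¹) + logDeriv g z := by
      have hno : ∀ᶠ z in 𝓝 (0:ℂ), f z ≠ 0 :=
        hf.continuous.continuousAt.eventually_ne (by rw [h0]; exact one_ne_zero)
      filter_upwards [hno] with z hz
      have hfe : f = fun z => (∏ a ∈ S, (1 - z / a) ^ k a) * g z := funext hfg
      have hz' := hz
      rw [hfg] at hz'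
      have hz1 := left_ne_zero_of_mul hz'
      rw [hfe, logDeriv_mul (f := fun z => ∏ a ∈ S, (1 - z / a) ^ k a) (g := g) z hz1
        (right_ne_zero_of_mul hz') (by fun_prop) (hg z)]
      congr 1
      have hz2 := Finset.prod_ne_zero_iff.mp hz1
      rw [logDeriv_prod (f := fun a z => (1 - z / a) ^ k a) hz2 (fun a ha => by fun_prop)]
      refine Finset.sum_congr rfl fun a ha => ?_
      rw [logDeriv_fun_pow (by fun_prop)]
      rcases Nat.eq_zero_or_pos (k a) with hk | hk
      · simp [hk]
      congr 1
      have ha0 := hS0 a ha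
      have h3 : (1 - z / a) ≠ 0 := by
        intro h; exact hz2 a ha (by rw [h, zero_pow hk.ne'])
      have h4 : z - a ≠ 0 := by
        intro h; apply h3; rw [sub_eq_zero.mp h]; simp [ha0]
      have h5 : HasDerivAt (fun z : ℂ => 1 - z / a) (-(1 / a)) z := by
        simpa using ((hasDerivAt_id z).div_const a).const_sub 1
      rw [logDeriv_apply, h5.deriv]
      have h6 : 1 - z / a = -(z - a) / a := by field_simp; ring
      rw [h6]
      field_simp
    rw [hev.deriv_eq]
    have hda : HasDerivAt (fun z : ℂ => (∑ a ∈ S, (k a : ℂ) * (z - a)⁻¹))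
        (∑ a ∈ S, -((k a : ℂ) / a ^ 2)) 0 := by
      refine HasDerivAt.fun_sum fun a ha => ?_
      have := (((hasDerivAt_id (0:ℂ)).sub_const a).inv (by simpa using hS0 a ha)).const_mul (k a : ℂ)
      refine this.congr_deriv ?_
      simp
      ring
    have hdg : DifferentiableAt ℂ (logDeriv g) 0 :=
      (hg.deriv 0).div (hg 0) (by rw [hg0]; exact one_ne_zero)
    rw [(hda.fun_add hdg.hasDerivAt).deriv, Finset.sum_neg_distrib]
    ring
  rw [← heq]; exact hB

lemma term_ineq {a : ℂ} (h0 : 0 < a.re) (h1 : a.re < 1) (k : ℕ) :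
    (k : ℝ) / ‖a‖ ^ 2 ≤ -2 * ((k : ℂ) / a ^ 2).re + (if ‖a‖ ≤ 3 then 4 * (k / ‖a‖ ^ 2) else 0) := by
  have hn : ‖(k : ℂ) / a ^ 2‖ = k / ‖a‖ ^ 2 := by simp
  split_ifs with h
  · have := Complex.re_le_norm ((k : ℂ) / a ^ 2)
    rw [hn] at this
    have : 0 ≤ (k : ℝ) / ‖a‖ ^ 2 := by positivity
    linarith
  · push Not at h
    have ha : a ≠ 0 := by rintro rfl; simp at h0
    have hsq : ‖a‖ ^ 2 = a.re ^ 2 + a.im ^ 2 := by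
      rw [Complex.sq_norm, Complex.normSq_apply]; ring
    have h9 : 9 < a.re ^ 2 + a.im ^ 2 := by rw [← hsq]; nlinarith
    have hre : ((k : ℂ) / a ^ 2).re = k * ((a.re ^ 2 - a.im ^ 2) / (‖a‖ ^ 2) ^ 2) := by
      rw [Complex.div_re]
      have e1 : Complex.normSq (a ^ 2) = (‖a‖ ^ 2) ^ 2 := by
        rw [Complex.normSq_eq_norm_sq, norm_pow]
      rw [e1]
      simp [pow_two]
      ring
    rw [hre, hsq, div_eq_mul_inv]
    have hp : 0 < a.re ^ 2 + a.im ^ 2 := by linarith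
    have key : (a.re ^ 2 + a.im ^ 2)⁻¹ ≤
        -2 * ((a.re ^ 2 - a.im ^ 2) / (a.re ^ 2 + a.im ^ 2) ^ 2) := by
      rw [inv_eq_one_div, ← mul_div_assoc, div_le_div_iff₀ hp (by positivity)]
      have hr : a.re ^ 2 < 1 := by nlinarith
      have h3 : a.re ^ 2 + a.im ^ 2 ≤ -2 * (a.re ^ 2 - a.im ^ 2) := by linarith
      have := mul_le_mul_of_nonneg_right h3 hp.le
      linarith [this]
    have hk : (0:ℝ) ≤ k := Nat.cast_nonneg k
    nlinarith [mul_le_mul_of_nonneg_left key hk]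

lemma sum_zeros {f : ℂ → ℂ} (hf : Differentiable ℂ f) (h0 : f 0 = 1) (k : ℂ → ℕ)
    (Z : Set ℂ) (hZ : ∀ a, a ∈ Z ↔ f a = 0) (hstrip : ∀ a ∈ Z, 0 < a.re ∧ a.re < 1)
    (hfin : ∀ R : ℝ, (Z ∩ closedBall 0 R).Finite)
    (ho : ∀ a ∈ Z, analyticOrderAt f a = k a) (B : ℝ → ℝ)
    (hB : ∀ᶠ R in atTop, 0 < B R ∧ ∀ z, ‖z‖ ≤ R → ‖f z‖ ≤ Real.exp (B R))
    (hBlim : Tendsto (fun R => B R / R ^ 2) atTop (𝓝 0)) :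
    HasSum (fun a : Z => (k a : ℂ) / (a : ℂ) ^ 2) (-deriv (logDeriv f) 0) := by
  classical
  set S : ℕ → Finset ℂ := fun n => (hfin n).toFinset with hSdef
  set S' : ℕ → Finset Z := fun n => (S n).subtype (· ∈ Z) with hS'def
  have hSm : ∀ n a, a ∈ S n ↔ f a = 0 ∧ ‖a‖ ≤ n := by
    intro n a; simp [hSdef, hZ]
  have hS'm : ∀ n (a : Z), a ∈ S' n ↔ ‖(a:ℂ)‖ ≤ n := by
    intro n a; simp [hS'def, hSdef]
  have hsum : ∀ n, ∑ a ∈ S' n, (k a : ℂ) / (a : ℂ) ^ 2 = ∑ a ∈ S n, (k a : ℂ) / a ^ 2 := by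
    intro n
    exact Finset.sum_subtype_of_mem (fun a => (k a : ℂ) / a ^ 2)
      (fun a ha => (hZ a).mpr ((hSm n a).mp ha).1)
  have hlim : Tendsto (fun n => ∑ a ∈ S' n, (k a : ℂ) / (a : ℂ) ^ 2) atTop
      (𝓝 (-deriv (logDeriv f) 0)) := by
    rw [tendsto_iff_norm_sub_tendsto_zero]
    have h4 : Tendsto (fun n : ℕ => 4 * (n : ℝ)) atTop atTop :=
      tendsto_natCast_atTop_atTop.const_mul_atTop (by norm_num)
    have hl : Tendsto (fun n : ℕ => 256 * (B (4 * n) / (4 * (n:ℝ)) ^ 2)) atTop (𝓝 0) := by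
      simpa using (hBlim.comp h4).const_mul 256
    refine squeeze_zero' (Eventually.of_forall fun _ => norm_nonneg _) ?_ hl
    filter_upwards [h4.eventually hB, eventually_gt_atTop 0] with n hn hn0
    have hn0' : (0:ℝ) < n := by exact_mod_cast hn0
    have := key_bound hf h0 k (S n) hn0' hn.1 (hSm n)
      (fun a ha => ho a ((hZ a).mpr ((hSm n a).mp ha).1)) hn.2
    rw [hsum, sub_neg_eq_add, add_comm]
    refine this.trans (le_of_eq ?_)
    field_simp
    ring
  have hmono : Monotone S' := by
    intro m n hmn a ha
    rw [hS'm] at ha ⊢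
    exact ha.trans (by exact_mod_cast hmn)
  have htop : Tendsto S' atTop atTop := by
    refine tendsto_atTop_finset_of_monotone hmono fun a => ?_
    obtain ⟨n, hn⟩ := exists_nat_ge ‖(a:ℂ)‖
    exact ⟨n, (hS'm n a).mpr hn⟩
  obtain ⟨C, hC⟩ := hlim.norm.bddAbove_range
  have hCn : ∀ n, ‖∑ a ∈ S' n, (k a : ℂ) / (a : ℂ) ^ 2‖ ≤ C := fun n => hC ⟨n, rfl⟩
  have hsm : Summable (fun a : Z => (k a : ℝ) / ‖(a : ℂ)‖ ^ 2) := by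
    refine summable_of_sum_le (c := 2 * C + ∑ a ∈ S' 3, 4 * ((k a : ℝ) / ‖(a:ℂ)‖ ^ 2))
      (fun a => by positivity) fun T => ?_
    obtain ⟨n, hn, hTn⟩ := ((eventually_ge_atTop 3).and (htop.eventually_ge_atTop T)).exists
    calc ∑ a ∈ T, (k a : ℝ) / ‖(a : ℂ)‖ ^ 2
        ≤ ∑ a ∈ S' n, (k a : ℝ) / ‖(a : ℂ)‖ ^ 2 :=
          Finset.sum_le_sum_of_subset_of_nonneg hTn (fun _ _ _ => by positivity)
      _ ≤ ∑ a ∈ S' n, (-2 * ((k a : ℂ) / (a:ℂ) ^ 2).re +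
            (if ‖(a:ℂ)‖ ≤ 3 then 4 * ((k a : ℝ) / ‖(a:ℂ)‖ ^ 2) else 0)) :=
          Finset.sum_le_sum fun a _ => term_ineq (hstrip a a.2).1 (hstrip a a.2).2 _
      _ = -2 * (∑ a ∈ S' n, (k a : ℂ) / (a : ℂ) ^ 2).re +
            ∑ a ∈ S' 3, 4 * ((k a : ℝ) / ‖(a:ℂ)‖ ^ 2) := by
          rw [Finset.sum_add_distrib, ← Finset.mul_sum, Complex.re_sum, ← Finset.sum_filter]
          congr 2
          ext a
          simp only [Finset.mem_filter, hS'm]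
          constructor
          · rintro ⟨_, h⟩; exact_mod_cast h
          · intro h
            have h' : ‖(a:ℂ)‖ ≤ 3 := by exact_mod_cast h
            exact ⟨h'.trans (by exact_mod_cast hn), h'⟩
      _ ≤ _ := by
          have h1 := Complex.abs_re_le_norm (∑ a ∈ S' n, (k a : ℂ) / (a : ℂ) ^ 2)
          have h2 := (abs_le.mp (h1.trans (hCn n))).1
          linarith
  have hsm' : Summable (fun a : Z => (k a : ℂ) / (a : ℂ) ^ 2) := by
    refine Summable.of_norm ?_
    simpa using hsm
  have := hsm'.hasSum
  rwa [tendsto_nhds_unique (this.comp htop) hlim] at this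

/-- `P n s = (s - 1) h_n(s)` with `n` shifted by one. -/
noncomputable def P (n : ℕ) (s : ℂ) : ℂ :=
  (s - 1) * ((n + 1 : ℕ) : ℂ) ^ (-s) + ((n + 2 : ℕ) : ℂ) ^ (1 - s) - ((n + 1 : ℕ) : ℂ) ^ (1 - s)

noncomputable def SN (N : ℕ) (s : ℂ) : ℂ :=
  (s - 1) * (∑ n ∈ Finset.range N, ((n + 1 : ℕ) : ℂ) ^ (-s)) + ((N + 1 : ℕ) : ℂ) ^ (1 - s)

lemma SN_eq (N : ℕ) (s : ℂ) : SN N s = 1 + ∑ n ∈ Finset.range N, P n s := by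
  induction N with
  | zero => simp [SN]
  | succ N ih =>
    rw [Finset.sum_range_succ, ← add_assoc, ← ih, SN, SN, P, Finset.sum_range_succ]
    ring

lemma hasDerivAt_nat_cpow (n : ℕ) (hn : n ≠ 0) (c s : ℂ) :
    HasDerivAt (fun s : ℂ => (n : ℂ) ^ (c - s)) (-((n : ℂ) ^ (c - s) * Complex.log n)) s := by
  have h := ((hasDerivAt_id s).const_sub c).const_cpow (c := (n : ℂ))
    (Or.inl (by exact_mod_cast hn))
  refine h.congr_deriv ?_
  simp

lemma hasDerivAt_nat_cpow' (n : ℕ) (hn : n ≠ 0) (s : ℂ) :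
    HasDerivAt (fun s : ℂ => (n : ℂ) ^ (-s)) (-((n : ℂ) ^ (-s) * Complex.log n)) s := by
  simpa using hasDerivAt_nat_cpow n hn 0 s

lemma differentiable_SN (N : ℕ) : Differentiable ℂ (SN N) := by
  intro s
  unfold SN
  refine DifferentiableAt.add (DifferentiableAt.mul (by fun_prop) ?_) ?_
  · exact DifferentiableAt.fun_sum fun n _ =>
      (hasDerivAt_nat_cpow' (n+1) (by omega) s).differentiableAt
  · exact (hasDerivAt_nat_cpow (N+1) (by omega) 1 s).differentiableAt

/-- first derivative of `SN`. -/
lemma hasDerivAt_SN (N : ℕ) (s : ℂ) : HasDerivAt (SN N)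
    ((∑ n ∈ Finset.range N, ((n + 1 : ℕ) : ℂ) ^ (-s)) +
      (s - 1) * (∑ n ∈ Finset.range N,
        -(((n + 1 : ℕ) : ℂ) ^ (-s) * Complex.log ((n + 1 : ℕ) : ℂ))) +
      -(((N + 1 : ℕ) : ℂ) ^ (1 - s) * Complex.log ((N + 1 : ℕ) : ℂ))) s := by
  have h1 : HasDerivAt (fun s : ℂ => ∑ n ∈ Finset.range N, ((n + 1 : ℕ) : ℂ) ^ (-s))
      (∑ n ∈ Finset.range N, -(((n + 1 : ℕ) : ℂ) ^ (-s) * Complex.log ((n + 1 : ℕ) : ℂ))) s :=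
    HasDerivAt.fun_sum fun n _ => hasDerivAt_nat_cpow' (n+1) (by omega) s
  have h2 := ((((hasDerivAt_id s).sub_const 1).fun_mul h1).fun_add
    (hasDerivAt_nat_cpow (N+1) (by omega) 1 s))
  refine (h2.congr_deriv ?_)
  simp

lemma deriv_SN_one (N : ℕ) : deriv (SN N) 1 =
    (((harmonic N : ℚ) : ℝ) - Real.log (N + 1) : ℝ) := by
  rw [(hasDerivAt_SN N 1).deriv]
  simp only [sub_self, zero_mul, add_zero, cpow_zero, one_mul]
  push_cast
  rw [harmonic]
  push_cast
  rw [sub_eq_add_neg]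
  have hl := Complex.natCast_log (n := N + 1)
  push_cast at hl
  rw [hl]
  congr 1
  refine Finset.sum_congr rfl fun n _ => ?_
  rw [cpow_neg_one]

lemma deriv_deriv_SN_one (N : ℕ) : deriv (deriv (SN N)) 1 =
    (-2 * (∑ j ∈ Finset.Icc 1 N, Real.log j / j) + Real.log ((N + 1 : ℕ) : ℝ) ^ 2 : ℝ) := by
  have h : deriv (SN N) = fun s => ((∑ n ∈ Finset.range N, ((n + 1 : ℕ) : ℂ) ^ (-s)) +
      (s - 1) * (∑ n ∈ Finset.range N,
        -(((n + 1 : ℕ) : ℂ) ^ (-s) * Complex.log ((n + 1 : ℕ) : ℂ))) +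
      -(((N + 1 : ℕ) : ℂ) ^ (1 - s) * Complex.log ((N + 1 : ℕ) : ℂ))) :=
    funext fun s => (hasDerivAt_SN N s).deriv
  have h1 : HasDerivAt (fun s : ℂ => ∑ n ∈ Finset.range N, ((n + 1 : ℕ) : ℂ) ^ (-s))
      (∑ n ∈ Finset.range N, -(((n + 1 : ℕ) : ℂ) ^ (-1 : ℂ) * Complex.log ((n + 1 : ℕ) : ℂ))) 1 :=
    HasDerivAt.fun_sum fun n _ => hasDerivAt_nat_cpow' (n+1) (by omega) 1
  have h2 : DifferentiableAt ℂ (fun s : ℂ => ∑ n ∈ Finset.range N,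
        -(((n + 1 : ℕ) : ℂ) ^ (-s) * Complex.log ((n + 1 : ℕ) : ℂ))) 1 :=
    DifferentiableAt.fun_sum fun n _ =>
      ((hasDerivAt_nat_cpow' (n+1) (by omega) 1).differentiableAt.mul_const _).neg
  have h3 := (h1.fun_add (((hasDerivAt_id' (1:ℂ)).sub_const 1).fun_mul h2.hasDerivAt)).fun_add
    (((hasDerivAt_nat_cpow (N+1) (by omega) 1 1).mul_const (Complex.log ((N + 1 : ℕ) : ℂ))).fun_neg)
  rw [h, h3.deriv]
  have hs : ∑ j ∈ Finset.Icc 1 N, Real.log j / j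
      = ∑ n ∈ Finset.range N, Real.log ((n + 1 : ℕ) : ℝ) / ((n + 1 : ℕ) : ℝ) := by
    rw [Finset.range_eq_Ico, Finset.sum_Ico_add' (fun n : ℕ => Real.log (n : ℝ) / (n : ℝ)) 0 N 1]
    rfl
  rw [hs]
  have e1 : ∑ n ∈ Finset.range N, -(((n + 1 : ℕ) : ℂ) ^ (-1 : ℂ) * Complex.log ((n + 1 : ℕ) : ℂ))
     = -((∑ n ∈ Finset.range N, Real.log ((n + 1 : ℕ) : ℝ) / ((n + 1 : ℕ) : ℝ) : ℝ) : ℂ) := by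
    rw [Finset.sum_neg_distrib, ofReal_sum]
    congr 1
    refine Finset.sum_congr rfl fun n _ => ?_
    rw [cpow_neg_one, ofReal_div, ← natCast_log, ofReal_natCast]
    ring
  simp only [sub_self, cpow_zero, id, zero_mul, one_mul, add_zero]
  rw [e1, ← natCast_log]
  push_cast
  ring

lemma norm_cpow_bound {n : ℕ} (hn : 1 ≤ n) {x : ℝ} (hx : (n:ℝ) ≤ x) {s : ℂ} (hs : 1/2 < s.re) :
    ‖(x : ℂ) ^ (-s - 1)‖ ≤ (n:ℝ) ^ (-(3/2) : ℝ) := by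
  have hn' : (1:ℝ) ≤ n := by exact_mod_cast hn
  have hxp : 0 < x := by linarith
  rw [Complex.norm_cpow_eq_rpow_re_of_pos hxp]
  have : x ^ ((-s-1).re) ≤ x ^ (-(3/2) : ℝ) := by
    apply Real.rpow_le_rpow_of_exponent_le (by linarith)
    simp; linarith
  refine this.trans ?_
  exact Real.rpow_le_rpow_of_nonpos (by linarith) hx (by norm_num)

lemma P_bound (n : ℕ) {s : ℂ} (hs : 1/2 < s.re) :
    ‖P n s‖ ≤ ‖s - 1‖ * ‖s‖ * ((n + 1 : ℕ) : ℝ) ^ (-(3/2) : ℝ) := by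
  set m : ℕ := n + 1 with hm
  have hm1 : 1 ≤ m := by omega
  have hm1' : (1:ℝ) ≤ m := by exact_mod_cast hm1
  set K := ‖s‖ * (m : ℝ) ^ (-(3/2) : ℝ) with hK
  have hd : ∀ (c : ℂ) (x : ℝ), x ∈ Set.Icc (m:ℝ) (m+1) →
      HasDerivWithinAt (fun x : ℝ => (x:ℂ) ^ c) (c * (x:ℂ) ^ (c - 1)) (Set.Icc (m:ℝ) (m+1)) x := by
    intro c x hx
    have hx0 : 0 < x := by linarith [hx.1]
    have h1 : HasDerivAt (fun z : ℂ => z ^ c) (c * (x:ℂ) ^ (c-1)) (x:ℂ) := by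
      simpa using (hasDerivAt_id (x:ℂ)).cpow_const (c := c) (Or.inl (by simpa using hx0))
    exact h1.comp_ofReal.hasDerivWithinAt
  have hmem : (m:ℝ) ∈ Set.Icc (m:ℝ) (m+1) := ⟨le_rfl, by linarith⟩
  have hmem' : (m:ℝ)+1 ∈ Set.Icc (m:ℝ) (m+1) := ⟨by linarith, le_rfl⟩
  have hK0 : 0 ≤ K := by positivity
  have step1 : ∀ x ∈ Set.Icc (m:ℝ) (m+1), ‖(x:ℂ) ^ (-s) - (m:ℂ) ^ (-s)‖ ≤ K := by
    intro x hx
    have := (convex_Icc (m:ℝ) (m+1)).norm_image_sub_le_of_norm_hasDerivWithin_le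
      (f := fun x : ℝ => (x:ℂ) ^ (-s)) (C := K) (fun y hy => hd (-s) y hy) (fun y hy => by
        rw [norm_mul, norm_neg]
        exact mul_le_mul_of_nonneg_left (norm_cpow_bound hm1 hy.1 hs) (norm_nonneg _)) hmem hx
    simp only [ofReal_natCast] at this
    refine this.trans (mul_le_of_le_one_right hK0 ?_)
    rw [Real.norm_eq_abs, abs_of_nonneg (by linarith [hx.1])]
    linarith [hx.2]
  have step2 := (convex_Icc (m:ℝ) (m+1)).norm_image_sub_le_of_norm_hasDerivWithin_le
      (f := fun x : ℝ => (s - 1) * (m:ℂ)^(-s) * (x:ℂ) + (x:ℂ) ^ (1-s))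
      (f' := fun x : ℝ => (s - 1) * (m:ℂ)^(-s) * 1 + (1 - s) * (x:ℂ) ^ (1 - s - 1))
      (C := ‖s - 1‖ * K) (fun y hy => by
        refine HasDerivWithinAt.fun_add ?_ (hd (1-s) y hy)
        exact ((hasDerivAt_id y).ofReal_comp.const_mul _).hasDerivWithinAt) (fun y hy => by
        have : (s - 1) * (m:ℂ)^(-s) * 1 + (1 - s) * (y:ℂ) ^ (1 - s - 1)
           = - ((s - 1) * ((y:ℂ) ^ (-s) - (m:ℂ)^(-s))) := by
          rw [show (1 - s - 1 : ℂ) = -s by ring]; ring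
        rw [this, norm_neg, norm_mul]
        exact mul_le_mul_of_nonneg_left (step1 y hy) (norm_nonneg _)) hmem hmem'
  have e : P n s = ((s - 1) * (m:ℂ)^(-s) * ((m + 1 : ℝ):ℂ) + ((m + 1 : ℝ):ℂ) ^ (1-s)) -
      ((s - 1) * (m:ℂ)^(-s) * ((m:ℝ):ℂ) + ((m:ℝ):ℂ) ^ (1-s)) := by
    rw [P, ← hm, show ((n + 2 : ℕ) : ℂ) = ((m + 1 : ℝ) : ℂ) by rw [hm]; push_cast; ring]
    push_cast
    ring
  rw [e]
  refine step2.trans (le_of_eq ?_)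
  rw [hK]; simp; ring

noncomputable def W (s : ℂ) : ℂ := 1 + ∑' n, P n s

lemma differentiable_P (n : ℕ) : Differentiable ℂ (P n) := by
  intro s
  unfold P
  refine ((DifferentiableAt.mul (by fun_prop) ?_).add ?_).sub ?_
  · exact (hasDerivAt_nat_cpow' (n+1) (by omega) s).differentiableAt
  · exact (hasDerivAt_nat_cpow (n+2) (by omega) 1 s).differentiableAt
  · exact (hasDerivAt_nat_cpow (n+1) (by omega) 1 s).differentiableAt

def U : Set ℂ := {s : ℂ | 1/2 < s.re}

lemma isOpen_U : IsOpen U := isOpen_lt continuous_const Complex.continuous_re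

lemma summable_bound : Summable fun n : ℕ => ((n + 1 : ℕ) : ℝ) ^ (-(3/2) : ℝ) :=
  (summable_nat_add_iff 1 (f := fun n : ℕ => (n : ℝ) ^ (-(3/2) : ℝ))).mpr
    (Real.summable_nat_rpow.mpr (by norm_num))

lemma summable_P {s : ℂ} (hs : s ∈ U) : Summable fun n => P n s :=
  Summable.of_norm_bounded (summable_bound.mul_left _) fun n => P_bound n hs

lemma tendsto_SN : TendstoLocallyUniformlyOn SN W atTop U := by
  rw [tendstoLocallyUniformlyOn_iff_forall_isCompact isOpen_U]
  intro K hKU hK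
  obtain ⟨C, hC⟩ := hK.exists_bound_of_continuousOn (f := fun s : ℂ => (s - 1) * s)
    (by fun_prop)
  have h := tendstoUniformlyOn_tsum_nat (f := P) (s := K)
    (u := fun n : ℕ => C * ((n + 1 : ℕ) : ℝ) ^ (-(3/2) : ℝ)) (summable_bound.mul_left C)
    (fun n s hs => by
      refine (P_bound n (hKU hs)).trans ?_
      have := hC s hs
      rw [norm_mul] at this
      exact mul_le_mul_of_nonneg_right this (by positivity))
  rw [Metric.tendstoUniformlyOn_iff] at h ⊢
  intro ε hε
  filter_upwards [h ε hε] with N hN s hs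
  have := hN s hs
  rw [SN_eq, W, dist_add_left]
  exact this

lemma differentiableOn_W : DifferentiableOn ℂ W U :=
  tendsto_SN.differentiableOn (Eventually.of_forall fun N => (differentiable_SN N).differentiableOn)
    isOpen_U

lemma one_mem_U : (1:ℂ) ∈ U := by simp [U]; norm_num

lemma W_one : W 1 = 1 := by
  have : ∀ n, P n 1 = 0 := by intro n; simp [P]
  simp [W, this]

lemma deriv_W_one : deriv W 1 = (Real.eulerMascheroniConstant : ℂ) := by
  have h := (tendsto_SN.deriv (Eventually.of_forall fun N =>
    (differentiable_SN N).differentiableOn) isOpen_U).tendsto_at one_mem_U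
  refine tendsto_nhds_unique h ?_
  simp only [Function.comp_apply, deriv_SN_one]
  exact (continuous_ofReal.tendsto _).comp Real.tendsto_harmonic_sub_log_add_one

lemma deriv_deriv_W_one {γ₁ : ℝ} (hγ₁ : Filter.Tendsto
      (fun N : ℕ => (∑ j ∈ Finset.Icc 1 N, Real.log j / j) - (Real.log N) ^ 2 / 2)
      Filter.atTop (nhds γ₁)) : deriv (deriv W) 1 = -2 * (γ₁ : ℂ) := by
  have h := ((tendsto_SN.deriv (Eventually.of_forall fun N =>
    (differentiable_SN N).differentiableOn) isOpen_U).deriv (Eventually.of_forall fun N =>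
    ((differentiable_SN N).deriv).differentiableOn) isOpen_U).tendsto_at one_mem_U
  refine tendsto_nhds_unique h ?_
  simp only [Function.comp_apply, deriv_deriv_SN_one]
  have h1 : Tendsto (fun N : ℕ => -2 * ((∑ j ∈ Finset.Icc 1 (N+1), Real.log j / j)
      - (Real.log ((N+1 : ℕ):ℝ)) ^ 2 / 2) + 2 * (Real.log ((N+1:ℕ):ℝ) / ((N+1:ℕ):ℝ)))
      atTop (𝓝 (-2 * γ₁ + 2 * 0)) := by
    refine ((hγ₁.comp (tendsto_add_atTop_nat 1)).const_mul (-2)).add (Tendsto.const_mul 2 ?_)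
    have h2 : Tendsto (fun x : ℝ => Real.log x / x) atTop (𝓝 0) :=
      Real.isLittleO_log_id_atTop.tendsto_div_nhds_zero
    exact (h2.comp tendsto_natCast_atTop_atTop).comp (tendsto_add_atTop_nat 1)
  have h3 := (continuous_ofReal.tendsto _).comp h1
  have e : ((-2 * γ₁ + 2 * 0 : ℝ) : ℂ) = -2 * (γ₁ : ℂ) := by push_cast; ring
  rw [e] at h3
  refine h3.congr fun N => ?_
  simp only [Function.comp_apply]
  congr 1
  rw [Finset.sum_Icc_succ_top (by omega)]
  ring

lemma W_eq {s : ℂ} (hs : 1 < s.re) : W s = (s - 1) * riemannZeta s := by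
  have hsU : s ∈ U := by simp only [U, Set.mem_setOf_eq]; linarith
  have h := tendsto_SN.tendsto_at hsU
  refine tendsto_nhds_unique h ?_
  have hz : Tendsto (fun N : ℕ => ∑ n ∈ Finset.range N, ((n + 1 : ℕ) : ℂ) ^ (-s)) atTop
      (𝓝 (riemannZeta s)) := by
    rw [zeta_eq_tsum_one_div_nat_add_one_cpow hs]
    have hsum : Summable (fun n : ℕ => 1 / (n + 1 : ℂ) ^ s) := by
      have := (summable_nat_add_iff 1).mpr (Complex.summable_one_div_nat_cpow.mpr hs)
      simpa using this
    refine hsum.hasSum.tendsto_sum_nat.congr fun N => ?_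
    refine Finset.sum_congr rfl fun n _ => ?_
    rw [cpow_neg, one_div]; push_cast; rfl
  have h0 : Tendsto (fun N : ℕ => ((N + 1 : ℕ) : ℂ) ^ (1 - s)) atTop (𝓝 0) := by
    rw [tendsto_zero_iff_norm_tendsto_zero]
    have h1 : Tendsto (fun x : ℝ => x ^ (-(s.re - 1))) atTop (𝓝 0) :=
      tendsto_rpow_neg_atTop (by linarith)
    refine ((h1.comp tendsto_natCast_atTop_atTop).comp (tendsto_add_atTop_nat 1)).congr fun N => ?_
    simp only [Function.comp_apply]
    rw [Complex.norm_natCast_cpow_of_pos (by omega)]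
    simp
  simpa [SN] using (hz.const_mul (s - 1)).add h0

lemma gamma_ne (z : ℂ) (hz : 0 < z.re) : ∀ m : ℕ, z ≠ -m := by
  intro m h
  rw [h] at hz
  simp at hz
  linarith [(Nat.cast_nonneg m : (0:ℝ) ≤ m)]

lemma differentiableAt_Gamma' (z : ℂ) (hz : 0 < z.re) : DifferentiableAt ℂ Complex.Gamma z :=
  Complex.differentiableAt_Gamma z (gamma_ne z hz)

lemma isOpen_re_pos : IsOpen {z : ℂ | 0 < z.re} := isOpen_lt continuous_const continuous_re

lemma analyticAt_Gamma (z : ℂ) (hz : 0 < z.re) : AnalyticAt ℂ Complex.Gamma z := by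
  have : DifferentiableOn ℂ Complex.Gamma {z : ℂ | 0 < z.re} :=
    fun w hw => (differentiableAt_Gamma' w hw).differentiableWithinAt
  exact this.analyticAt (isOpen_re_pos.mem_nhds hz)

lemma differentiableAt_logDeriv {f : ℂ → ℂ} {z : ℂ} (hf : AnalyticAt ℂ f z) (h : f z ≠ 0) :
    DifferentiableAt ℂ (logDeriv f) z :=
  hf.deriv.differentiableAt.div hf.differentiableAt h

lemma deriv_logDeriv_Gamma_half :
    deriv (logDeriv Complex.Gamma) (1/2) = (π:ℂ)^2 / 2 := by
  have hd : DifferentiableAt ℂ (logDeriv Complex.Gamma) (1/2) :=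
    differentiableAt_logDeriv (analyticAt_Gamma _ (by norm_num))
      (Complex.Gamma_ne_zero_of_re_pos (by norm_num))
  have key : ∀ᶠ z in 𝓝 (1/2 : ℂ), logDeriv Complex.Gamma z - logDeriv Complex.Gamma (1 - z)
      = - (π * Complex.cos (π * z) / Complex.sin (π * z)) := by
    have h1 : ∀ᶠ z in 𝓝 (1/2 : ℂ), 0 < z.re :=
      continuous_re.continuousAt.eventually_mem (isOpen_Ioi.mem_nhds (by norm_num))
    have h2 : ∀ᶠ z in 𝓝 (1/2 : ℂ), z.re < 1 :=
      continuous_re.continuousAt.eventually_mem (isOpen_Iio.mem_nhds (by norm_num))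
    filter_upwards [h1, h2] with z hz1 hz2
    have hz2' : 0 < (1 - z).re := by simp; linarith
    have hG := Complex.Gamma_ne_zero_of_re_pos hz1
    have hG' := Complex.Gamma_ne_zero_of_re_pos hz2'
    have hs : Complex.sin (π * z) ≠ 0 := by
      intro h
      have := Complex.Gamma_mul_Gamma_one_sub z
      rw [h, div_zero] at this
      exact mul_ne_zero hG hG' this
    have hc : HasDerivAt (fun z : ℂ => Complex.Gamma (1 - z))
        (deriv Complex.Gamma (1 - z) * (-1)) z :=
      (differentiableAt_Gamma' _ hz2').hasDerivAt.comp z ((hasDerivAt_id' z).const_sub 1)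
    have hsin : HasDerivAt (fun z : ℂ => Complex.sin (π * z)) (Complex.cos (π * z) * (π * 1)) z :=
      (Complex.hasDerivAt_sin _).comp z ((hasDerivAt_id' z).const_mul (π:ℂ))
    have hp := (((differentiableAt_Gamma' _ hz1).hasDerivAt.fun_mul hc).fun_mul hsin).deriv
    have hconst : (fun z : ℂ => Complex.Gamma z * Complex.Gamma (1 - z) * Complex.sin (π * z))
        =ᶠ[𝓝 z] fun _ => (π:ℂ) := by
      have : ∀ᶠ w in 𝓝 z, Complex.sin (π * w) ≠ 0 :=
        hsin.continuousAt.eventually_ne hs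
      filter_upwards [this] with w hw
      rw [Complex.Gamma_mul_Gamma_one_sub, div_mul_cancel₀ _ hw]
    rw [hconst.deriv_eq, deriv_const] at hp
    rw [logDeriv_apply, logDeriv_apply]
    generalize Complex.sin (π * z) = S at *
    generalize Complex.cos (π * z) = S2 at *
    field_simp
    linear_combination -hp
  have hc2 : HasDerivAt (fun z : ℂ => logDeriv Complex.Gamma (1 - z))
      (deriv (logDeriv Complex.Gamma) (1/2) * (-1)) (1/2) := by
    have h : HasDerivAt (logDeriv Complex.Gamma) (deriv (logDeriv Complex.Gamma) (1/2))
      (1 - 1/2) := by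
      have := hd.hasDerivAt
      rwa [show (1 - 1/2 : ℂ) = 1/2 by norm_num]
    exact h.comp (1/2 : ℂ) ((hasDerivAt_id' _).const_sub 1)
  have e1 := (hd.hasDerivAt.fun_sub hc2).deriv
  have hcs : Complex.cos (π * (1/2)) = 0 := by
    rw [show (π:ℂ) * (1/2) = π/2 by ring, Complex.cos_pi_div_two]
  have hss : Complex.sin (π * (1/2)) = 1 := by
    rw [show (π:ℂ) * (1/2) = π/2 by ring, Complex.sin_pi_div_two]
  have hcos : HasDerivAt (fun z : ℂ => Complex.cos (π * z)) (-Complex.sin (π * (1/2)) * (π * 1)) (1/2) :=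
    (Complex.hasDerivAt_cos _).comp (1/2 : ℂ) ((hasDerivAt_id' _).const_mul (π:ℂ))
  have hsin : HasDerivAt (fun z : ℂ => Complex.sin (π * z)) (Complex.cos (π * (1/2)) * (π * 1)) (1/2) :=
    (Complex.hasDerivAt_sin _).comp (1/2 : ℂ) ((hasDerivAt_id' _).const_mul (π:ℂ))
  have e2 := (((hcos.const_mul (π:ℂ)).fun_div hsin (by rw [hss]; exact one_ne_zero)).fun_neg).deriv
  have e3 := EventuallyEq.deriv_eq key
  rw [e1, e2, hcs, hss] at e3
  linear_combination e3 / 2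

lemma analyticAt_Gammaℝ (z : ℂ) (hz : 0 < z.re) : AnalyticAt ℂ Gammaℝ z := by
  have : DifferentiableOn ℂ Gammaℝ {z : ℂ | 0 < z.re} := by
    intro w hw
    have hw' : 0 < (w/2).re := by
      have : 0 < w.re := hw
      simpa using this
    have e : Gammaℝ = fun s => (π:ℂ) ^ (-s / 2) * Complex.Gamma (s / 2) := funext Gammaℝ_def
    rw [e]
    apply DifferentiableAt.differentiableWithinAt
    apply DifferentiableAt.mul
    · exact DifferentiableAt.const_cpow (by fun_prop) (Or.inl (by exact_mod_cast pi_ne_zero))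
    · exact (differentiableAt_Gamma' _ hw').comp w (f := fun w => w / 2) (by fun_prop)
  exact this.analyticAt (isOpen_re_pos.mem_nhds hz)

lemma deriv_logDeriv_Gammaℝ_one : deriv (logDeriv Gammaℝ) 1 = (π:ℂ)^2 / 8 := by
  have key : ∀ᶠ z in 𝓝 (1 : ℂ), logDeriv Gammaℝ z
      = -(Complex.log π / 2) + logDeriv Complex.Gamma (z / 2) * (1/2) := by
    have h1 : ∀ᶠ z in 𝓝 (1 : ℂ), 0 < z.re :=
      continuous_re.continuousAt.eventually_mem (isOpen_Ioi.mem_nhds (by norm_num))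
    filter_upwards [h1] with z hz
    have hw' : 0 < (z/2).re := by simpa using hz
    have hpi : (π:ℂ) ≠ 0 := by exact_mod_cast pi_ne_zero
    have hG := Complex.Gamma_ne_zero_of_re_pos hw'
    have e : Gammaℝ = fun s => (π:ℂ) ^ (-s / 2) * Complex.Gamma (s / 2) := funext Gammaℝ_def
    have h2 : HasDerivAt (fun s : ℂ => (π:ℂ) ^ (-s / 2)) ((π:ℂ) ^ (-z / 2) * Complex.log π * (-1/2)) z :=
      (((hasDerivAt_id' z).fun_neg.div_const 2).const_cpow (Or.inl hpi))
    have h3 : HasDerivAt (fun s : ℂ => Complex.Gamma (s / 2)) (deriv Complex.Gamma (z/2) * (1/2)) z :=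
      (differentiableAt_Gamma' _ hw').hasDerivAt.comp z ((hasDerivAt_id' z).div_const 2)
    have hp : (π:ℂ) ^ (-z / 2) ≠ 0 := by simp [cpow_eq_zero_iff, hpi]
    rw [logDeriv_apply, e, (h2.fun_mul h3).deriv, logDeriv_apply]
    field_simp
  rw [EventuallyEq.deriv_eq key]
  have hd : DifferentiableAt ℂ (logDeriv Complex.Gamma) (1/2) :=
    differentiableAt_logDeriv (analyticAt_Gamma _ (by norm_num))
      (Complex.Gamma_ne_zero_of_re_pos (by norm_num))
  have h : HasDerivAt (fun z : ℂ => logDeriv Complex.Gamma (z / 2))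
     (deriv (logDeriv Complex.Gamma) (1/2) * (1/2)) 1 :=
    hd.hasDerivAt.comp (1:ℂ) ((hasDerivAt_id' _).div_const 2)
  rw [((h.mul_const (1/2)).const_add _).deriv, deriv_logDeriv_Gamma_half]
  ring

lemma exists_kernel_bound : ∃ (q K : ℝ), 0 < q ∧ 0 ≤ K ∧ ∀ (N : ℕ) (s : ℂ), 0 ≤ s.re → s.re ≤ N →
    ‖(HurwitzZeta.hurwitzEvenFEPair 0).Λ₀ s‖ ≤ (1 + N.factorial / q ^ N) * K := by
  set Q := HurwitzZeta.hurwitzEvenFEPair 0 with hQ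
  obtain ⟨p, hp, hO⟩ := HurwitzZeta.isBigO_atTop_evenKernel_sub 0
  have hsP := Q.isStrongFEPair_toStrongFEPair
  have hzero : ∀ r : ℝ, Q.f_modif =O[𝓝[>] 0] (· ^ r) := hsP.hf_zero
  have htop : Q.f_modif =O[atTop] fun t : ℝ => Real.exp (-p * t) := by
    have : (fun t : ℝ => Q.f_modif t) =ᶠ[atTop]
        fun t => ((HurwitzZeta.evenKernel 0 t - (if (0 : UnitAddCircle) = 0 then 1 else 0) : ℝ) : ℂ) := by
      filter_upwards [eventually_gt_atTop 1] with t ht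
      rw [WeakFEPair.f_modif, Pi.add_apply, Set.indicator_of_mem (Set.mem_Ioi.mpr ht),
        Set.indicator_of_notMem (Set.notMem_Ioo_of_ge ht.le), add_zero]
      simp [hQ, HurwitzZeta.hurwitzEvenFEPair]
    refine this.trans_isBigO ?_
    exact Complex.isBigO_ofReal_left.mpr hO
  set q := p / 2 with hq
  have hq0 : 0 < q := by positivity
  set h : ℝ → ℂ := fun t => (Real.exp (q * t) : ℂ) * Q.f_modif t with hh
  have hexp : Continuous fun t : ℝ => (Real.exp (q * t) : ℂ) := by fun_prop
  have hLocInt : MeasureTheory.LocallyIntegrableOn h (Set.Ioi 0) :=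
    Q.hf_modif_int.continuousOn_mul hexp.continuousOn isOpen_Ioi.isLocallyClosed
  have hconv : MellinConvergent h 0 := by
    refine mellinConvergent_of_isBigO_rpow_exp (a := q) (b := -1) hq0 hLocInt ?_ ?_ (by simp)
    · have h0 : (fun t : ℝ => (Real.exp (q * t) : ℂ)) =O[atTop] fun t : ℝ => Real.exp (q * t) :=
        Complex.isBigO_ofReal_left.mpr (Asymptotics.isBigO_refl _ _)
      have := h0.mul htop
      refine this.trans (Asymptotics.IsBigO.of_bound 1 (Eventually.of_forall fun t => ?_))
      rw [norm_mul, Real.norm_eq_abs, Real.norm_eq_abs, Real.norm_eq_abs, Real.abs_exp, Real.abs_exp,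
        Real.abs_exp, ← Real.exp_add, one_mul]
      apply le_of_eq; congr 1; rw [hq]; ring
    · have h1 : (fun t : ℝ => (Real.exp (q * t) : ℂ)) =O[𝓝[>] 0] fun _ => (1:ℝ) :=
        (hexp.tendsto 0).isBigO_one ℝ |>.mono nhdsWithin_le_nhds
      have := h1.mul (hzero 1)
      simpa [hh] using this
  have hnorm : MeasureTheory.IntegrableOn (fun t : ℝ => t⁻¹ * (Real.exp (q * t) * ‖Q.f_modif t‖)) (Set.Ioi 0) := by
    have := hconv.norm
    refine MeasureTheory.IntegrableOn.congr_fun this ?_ measurableSet_Ioi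
    intro t ht
    have ht0 : (0:ℝ) < t := ht
    simp only [hh, zero_sub, smul_eq_mul, norm_mul, Complex.norm_real, Real.norm_eq_abs, Real.abs_exp,
      cpow_neg_one, norm_inv, abs_of_pos ht0]
  refine ⟨q, ∫ t in Set.Ioi 0, t⁻¹ * (Real.exp (q * t) * ‖Q.f_modif t‖), hq0, ?_, ?_⟩
  · refine MeasureTheory.setIntegral_nonneg measurableSet_Ioi fun t ht => ?_
    have ht0 : (0:ℝ) < t := ht
    positivity
  intro N s hs0 hsN
  rw [WeakFEPair.Λ₀, mellin, ← MeasureTheory.integral_const_mul]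
  refine MeasureTheory.norm_integral_le_of_norm_le (hnorm.const_mul _) ?_
  refine (MeasureTheory.ae_restrict_mem measurableSet_Ioi).mono fun t ht => ?_
  have ht0 : (0:ℝ) < t := ht
  rw [norm_smul, Complex.norm_cpow_eq_rpow_re_of_pos ht0]
  have e1 : t ^ ((s - 1).re) = t⁻¹ * t ^ s.re := by
    rw [sub_re, one_re, Real.rpow_sub_one ht0.ne']; ring
  have e2 : t ^ s.re ≤ 1 + t ^ N := by
    rcases le_total t 1 with h1 | h1
    · have := Real.rpow_le_one ht0.le h1 hs0
      have := pow_nonneg ht0.le N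
      linarith
    · have := Real.rpow_le_rpow_of_exponent_le h1 hsN
      rw [Real.rpow_natCast] at this
      linarith
  have e3 : 1 ≤ Real.exp (q * t) := Real.one_le_exp (by positivity)
  have e4 : t ^ N ≤ N.factorial / q ^ N * Real.exp (q * t) := by
    have := Real.pow_div_factorial_le_exp (q * t) (by positivity) N
    rw [div_le_iff₀ (by positivity), mul_pow] at this
    rw [div_mul_eq_mul_div, le_div_iff₀ (by positivity)]
    linarith
  have e5 : t ^ s.re ≤ (1 + N.factorial / q ^ N) * Real.exp (q * t) := by
    rw [add_mul]; linarith
  rw [e1]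
  calc t⁻¹ * t ^ s.re * ‖Q.f_modif t‖
      ≤ t⁻¹ * ((1 + N.factorial / q ^ N) * Real.exp (q * t)) * ‖Q.f_modif t‖ := by gcongr
    _ = _ := by ring

noncomputable def Xi (s : ℂ) : ℂ := s * (s - 1) * completedRiemannZeta₀ s + 1

lemma differentiable_Xi : Differentiable ℂ Xi := by
  unfold Xi
  have := differentiable_completedZeta₀
  fun_prop

lemma Xi_zero : Xi 0 = 1 := by simp [Xi]

lemma Xi_one_sub (s : ℂ) : Xi (1 - s) = Xi s := by
  rw [Xi, Xi, completedRiemannZeta₀_one_sub]; ring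

lemma Xi_eq {s : ℂ} (h0 : s ≠ 0) (h1 : s ≠ 1) : Xi s = s * (s - 1) * completedRiemannZeta s := by
  rw [Xi, completedRiemannZeta_eq]
  have : 1 - s ≠ 0 := sub_ne_zero.mpr h1.symm
  field_simp
  ring

lemma Xi_eq_zeta {s : ℂ} (h0 : 0 < s.re) (h1 : s ≠ 1) :
    Xi s = s * (s - 1) * Gammaℝ s * riemannZeta s := by
  have hs : s ≠ 0 := by rintro rfl; simp at h0
  rw [Xi_eq hs h1, riemannZeta_def_of_ne_zero hs]
  have := Gammaℝ_ne_zero_of_re_pos h0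
  field_simp

lemma Xi_one : Xi 1 = 1 := by simp [Xi]

lemma Xi_ne_zero_of_one_le {s : ℂ} (hs : 1 ≤ s.re) : Xi s ≠ 0 := by
  by_cases h : s = 1
  · rw [h, Xi_one]; exact one_ne_zero
  have h0 : 0 < s.re := by linarith
  have hs0 : s ≠ 0 := by rintro rfl; simp at h0
  rw [Xi_eq_zeta h0 h]
  exact mul_ne_zero (mul_ne_zero (mul_ne_zero hs0 (sub_ne_zero.mpr h)) (Gammaℝ_ne_zero_of_re_pos h0))
    (riemannZeta_ne_zero_of_one_le_re hs)

lemma Xi_zero_iff (a : ℂ) : (riemannZeta a = 0 ∧ 0 < a.re ∧ a.re < 1) ↔ Xi a = 0 := by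
  constructor
  · rintro ⟨h, h0, h1⟩
    rw [Xi_eq_zeta h0 (by rintro rfl; simp at h1), h, mul_zero]
  · intro h
    have h1 : a.re < 1 := by
      by_contra hc
      exact Xi_ne_zero_of_one_le (not_lt.mp hc) h
    have h0 : 0 < a.re := by
      by_contra hc
      refine Xi_ne_zero_of_one_le (s := 1 - a) (by simp; linarith) ?_
      rw [Xi_one_sub, h]
    refine ⟨?_, h0, h1⟩
    have hne1 : a ≠ 1 := by rintro rfl; simp at h1
    have hs0 : a ≠ 0 := by rintro rfl; simp at h0
    rw [Xi_eq_zeta h0 hne1] at h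
    exact (mul_eq_zero.mp h).resolve_left
      (mul_ne_zero (mul_ne_zero hs0 (sub_ne_zero.mpr hne1)) (Gammaℝ_ne_zero_of_re_pos h0))

lemma Xi_bound : ∃ A c : ℝ, 1 ≤ A ∧ 0 ≤ c ∧ ∀ R : ℝ, 0 ≤ R → ∀ z : ℂ, ‖z‖ ≤ R →
    ‖Xi z‖ ≤ A * (R + 2) ^ 2 * Real.exp ((R + 2) * (Real.log (R + 2) + c)) := by
  obtain ⟨q, K, hq, hK, hb⟩ := exists_kernel_bound
  refine ⟨1 + 2 * K, |Real.log q|, by linarith, abs_nonneg _, fun R hR z hz => ?_⟩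
  set E := Real.exp ((R + 2) * (Real.log (R + 2) + |Real.log q|)) with hE
  have hlog : 0 ≤ Real.log (R + 2) := Real.log_nonneg (by linarith)
  have hE1 : 1 ≤ E := Real.one_le_exp (by positivity)
  set N := ⌈R + 1⌉₊ with hN
  have hN1 : (R + 1) ≤ N := Nat.le_ceil _
  have hN2 : (N : ℝ) ≤ R + 2 := by
    have := (Nat.ceil_lt_add_one (show 0 ≤ R + 1 by linarith)).le
    linarith
  have hfac : (N.factorial : ℝ) / q ^ N ≤ E := by
    have h1 : (N.factorial : ℝ) ≤ (R + 2) ^ N := by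
      calc (N.factorial : ℝ) ≤ (N : ℝ) ^ N := by exact_mod_cast Nat.factorial_le_pow N
        _ ≤ (R + 2) ^ N := by gcongr
    have h2 : (R + 2) ^ N / q ^ N = Real.exp (N * (Real.log (R + 2) - Real.log q)) := by
      rw [Real.exp_nat_mul, Real.exp_sub, Real.exp_log (by linarith), Real.exp_log hq, div_pow]
    calc (N.factorial : ℝ) / q ^ N ≤ (R + 2) ^ N / q ^ N := by gcongr
      _ = Real.exp (N * (Real.log (R + 2) - Real.log q)) := h2
      _ ≤ E := by
        apply Real.exp_le_exp.mpr
        have := neg_abs_le (Real.log q)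
        calc (N:ℝ) * (Real.log (R + 2) - Real.log q) ≤ N * (Real.log (R + 2) + |Real.log q|) := by
              gcongr; linarith
          _ ≤ _ := by gcongr
  have key : ∀ w : ℂ, 0 ≤ w.re → ‖w‖ ≤ R + 1 → ‖completedRiemannZeta₀ w‖ ≤ 2 * E * K := by
    intro w hw0 hw
    have hre := (Complex.re_le_norm w).trans hw
    have h := hb N (w / 2) (by simp; linarith) (by simp; linarith)
    have : completedRiemannZeta₀ w = (HurwitzZeta.hurwitzEvenFEPair 0).Λ₀ (w / 2) / 2 := rfl
    rw [this, norm_div]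
    have h2 : (1 + N.factorial / q ^ N) * K ≤ 2 * E * K := by
      gcongr; linarith
    have h3 : ‖(2:ℂ)‖ = 2 := by simp
    rw [h3]
    linarith [norm_nonneg ((HurwitzZeta.hurwitzEvenFEPair 0).Λ₀ (w / 2))]
  have hL : ‖completedRiemannZeta₀ z‖ ≤ 2 * E * K := by
    rcases le_total 0 z.re with h | h
    · exact key z h (by linarith)
    · rw [← completedRiemannZeta₀_one_sub]
      refine key _ (by simp; linarith) ?_
      have := norm_sub_le (1:ℂ) z
      rw [norm_one] at this
      linarith
  have hz1 : ‖z - 1‖ ≤ R + 1 := by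
    have := norm_sub_le z (1:ℂ)
    rw [norm_one] at this
    linarith
  calc ‖Xi z‖ ≤ ‖z‖ * ‖z - 1‖ * ‖completedRiemannZeta₀ z‖ + 1 := by
        rw [Xi]
        refine (norm_add_le _ _).trans ?_
        simp
    _ ≤ (R + 2) * (R + 2) * (2 * E * K) + (R + 2) * (R + 2) * E := by
        have h1 : ‖z‖ * ‖z - 1‖ * ‖completedRiemannZeta₀ z‖ ≤ (R + 2) * (R + 2) * (2 * E * K) := by
          gcongr <;> linarith
        have h2 : 1 ≤ (R + 2) * (R + 2) * E := by nlinarith [mul_nonneg hR hR]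
        linarith
    _ = _ := by ring

lemma Xi_growth : ∃ B : ℝ → ℝ, (∀ᶠ R in atTop, 0 < B R ∧ ∀ z, ‖z‖ ≤ R → ‖Xi z‖ ≤ Real.exp (B R)) ∧
    Tendsto (fun R => B R / R ^ 2) atTop (𝓝 0) := by
  obtain ⟨A, c, hA, hc, hb⟩ := Xi_bound
  refine ⟨fun R => Real.log A + 2 * Real.log (R + 2) + (R + 2) * (Real.log (R + 2) + c), ?_, ?_⟩
  · filter_upwards [eventually_ge_atTop 0] with R hR
    have h1 : 0 < Real.log (R + 2) := Real.log_pos (by linarith)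
    have h2 : 0 ≤ Real.log A := Real.log_nonneg hA
    refine ⟨by positivity, fun z hz => (hb R hR z hz).trans (le_of_eq ?_)⟩
    rw [Real.exp_add, Real.exp_add, Real.exp_log (by linarith), two_mul, Real.exp_add,
      Real.exp_log (by linarith)]
    ring
  · have hid : Tendsto (fun R : ℝ => R) atTop atTop := tendsto_id
    have hshift : Tendsto (fun R : ℝ => R + 2) atTop atTop := tendsto_atTop_add_const_right _ _ hid
    have hc1 : ∀ C : ℝ, (fun _ : ℝ => C) =o[atTop] fun R : ℝ => R := fun C =>
      Asymptotics.isLittleO_const_left.mpr (Or.inr (tendsto_norm_atTop_atTop.comp hid))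
    have hs : (fun R : ℝ => R + 2) =O[atTop] fun R : ℝ => R :=
      (Asymptotics.isBigO_refl _ _).add (hc1 2).isBigO
    have hl : (fun R : ℝ => Real.log (R + 2)) =o[atTop] fun R : ℝ => R :=
      (Real.isLittleO_log_id_atTop.comp_tendsto hshift).trans_isBigO hs
    have h1R : (fun R : ℝ => R) =O[atTop] fun R : ℝ => R * R := by
      have := (hc1 1).isBigO.mul (Asymptotics.isBigO_refl (fun R : ℝ => R) atTop)
      simpa using this
    have hfin : (fun R : ℝ => Real.log A + 2 * Real.log (R + 2) + (R + 2) * (Real.log (R + 2) + c))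
        =o[atTop] fun R : ℝ => R * R :=
      (((hc1 _).add (hl.const_mul_left 2)).trans_isBigO h1R).add (hs.mul_isLittleO (hl.add (hc1 c)))
    have := hfin.tendsto_div_nhds_zero
    simpa [pow_two] using this

lemma Xi_eqOn_U : ∀ s ∈ U, Xi s = s * Gammaℝ s * W s := by
  have hUpos : ∀ s ∈ U, 0 < s.re := by
    intro s hs
    have : 1/2 < s.re := hs
    linarith
  have hf : AnalyticOnNhd ℂ Xi U := fun s _ => differentiable_Xi.analyticAt s
  have hg : AnalyticOnNhd ℂ (fun s => s * Gammaℝ s * W s) U := fun s hs =>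
    ((analyticAt_id.mul (analyticAt_Gammaℝ s (hUpos s hs))).mul
      (differentiableOn_W.analyticAt (isOpen_U.mem_nhds hs)))
  have hconn : IsPreconnected U := (convex_halfSpace_re_gt (1/2)).isPreconnected
  have h2 : (2:ℂ) ∈ U := by
    change 1/2 < (2:ℂ).re
    norm_num
  have hev : Xi =ᶠ[𝓝 2] fun s => s * Gammaℝ s * W s := by
    have h1 : ∀ᶠ z in 𝓝 (2 : ℂ), 1 < z.re :=
      continuous_re.continuousAt.eventually_mem (isOpen_Ioi.mem_nhds (by norm_num))
    filter_upwards [h1] with z hz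
    rw [Xi_eq_zeta (by linarith) (by rintro rfl; simp at hz), W_eq hz]
    ring
  exact fun s hs => hf.eqOn_of_preconnected_of_eventuallyEq hg hconn h2 hev hs

lemma deriv_logDeriv_W_one {γ₁ : ℝ} (hγ₁ : Filter.Tendsto
      (fun N : ℕ => (∑ j ∈ Finset.Icc 1 N, Real.log j / j) - (Real.log N) ^ 2 / 2)
      Filter.atTop (nhds γ₁)) :
    deriv (logDeriv W) 1 = -2 * (γ₁ : ℂ) - (Real.eulerMascheroniConstant : ℂ) ^ 2 := by
  have hW : AnalyticAt ℂ W 1 := differentiableOn_W.analyticAt (isOpen_U.mem_nhds one_mem_U)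
  have h := (hW.deriv.differentiableAt.hasDerivAt.div hW.differentiableAt.hasDerivAt
    (by rw [W_one]; exact one_ne_zero)).deriv
  have e : logDeriv W = deriv W / W := rfl
  rw [e, h, W_one, deriv_W_one, deriv_deriv_W_one hγ₁]
  ring

lemma deriv_logDeriv_Xi_one {γ₁ : ℝ} (hγ₁ : Filter.Tendsto
      (fun N : ℕ => (∑ j ∈ Finset.Icc 1 N, Real.log j / j) - (Real.log N) ^ 2 / 2)
      Filter.atTop (nhds γ₁)) :
    deriv (logDeriv Xi) 1 = -1 + (π : ℂ) ^ 2 / 8 +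
      (-2 * (γ₁ : ℂ) - (Real.eulerMascheroniConstant : ℂ) ^ 2) := by
  have hW : AnalyticAt ℂ W 1 := differentiableOn_W.analyticAt (isOpen_U.mem_nhds one_mem_U)
  have hG : AnalyticAt ℂ Gammaℝ 1 := analyticAt_Gammaℝ 1 (by simp)
  have hG1 : Gammaℝ 1 ≠ 0 := Gammaℝ_ne_zero_of_re_pos (by simp)
  have hW1 : W 1 ≠ 0 := by rw [W_one]; exact one_ne_zero
  have hU : ∀ᶠ z in 𝓝 (1:ℂ), z ∈ U := isOpen_U.mem_nhds one_mem_U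
  have hpos : ∀ᶠ z in 𝓝 (1 : ℂ), 0 < z.re :=
    continuous_re.continuousAt.eventually_mem (isOpen_Ioi.mem_nhds (by norm_num))
  have key : logDeriv Xi =ᶠ[𝓝 1] fun z => z⁻¹ + logDeriv Gammaℝ z + logDeriv W z := by
    filter_upwards [hU, hpos, hW.continuousAt.eventually_ne hW1] with z hzU hz hWz
    have hev : Xi =ᶠ[𝓝 z] fun s => s * Gammaℝ s * W s := by
      filter_upwards [isOpen_U.mem_nhds hzU] with s hs using Xi_eqOn_U s hs
    have hz0 : z ≠ 0 := by rintro rfl; simp at hz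
    have hGz := Gammaℝ_ne_zero_of_re_pos hz
    have hWd : DifferentiableAt ℂ W z := differentiableOn_W.differentiableAt (isOpen_U.mem_nhds hzU)
    have hd := (((hasDerivAt_id' z).fun_mul
      (analyticAt_Gammaℝ z hz).differentiableAt.hasDerivAt).fun_mul hWd.hasDerivAt).deriv
    rw [logDeriv_apply, hev.deriv_eq, hev.eq_of_nhds, hd, logDeriv_apply, logDeriv_apply]
    field_simp
  rw [key.deriv_eq]
  have h1 := hasDerivAt_inv (one_ne_zero : (1:ℂ) ≠ 0)
  have h2 := (differentiableAt_logDeriv hG hG1).hasDerivAt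
  have h3 := (differentiableAt_logDeriv hW hW1).hasDerivAt
  rw [((h1.fun_add h2).fun_add h3).deriv, deriv_logDeriv_W_one hγ₁, deriv_logDeriv_Gammaℝ_one]
  ring

lemma deriv_logDeriv_Xi_zero : deriv (logDeriv Xi) 0 = deriv (logDeriv Xi) 1 := by
  have h : logDeriv Xi = fun s => -logDeriv Xi (1 - s) := by
    funext s
    have e : Xi = fun s => Xi (1 - s) := funext fun s => (Xi_one_sub s).symm
    have hd : deriv Xi s = deriv Xi (1 - s) * (-1) := by
      have : HasDerivAt (fun s => Xi (1 - s)) (deriv Xi (1 - s) * (-1)) s :=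
        (differentiable_Xi (1 - s)).hasDerivAt.comp s ((hasDerivAt_id' s).const_sub 1)
      rw [← this.deriv, ← e]
    rw [logDeriv_apply, logDeriv_apply, hd, Xi_one_sub]
    ring
  have hd : HasDerivAt (logDeriv Xi) (deriv (logDeriv Xi) 1) (1 - 0) := by
    rw [sub_zero]
    exact (differentiableAt_logDeriv (differentiable_Xi.analyticAt 1)
      (by rw [Xi_one]; exact one_ne_zero)).hasDerivAt
  have h2 : HasDerivAt (fun s => -logDeriv Xi (1 - s)) (-(deriv (logDeriv Xi) 1 * (-1))) 0 :=
    (hd.comp (0:ℂ) ((hasDerivAt_id' (0:ℂ)).const_sub 1)).fun_neg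
  rw [← h] at h2
  rw [h2.deriv]
  ring

lemma analyticOrderAt_Xi {a : ℂ} (h0 : 0 < a.re) (h1 : a.re < 1)
    (hz : AnalyticAt ℂ riemannZeta a) : analyticOrderAt Xi a = analyticOrderAt riemannZeta a := by
  have hne1 : a ≠ 1 := by rintro rfl; simp at h1
  have hs0 : a ≠ 0 := by rintro rfl; simp at h0
  have hpos : ∀ᶠ z in 𝓝 a, 0 < z.re :=
    continuous_re.continuousAt.eventually_mem (isOpen_Ioi.mem_nhds h0)
  have hev : Xi =ᶠ[𝓝 a] (fun s => s * (s - 1) * Gammaℝ s) * riemannZeta := by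
    filter_upwards [hpos, isOpen_ne.mem_nhds hne1] with s hs hs1
    rw [Pi.mul_apply, Xi_eq_zeta hs hs1]
  have hg : AnalyticAt ℂ (fun s => s * (s - 1) * Gammaℝ s) a :=
    (analyticAt_id.mul (analyticAt_id.sub analyticAt_const)).mul (analyticAt_Gammaℝ a h0)
  have hg0 : analyticOrderAt (fun s => s * (s - 1) * Gammaℝ s) a = 0 :=
    hg.analyticOrderAt_eq_zero.mpr
      (mul_ne_zero (mul_ne_zero hs0 (sub_ne_zero.mpr hne1)) (Gammaℝ_ne_zero_of_re_pos h0))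
  rw [analyticOrderAt_congr hev, analyticOrderAt_mul hg hz, hg0, zero_add]

end ZetaSum

/-- The nontrivial zeros `ρ` of the Riemann zeta function (of order `k_ρ`) satisfy
`∑_ρ k_ρ/ρ² = 1 - π²/8 + γ² + 2γ₁`, where `γ` is the Euler–Mascheroni constant and
`γ₁` is the first Stieltjes constant. -/
theorem sum_inv_sq_nontrivial_zeta_zeros (k : ℂ → ℕ)
    (hk : ∀ ρ : ℂ, (riemannZeta ρ = 0 ∧ 0 < ρ.re ∧ ρ.re < 1) →
      ∃ h : AnalyticAt ℂ riemannZeta ρ, analyticOrderAt riemannZeta ρ = (k ρ : ℕ∞))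
    (γ₁ : ℝ)
    (hγ₁ : Filter.Tendsto
      (fun N : ℕ => (∑ j ∈ Finset.Icc 1 N, Real.log j / j) - (Real.log N) ^ 2 / 2)
      Filter.atTop (nhds γ₁)) :
    Summable (fun ρ : {ρ : ℂ // riemannZeta ρ = 0 ∧ 0 < ρ.re ∧ ρ.re < 1} =>
      (k ρ : ℂ) / (ρ : ℂ) ^ 2) ∧
    ∑' ρ : {ρ : ℂ // riemannZeta ρ = 0 ∧ 0 < ρ.re ∧ ρ.re < 1}, (k ρ : ℂ) / (ρ : ℂ) ^ 2
      = 1 - (Real.pi : ℂ) ^ 2 / 8 + (Real.eulerMascheroniConstant : ℂ) ^ 2 + 2 * (γ₁ : ℂ) := by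
  obtain ⟨B, hB, hBlim⟩ := ZetaSum.Xi_growth
  have h := ZetaSum.sum_zeros ZetaSum.differentiable_Xi ZetaSum.Xi_zero k
    {ρ : ℂ | riemannZeta ρ = 0 ∧ 0 < ρ.re ∧ ρ.re < 1} ZetaSum.Xi_zero_iff (fun a ha => ha.2)
    (fun R => ((isCompact_closedBall (0:ℂ) R).inter_riemannZetaZeros_finite).subset
      (fun a ha => ⟨ha.2, ha.1.1⟩))
    (fun a ha => by
      obtain ⟨h1, h2⟩ := hk a ha
      rw [ZetaSum.analyticOrderAt_Xi ha.2.1 ha.2.2 h1, h2])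
    B hB hBlim
  rw [ZetaSum.deriv_logDeriv_Xi_zero, ZetaSum.deriv_logDeriv_Xi_one hγ₁] at h
  refine ⟨h.summable, h.tsum_eq.trans ?_⟩
  ring
end

section
/- Let n ≥ 2 be an integer and let ψ^{(n)} denote the n-th polygamma function, ψ^{(n)}(z) = (−1)^{n+1}·n!·∑_{k=0}^∞ 1/(k+z)^{n+1} for z ∈ ℂ ∖ {0,−1,−2,…}. Let (η_k)_{k≥1} enumerate the zeros of ψ^{(n)} in nondecreasing order of modulus, and let l_k be the order of the zero at η_k. Then for every integer j with 2 ≤ j ≤ n, the series ∑_{k=1}^∞ l_k/η_k^j (summed in this order) converges and ∑_{k=1}^∞ l_k/η_k^j = (−1)^j·(n+1)·ζ(j), where ζ is the Riemann zeta function. -/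
open Complex

/-- The `n`-th polygamma function `ψ⁽ⁿ⁾(z) = (-1)^{n+1} n! ∑_{k≥0} 1/(k+z)^{n+1}`. -/
noncomputable def polygamma (n : ℕ) (z : ℂ) : ℂ :=
  (-1) ^ (n + 1) * (Nat.factorial n : ℂ) * ∑' k : ℕ, 1 / ((k : ℂ) + z) ^ (n + 1)

lemma pz_factor_one {ρ : ℝ} {f : ℂ → ℂ} (hf : DifferentiableOn ℂ f (Metric.ball 0 ρ)) {a : ℂ}
    (ha : a ∈ Metric.ball (0:ℂ) ρ) (ha0 : a ≠ 0) {l : ℕ} (hl : analyticOrderAt f a = l) :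
    ∃ g : ℂ → ℂ, DifferentiableOn ℂ g (Metric.ball 0 ρ) ∧ g a ≠ 0 ∧
      ∀ z ∈ Metric.ball (0:ℂ) ρ, f z = (1 - z / a) ^ l * g z := by
  have hfa : AnalyticAt ℂ f a := hf.analyticAt (Metric.isOpen_ball.mem_nhds ha)
  obtain ⟨g₀, hg₀, hg₀a, hev⟩ := (hfa.analyticOrderAt_eq_natCast).1 hl
  have hne : ∀ z, z ≠ a → (1 - z / a) ≠ 0 := by
    intro z hz h
    apply hz
    field_simp at h
    linear_combination -h
  have key : ∀ z, (z - a) = (1 - z / a) * (-a) := by intro z; field_simp; ring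
  refine ⟨Function.update (fun z => f z / (1 - z / a) ^ l) a (g₀ a * (-a) ^ l), ?_, ?_, ?_⟩
  · intro z hz
    by_cases hza : z = a
    · subst hza
      have h2 : (fun w => g₀ w * (-z) ^ l) =ᶠ[nhds z]
          Function.update (fun w => f w / (1 - w / z) ^ l) z (g₀ z * (-z) ^ l) := by
        filter_upwards [hev] with w hw
        by_cases hwz : w = z
        · subst hwz; simp
        · rw [Function.update_of_ne hwz, hw, key w, mul_pow, smul_eq_mul]
          have := pow_ne_zero l (hne w hwz)
          field_simp
      exact ((hg₀.mul analyticAt_const).congr h2).differentiableAt.differentiableWithinAt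
    · have h2 : (fun z => f z / (1 - z / a) ^ l) =ᶠ[nhds z]
          Function.update (fun z => f z / (1 - z / a) ^ l) a (g₀ a * (-a) ^ l) := by
        filter_upwards [isOpen_ne.mem_nhds hza] with w hw
        rw [Function.update_of_ne hw]
      refine DifferentiableAt.differentiableWithinAt (DifferentiableAt.congr_of_eventuallyEq ?_ h2.symm)
      have := pow_ne_zero l (hne z hza)
      exact (hf.differentiableAt (Metric.isOpen_ball.mem_nhds hz)).div (by fun_prop) this
  · simp [hg₀a, ha0]
  · intro z hz
    by_cases hza : z = a
    · subst hza
      rw [hev.self_of_nhds]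
      simp only [Function.update_self, smul_eq_mul, key z, mul_pow]
      ring
    · rw [Function.update_of_ne hza]
      have := pow_ne_zero l (hne z hza)
      field_simp

lemma pz_factor {ρ : ℝ} {f : ℂ → ℂ} (hf : DifferentiableOn ℂ f (Metric.ball 0 ρ)) {a : ℕ → ℂ}
    (hinj : Function.Injective a) {l : ℕ → ℕ} (N : ℕ)
    (ha : ∀ k < N, a k ∈ Metric.ball (0:ℂ) ρ) (ha0 : ∀ k, a k ≠ 0)
    (hl : ∀ k < N, analyticOrderAt f (a k) = l k) :
    ∃ g : ℂ → ℂ, DifferentiableOn ℂ g (Metric.ball 0 ρ) ∧ (∀ k < N, g (a k) ≠ 0) ∧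
      ∀ z ∈ Metric.ball (0:ℂ) ρ, f z = (∏ k ∈ Finset.range N, (1 - z / a k) ^ l k) * g z := by
  induction N with
  | zero => exact ⟨f, hf, by simp, by simp⟩
  | succ N ih =>
    obtain ⟨g, hg, hga, hfg⟩ := ih (fun k hk => ha k (by omega)) (fun k hk => hl k (by omega))
    have haN := ha N (by omega)
    have hP : AnalyticAt ℂ (fun z => ∏ k ∈ Finset.range N, (1 - z / a k) ^ l k) (a N) := by
      apply Differentiable.analyticAt
      fun_prop
    have hPne : (∏ k ∈ Finset.range N, (1 - a N / a k) ^ l k) ≠ 0 := by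
      rw [Finset.prod_ne_zero_iff]
      intro k hk
      apply pow_ne_zero
      intro h
      have h0 := ha0 k
      field_simp at h
      have : a k = a N := by linear_combination h
      have := hinj this
      simp at hk; omega
    have hgA : AnalyticAt ℂ g (a N) := hg.analyticAt (Metric.isOpen_ball.mem_nhds haN)
    have hord : analyticOrderAt g (a N) = l N := by
      rw [← hl N (by omega)]
      have : f =ᶠ[nhds (a N)] (fun z => ∏ k ∈ Finset.range N, (1 - z / a k) ^ l k) * g := by
        filter_upwards [Metric.isOpen_ball.mem_nhds haN] with z hz
        exact hfg z hz
      rw [analyticOrderAt_congr this, analyticOrderAt_mul hP hgA,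
        hP.analyticOrderAt_eq_zero.2 hPne, zero_add]
    obtain ⟨g', hg', hga', hfg'⟩ := pz_factor_one hg haN (ha0 N) hord
    refine ⟨g', hg', ?_, ?_⟩
    · intro k hk
      rcases Nat.lt_succ_iff_lt_or_eq.1 hk with h | h
      · have := hga k h
        rw [hfg' _ (ha k (by omega))] at this
        exact right_ne_zero_of_mul this
      · subst h; exact hga'
    · intro z hz
      rw [hfg z hz, hfg' z hz, Finset.prod_range_succ, mul_assoc]

lemma pz_log_bound {R A : ℝ} (hR : 0 < R) (hA : 0 < A) {g : ℂ → ℂ}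
    (hg : DifferentiableOn ℂ g (Metric.ball 0 R)) (hg0 : g 0 = 1)
    (hne : ∀ z ∈ Metric.ball (0:ℂ) R, g z ≠ 0)
    (hb : ∀ z ∈ Metric.ball (0:ℂ) R, ‖g z‖ ≤ Real.exp A) (i : ℕ) :
    ‖iteratedDeriv i (logDeriv g) 0‖ ≤ (i + 1).factorial * (2 * A) / (R / 2) ^ (i + 1) := by
  have hld : DifferentiableOn ℂ (logDeriv g) (Metric.ball 0 R) :=
    (hg.deriv Metric.isOpen_ball).div hg hne
  obtain ⟨h, hh0, hh⟩ := hld.isExactOn_ball.with_val_at 0 0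
  have h0mem : (0:ℂ) ∈ Metric.ball (0:ℂ) R := Metric.mem_ball_self hR
  have hhd : DifferentiableOn ℂ h (Metric.ball 0 R) :=
    fun z hz => (hh z hz).differentiableAt.differentiableWithinAt
  have hexp : ∀ z ∈ Metric.ball (0:ℂ) R, g z = Complex.exp (h z) := by
    have hder : ∀ z ∈ Metric.ball (0:ℂ) R,
        HasDerivAt (fun z => g z * Complex.exp (-h z)) 0 z := by
      intro z hz
      have h1 := (hg.differentiableAt (Metric.isOpen_ball.mem_nhds hz)).hasDerivAt
      have h2 := (hh z hz).neg.cexp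
      convert! h1.mul h2 using 1
      have := hne z hz
      rw [logDeriv_apply]
      simp only [Pi.neg_apply]
      field_simp
      ring
    intro z hz
    have hc : (fun z => g z * Complex.exp (-h z)) z = (fun z => g z * Complex.exp (-h z)) 0 := by
      refine IsOpen.is_const_of_deriv_eq_zero Metric.isOpen_ball
        (convex_ball (0:ℂ) R).isPreconnected
        (fun w hw => (hder w hw).differentiableAt.differentiableWithinAt)
        (fun w hw => (hder w hw).deriv) hz h0mem
    simp only [hg0, hh0, neg_zero, Complex.exp_zero, mul_one] at hc
    rw [Complex.exp_neg] at hc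
    have := Complex.exp_ne_zero (h z)
    field_simp at hc
    exact hc
  have hre : Set.MapsTo h (Metric.ball 0 R) {z | z.re ≤ A} := by
    intro z hz
    have := hb z hz
    rw [hexp z hz, Complex.norm_exp, Real.exp_le_exp] at this
    exact this
  have hbc : ∀ z ∈ Metric.sphere (0:ℂ) (R/2), ‖h z‖ ≤ 2 * A := by
    intro z hz
    have hz' : ‖z‖ = R / 2 := by simpa using hz
    have := Complex.borelCaratheodory_zero hA hhd hre hR (z := z)
      (by simp [hz']; linarith) hh0
    rw [hz'] at this
    convert! this using 1
    field_simp
    ring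
  have hc := Complex.norm_iteratedDeriv_le_of_forall_mem_sphere_norm_le (i+1) (half_pos hR)
    (f := h) (c := 0) (C := 2 * A)
    (hhd.diffContOnCl_ball (Metric.closedBall_subset_ball (by linarith))) hbc
  rw [iteratedDeriv_succ'] at hc
  have : deriv h =ᶠ[nhds 0] logDeriv g := by
    filter_upwards [Metric.isOpen_ball.mem_nhds h0mem] with z hz
    exact (hh z hz).deriv
  rwa [this.iteratedDeriv_eq] at hc

lemma pz_main {R ρ A : ℝ} (hR : 0 < R) (hρ : 2 * R < ρ) (hA : 0 < A) {f g : ℂ → ℂ}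
    (hg : DifferentiableOn ℂ g (Metric.ball 0 ρ)) (hf0 : f 0 = 1)
    (hb : ∀ z, ‖z‖ = 2 * R → ‖f z‖ ≤ Real.exp A) {a : ℕ → ℂ} {l : ℕ → ℕ} {N : ℕ}
    (ha : ∀ k < N, ‖a k‖ ≤ R) (ha0 : ∀ k, a k ≠ 0) (hga : ∀ k < N, g (a k) ≠ 0)
    (hz : ∀ z, ‖z‖ < R → f z = 0 → ∃ k < N, z = a k)
    (hfg : ∀ z ∈ Metric.ball (0:ℂ) ρ, f z = (∏ k ∈ Finset.range N, (1 - z / a k) ^ l k) * g z)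
    (i : ℕ) :
    ‖iteratedDeriv i (logDeriv g) 0‖ ≤ (i + 1).factorial * (2 * A) / (R / 2) ^ (i + 1) := by
  have hbb : ∀ z ∈ Metric.closedBall (0:ℂ) (2 * R), ‖g z‖ ≤ Real.exp A := by
    intro z hz
    refine Complex.norm_le_of_forall_mem_frontier_norm_le (U := Metric.ball (0:ℂ) (2*R))
      Metric.isBounded_ball (hg.diffContOnCl_ball (Metric.closedBall_subset_ball hρ)) ?_ ?_
    · intro w hw
      rw [frontier_ball _ (by positivity)] at hw
      have hw' : ‖w‖ = 2 * R := by simpa using hw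
      have h1 := hb w hw'
      rw [hfg w (by simp [hw', hρ]), norm_mul] at h1
      have h2 : 1 ≤ ‖∏ k ∈ Finset.range N, (1 - w / a k) ^ l k‖ := by
        rw [norm_prod]
        apply Finset.one_le_prod
        intro k hk
        rw [norm_pow]
        apply one_le_pow₀
        have h3 : 2 ≤ ‖w / a k‖ := by
          rw [norm_div, hw', le_div_iff₀ (norm_pos_iff.2 (ha0 k))]
          have := ha k (by simpa using hk)
          linarith
        have h4 := norm_sub_norm_le (w / a k) 1
        rw [norm_sub_rev] at h4
        simp only [norm_one] at h4
        linarith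
      nlinarith [norm_nonneg (g w)]
    · rw [closure_ball _ (by positivity)]; exact hz
  have hsub : Metric.ball (0:ℂ) R ⊆ Metric.ball 0 ρ := Metric.ball_subset_ball (by linarith)
  refine pz_log_bound hR hA (hg.mono hsub) ?_ ?_ ?_ i
  · have := hfg 0 (by simp; linarith)
    simpa [hf0] using this.symm
  · intro z hzR h0
    have h1 := hfg z (hsub hzR)
    rw [h0, mul_zero] at h1
    obtain ⟨k, hk, rfl⟩ := hz z (by simpa using hzR) h1
    exact hga k hk h0
  · intro z hzR
    apply hbb
    simp at hzR ⊢
    linarith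

lemma pz_iter_inv {b : ℂ} (i : ℕ) :
    iteratedDeriv i (fun z : ℂ => (z + b)⁻¹) 0 = (-1) ^ i * i.factorial / b ^ (i + 1) := by
  have := congrFun (iteratedDeriv_comp_add_const i (fun z : ℂ => z⁻¹) b) 0
  rw [this, iteratedDeriv_eq_iterate, iter_deriv_inv]
  simp only [zero_add]
  rw [div_eq_mul_inv, ← zpow_natCast b (i + 1), ← zpow_neg]
  congr 2
  push_cast; ring

lemma pz_contDiff_inv {b : ℂ} (hb : b ≠ 0) (i : ℕ) (c : ℂ) :
    ContDiffAt ℂ i (fun z : ℂ => c * (z + b)⁻¹) 0 := by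
  refine contDiffAt_const.mul ((contDiffAt_id.add contDiffAt_const).inv ?_)
  simpa using hb

lemma pz_logDeriv_lin {b z : ℂ} (hb : b ≠ 0) :
    logDeriv (fun z : ℂ => 1 + z / b) z = (z + b)⁻¹ := by
  rw [logDeriv_apply]
  have : deriv (fun z : ℂ => 1 + z / b) z = 1 / b := by simp
  rw [this]
  by_cases h : z + b = 0
  · have : 1 + z / b = 0 := by field_simp; linear_combination h
    rw [this, h]; simp
  · have : 1 + z / b ≠ 0 := by
      intro h'; apply h; field_simp at h'; linear_combination h'
    rw [div_div, mul_add, mul_one, mul_div_cancel₀ _ hb, add_comm, one_div]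

lemma pz_sum_iter {ι : Type*} (s : Finset ι) (b : ι → ℂ) (c : ι → ℂ) (hb : ∀ k ∈ s, b k ≠ 0)
    (i : ℕ) : iteratedDeriv i (fun z => ∑ k ∈ s, c k * (z + b k)⁻¹) 0 =
      ∑ k ∈ s, c k * ((-1) ^ i * i.factorial / b k ^ (i + 1)) := by
  rw [iteratedDeriv_fun_sum (fun k hk => pz_contDiff_inv (hb k hk) i (c k))]
  refine Finset.sum_congr rfl fun k _ => ?_
  rw [← pz_iter_inv, ← iteratedDeriv_const_mul_field]

lemma pz_logDeriv_prod {ι : Type*} (s : Finset ι) (b : ι → ℂ) (l : ι → ℕ)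
    (hb : ∀ k ∈ s, b k ≠ 0) :
    ∀ᶠ z in nhds (0:ℂ), (∏ k ∈ s, (1 + z / b k) ^ l k) ≠ 0 ∧
      logDeriv (fun z => ∏ k ∈ s, (1 + z / b k) ^ l k) z = ∑ k ∈ s, (l k : ℂ) * (z + b k)⁻¹ := by
  have h1 : ∀ᶠ z in nhds (0:ℂ), (∏ k ∈ s, (1 + z / b k) ) ≠ 0 := by
    have hc : Continuous (fun z : ℂ => ∏ k ∈ s, (1 + z / b k)) := by fun_prop
    apply hc.continuousAt.eventually_ne
    simp
  filter_upwards [h1] with z hz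
  rw [Finset.prod_ne_zero_iff] at hz
  have hz' : ∀ k ∈ s, (1 + z / b k) ^ l k ≠ 0 := fun k hk => pow_ne_zero _ (hz k hk)
  refine ⟨Finset.prod_ne_zero_iff.2 hz', ?_⟩
  have := logDeriv_prod (s := s) (f := fun k z => (1 + z / b k) ^ l k) (x := z) hz'
    (fun k hk => by fun_prop)
  convert! this using 1
  refine Finset.sum_congr rfl fun k hk => ?_
  rw [logDeriv_fun_pow (by fun_prop), pz_logDeriv_lin (hb k hk)]

lemma pz_logDeriv_flat {n : ℕ} {φ : ℂ → ℂ} (hφ : AnalyticAt ℂ φ 0) {i : ℕ} (hi : i < n) :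
    AnalyticAt ℂ (logDeriv (fun z => 1 + z ^ (n + 1) * φ z)) 0 ∧
    iteratedDeriv i (logDeriv (fun z => 1 + z ^ (n + 1) * φ z)) 0 = 0 := by
  have hF : AnalyticAt ℂ (fun z => 1 + z ^ (n + 1) * φ z) 0 := by fun_prop
  have hA : AnalyticAt ℂ (logDeriv (fun z => 1 + z ^ (n + 1) * φ z)) 0 := by
    exact hF.deriv.div hF (by simp)
  refine ⟨hA, ?_⟩
  refine (natCast_le_analyticOrderAt_iff_iteratedDeriv_eq_zero hA (n := n)).1 ?_ i hi
  rw [natCast_le_analyticOrderAt hA]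
  refine ⟨fun z => (((n:ℂ) + 1) * φ z + z * deriv φ z) / (1 + z ^ (n + 1) * φ z), ?_, ?_⟩
  · have := hφ.deriv
    refine AnalyticAt.div (by fun_prop) hF (by simp)
  · filter_upwards [hφ.eventually_analyticAt] with z hz
    have h1 : HasDerivAt (fun z => 1 + z ^ (n + 1) * φ z)
        (((n + 1 : ℕ) : ℂ) * z ^ n * φ z + z ^ (n + 1) * deriv φ z) z := by
      have h2 := (hasDerivAt_pow (n+1) z).mul hz.differentiableAt.hasDerivAt
      simpa using h2.const_add 1
    rw [logDeriv_apply, h1.deriv, smul_eq_mul, sub_zero, mul_div_assoc']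
    congr 1
    push_cast; ring

lemma pz_deriv {n M N : ℕ} {ρ : ℝ} (hρ : 0 < ρ) {f g φ : ℂ → ℂ}
    (hg : DifferentiableOn ℂ g (Metric.ball 0 ρ)) {a : ℕ → ℂ} {l : ℕ → ℕ}
    (ha0 : ∀ k, a k ≠ 0) (hφ : AnalyticAt ℂ φ 0)
    (hf : ∀ᶠ z in nhds (0:ℂ), f z =
      (∏ m ∈ Finset.range M, (1 + z / ((m:ℂ) + 1))) ^ (n + 1) * (1 + z ^ (n + 1) * φ z))
    (hfg : ∀ z ∈ Metric.ball (0:ℂ) ρ, f z = (∏ k ∈ Finset.range N, (1 - z / a k) ^ l k) * g z)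
    {i : ℕ} (hi : i < n) :
    iteratedDeriv i (logDeriv g) 0 = i.factorial * ((∑ k ∈ Finset.range N, (l k : ℂ) / a k ^ (i + 1))
      + (-1) ^ i * ((n:ℂ) + 1) * ∑ m ∈ Finset.range M, 1 / ((m:ℂ) + 1) ^ (i + 1)) := by
  have h0mem : (0:ℂ) ∈ Metric.ball (0:ℂ) ρ := Metric.mem_ball_self hρ
  have hgA : AnalyticAt ℂ g 0 := hg.analyticAt (Metric.isOpen_ball.mem_nhds h0mem)
  have hb1 : ∀ m ∈ Finset.range M, ((m:ℂ) + 1) ≠ 0 := fun m _ => Nat.cast_add_one_ne_zero m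
  have hb2 : ∀ k ∈ Finset.range N, -a k ≠ 0 := fun k _ => neg_ne_zero.2 (ha0 k)
  have e1 := pz_logDeriv_prod (Finset.range M) (fun m => (m:ℂ) + 1) (fun _ => n + 1) hb1
  have e2 := pz_logDeriv_prod (Finset.range N) (fun k => -a k) l hb2
  obtain ⟨hflatA, hflat0⟩ := pz_logDeriv_flat hφ hi
  have hg0 : g 0 ≠ 0 := by
    have h1 := hfg 0 h0mem
    have h2 := hf.self_of_nhds
    simp at h1 h2
    rw [← h1, h2]; exact one_ne_zero
  have e3 : ∀ᶠ z in nhds (0:ℂ), g z ≠ 0 := hgA.continuousAt.eventually_ne hg0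
  have e4 : ∀ᶠ z in nhds (0:ℂ), 1 + z ^ (n + 1) * φ z ≠ 0 := by
    have : ContinuousAt (fun z => 1 + z ^ (n + 1) * φ z) 0 := by
      have := hφ.continuousAt
      fun_prop
    apply this.eventually_ne
    simp
  have efg : ∀ᶠ z in nhds (0:ℂ), (∏ k ∈ Finset.range N, (1 + z / (-a k)) ^ l k) * g z =
      (∏ m ∈ Finset.range M, (1 + z / ((m:ℂ) + 1)) ^ (n + 1)) * (1 + z ^ (n + 1) * φ z) := by
    filter_upwards [hf, Metric.isOpen_ball.mem_nhds h0mem] with z h1 h2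
    rw [Finset.prod_pow, ← h1, hfg z h2]
    simp only [div_neg, sub_eq_add_neg]
  have main : logDeriv g =ᶠ[nhds 0] fun z =>
      ((∑ m ∈ Finset.range M, ((n + 1 : ℕ) : ℂ) * (z + ((m:ℂ) + 1))⁻¹) +
        logDeriv (fun z => 1 + z ^ (n + 1) * φ z) z) -
        ∑ k ∈ Finset.range N, (l k : ℂ) * (z + (-a k))⁻¹ := by
    filter_upwards [e1, e2, e3, e4, efg.eventually_nhds, hgA.eventually_analyticAt,
      hφ.eventually_analyticAt] with z h1 h2 h3 h4 h5 h6 h7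
    have h8 := logDeriv_congr_nhds (show (fun z => (∏ k ∈ Finset.range N, (1 + z / (-a k)) ^ l k) * g z)
      =ᶠ[nhds z] (fun z => (∏ m ∈ Finset.range M, (1 + z / ((m:ℂ) + 1)) ^ (n + 1)) *
        (1 + z ^ (n + 1) * φ z)) from h5)
    have h8 := h8.self_of_nhds
    have h7' := h7.differentiableAt
    rw [logDeriv_mul z h2.1 h3 (by fun_prop) h6.differentiableAt,
      logDeriv_mul z h1.1 h4 (by fun_prop) (by fun_prop), h1.2, h2.2] at h8
    rw [← h8]; ring
  rw [main.iteratedDeriv_eq]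
  have c1 : ContDiffAt ℂ i (fun z => ∑ m ∈ Finset.range M, ((n + 1 : ℕ) : ℂ) * (z + ((m:ℂ) + 1))⁻¹) 0 :=
    ContDiffAt.sum fun m hm => pz_contDiff_inv (hb1 m hm) i _
  have c2 : ContDiffAt ℂ i (fun z => ∑ k ∈ Finset.range N, (l k : ℂ) * (z + (-a k))⁻¹) 0 :=
    ContDiffAt.sum fun m hm => pz_contDiff_inv (hb2 m hm) i _
  have c3 : ContDiffAt ℂ i (logDeriv (fun z => 1 + z ^ (n + 1) * φ z)) 0 := hflatA.contDiffAt
  rw [iteratedDeriv_fun_sub (c1.add c3) c2, iteratedDeriv_fun_add c1 c3, hflat0,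
    pz_sum_iter _ _ _ hb1, pz_sum_iter _ _ _ hb2, add_zero, mul_add, sub_eq_add_neg, add_comm]
  congr 1
  · rw [← Finset.sum_neg_distrib, Finset.mul_sum]
    refine Finset.sum_congr rfl fun k _ => ?_
    have := ha0 k
    rw [show (-a k) ^ (i + 1) = (-1) ^ i * (-1) * a k ^ (i + 1) by rw [neg_pow, pow_succ]]
    have h1 : ((-1:ℂ)) ^ i ≠ 0 := by simp
    field_simp
  · simp only [Finset.mul_sum]
    refine Finset.sum_congr rfl fun k _ => ?_
    push_cast
    ring

/-- finite product clearing the first `M` poles -/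
noncomputable def pzQ (M : ℕ) (z : ℂ) : ℂ := ∏ m ∈ Finset.range M, (1 + z / ((m:ℂ) + 1))

/-- tail of the polygamma series -/
noncomputable def pzT (n M : ℕ) (z : ℂ) : ℂ := ∑' k : ℕ, 1 / (((k + (M + 1) : ℕ) : ℂ) + z) ^ (n + 1)

/-- `1/(k+1)` times the product with the factor `k` omitted -/
noncomputable def pzO (M k : ℕ) (z : ℂ) : ℂ :=
  1 / ((k:ℂ) + 1) * ∏ m ∈ (Finset.range M).erase k, (1 + z / ((m:ℂ) + 1))

/-- regularised polygamma -/
noncomputable def pzE (n M : ℕ) (z : ℂ) : ℂ :=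
  pzQ M z ^ (n + 1) + z ^ (n + 1) * (∑ k ∈ Finset.range M, pzO M k z ^ (n + 1))
    + z ^ (n + 1) * pzQ M z ^ (n + 1) * pzT n M z

lemma pz_summ {n : ℕ} (hn : 2 ≤ n) : Summable (fun k : ℕ => 1 / ((k:ℝ) + 1) ^ (n + 1)) := by
  have := (summable_nat_add_iff 1).2 (Real.summable_one_div_nat_pow (p := n + 1) |>.2 (by omega))
  simpa using this

lemma pz_term {n M : ℕ} {z : ℂ} (hz : z ∈ Metric.ball (0:ℂ) M) (k : ℕ) :
    ((k:ℝ) + 1) ≤ ‖(((k + (M + 1) : ℕ) : ℂ) + z)‖ ∧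
    ‖1 / (((k + (M + 1) : ℕ) : ℂ) + z) ^ (n + 1)‖ ≤ 1 / ((k:ℝ) + 1) ^ (n + 1) := by
  have h1 : ((k:ℝ) + 1) ≤ ‖(((k + (M + 1) : ℕ) : ℂ) + z)‖ := by
    have hz' : ‖z‖ < M := by simpa using hz
    have h2 := norm_sub_le_norm_add (((k + (M + 1) : ℕ) : ℂ)) z
    rw [Complex.norm_natCast] at h2
    push_cast at h2 ⊢
    linarith
  refine ⟨h1, ?_⟩
  rw [norm_div, norm_one, norm_pow]
  gcongr

lemma pzT_diff {n : ℕ} (hn : 2 ≤ n) (M : ℕ) : DifferentiableOn ℂ (pzT n M) (Metric.ball 0 M) := by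
  refine Complex.differentiableOn_tsum_of_summable_norm (pz_summ hn) ?_ Metric.isOpen_ball
    (fun k z hz => (pz_term hz k).2)
  intro k z hz
  have h1 := (pz_term (n := n) hz k).1
  have h2 : (((k + (M + 1) : ℕ) : ℂ) + z) ≠ 0 := by
    rw [← norm_pos_iff]
    have : (0:ℝ) < k + 1 := by positivity
    linarith
  apply DifferentiableAt.differentiableWithinAt
  exact (differentiableAt_const _).div (by fun_prop) (pow_ne_zero _ h2)

lemma pzT_bound {n : ℕ} (hn : 2 ≤ n) {M : ℕ} {z : ℂ} (hz : z ∈ Metric.ball (0:ℂ) M) :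
    ‖pzT n M z‖ ≤ ∑' k : ℕ, 1 / ((k:ℝ) + 1) ^ (n + 1) :=
  tsum_of_norm_bounded (pz_summ hn).hasSum (fun k => (pz_term hz k).2)

lemma pzE_diff {n : ℕ} (hn : 2 ≤ n) (M : ℕ) : DifferentiableOn ℂ (pzE n M) (Metric.ball 0 M) := by
  have h1 := pzT_diff hn M
  have h2 : Differentiable ℂ (pzQ M) := by unfold pzQ; fun_prop
  have h3 : ∀ k, Differentiable ℂ (pzO M k) := by intro k; unfold pzO; fun_prop
  have h4 : Differentiable ℂ (fun z => pzQ M z ^ (n + 1) +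
      z ^ (n + 1) * (∑ k ∈ Finset.range M, pzO M k z ^ (n + 1))) := by fun_prop
  have h5 : Differentiable ℂ (fun z => z ^ (n + 1) * pzQ M z ^ (n + 1)) := by fun_prop
  exact h4.differentiableOn.add (h5.differentiableOn.mul h1)

lemma pzO_eq {M k : ℕ} (hk : k < M) {z : ℂ} (hz : ((k:ℂ) + 1) + z ≠ 0) :
    pzO M k z = pzQ M z * (1 / ((k:ℂ) + 1 + z)) := by
  unfold pzO pzQ
  rw [← Finset.mul_prod_erase (Finset.range M) _ (Finset.mem_range.2 hk)]
  have := Nat.cast_add_one_ne_zero (R := ℂ) k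
  field_simp

/-- local form at points which are not `-1, -2, ...` -/
lemma pzE_eq {n M : ℕ} {z : ℂ} (hz : ∀ k < M, ((k:ℂ) + 1) + z ≠ 0) :
    pzE n M z = pzQ M z ^ (n + 1) * (1 + z ^ (n + 1) *
      ((∑ k ∈ Finset.range M, (1 / ((k:ℂ) + 1 + z)) ^ (n + 1)) + pzT n M z)) := by
  unfold pzE
  rw [Finset.sum_congr rfl (fun k hk => by rw [pzO_eq (Finset.mem_range.1 hk) (hz k (Finset.mem_range.1 hk)), mul_pow]),
    ← Finset.mul_sum]
  ring

lemma pz_eq_poly {n : ℕ} (hn : 2 ≤ n) {M : ℕ} {z : ℂ} (hzb : z ∈ Metric.ball (0:ℂ) M) (hz0 : z ≠ 0)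
    (hz : ∀ k < M, ((k:ℂ) + 1) + z ≠ 0) :
    ((-1) ^ (n + 1) * (Nat.factorial n : ℂ)) * pzE n M z =
      (z ^ (n + 1) * pzQ M z ^ (n + 1)) * polygamma n z := by
  have hs : Summable (fun k : ℕ => 1 / ((k : ℂ) + z) ^ (n + 1)) := by
    rw [← summable_nat_add_iff (M + 1)]
    exact Summable.of_norm_bounded (pz_summ hn) (fun k => (pz_term hzb k).2)
  rw [pzE_eq hz, polygamma, ← hs.sum_add_tsum_nat_add (M + 1), Finset.sum_range_succ']
  simp only [Nat.cast_zero, zero_add, Nat.cast_add, Nat.cast_one, one_div_pow]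
  unfold pzT
  simp only [Nat.cast_add, Nat.cast_one]
  have : z ^ (n + 1) ≠ 0 := pow_ne_zero _ hz0
  field_simp
  ring

lemma pzE_zero (n M : ℕ) : pzE n M 0 = 1 := by
  simp [pzE, pzQ]

lemma pzE_ne {n M k : ℕ} (hk : k < M) : pzE n M (-((k:ℂ) + 1)) ≠ 0 := by
  have hk1 := Nat.cast_add_one_ne_zero (R := ℂ) k
  have hQ : pzQ M (-((k:ℂ) + 1)) = 0 := by
    unfold pzQ
    apply Finset.prod_eq_zero (Finset.mem_range.2 hk)
    rw [neg_div, div_self hk1]; ring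
  have hO : ∀ m ∈ Finset.range M, m ≠ k → pzO M m (-((k:ℂ) + 1)) ^ (n + 1) = 0 := by
    intro m _ hmk
    have : ∏ m ∈ (Finset.range M).erase m, (1 + (-((k:ℂ) + 1)) / ((m:ℂ) + 1)) = 0 := by
      apply Finset.prod_eq_zero (i := k) (by simp [hk, hmk.symm])
      rw [neg_div, div_self hk1]; ring
    rw [pzO, this]; simp
  unfold pzE
  rw [hQ, Finset.sum_eq_single_of_mem k (Finset.mem_range.2 hk) hO]
  simp only [ne_eq, Nat.add_eq_zero_iff, one_ne_zero, and_false, not_false_eq_true, zero_pow,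
    zero_add, mul_zero, zero_mul, add_zero]
  rw [← mul_pow]
  apply pow_ne_zero
  apply mul_ne_zero (neg_ne_zero.2 hk1)
  unfold pzO
  apply mul_ne_zero (one_div_ne_zero hk1)
  rw [Finset.prod_ne_zero_iff]
  intro m hm h
  have hm1 := Nat.cast_add_one_ne_zero (R := ℂ) m
  field_simp at h
  have h' : (m:ℂ) = k := by linear_combination h
  have := Nat.cast_injective h'
  simp [this] at hm

lemma pzE_order {n : ℕ} (hn : 2 ≤ n) {M : ℕ} {z : ℂ} (hzb : z ∈ Metric.ball (0:ℂ) M)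
    (hz : ∀ m : ℕ, z ≠ -(m:ℂ)) (hA : AnalyticAt ℂ (polygamma n) z) :
    analyticOrderAt (pzE n M) z = analyticOrderAt (polygamma n) z := by
  have hz0 : z ≠ 0 := by simpa using hz 0
  have hzk : ∀ k ∈ Finset.range M, ((k:ℂ) + 1) + z ≠ 0 := by
    intro k _ h
    apply hz (k + 1)
    push_cast
    linear_combination h
  have hc : ((-1) ^ (n + 1) * (Nat.factorial n : ℂ)) ≠ 0 :=
    mul_ne_zero (by simp) (by exact_mod_cast n.factorial_ne_zero)
  have h1 : ∀ᶠ w in nhds z, ∀ k ∈ Finset.range M, ((k:ℂ) + 1) + w ≠ 0 := by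
    rw [Filter.eventually_all_finset]
    intro k hk
    have : ContinuousAt (fun w : ℂ => ((k:ℂ) + 1) + w) z := by fun_prop
    exact this.eventually_ne (hzk k hk)
  have hev : pzE n M =ᶠ[nhds z] (fun w => ((-1) ^ (n + 1) * (Nat.factorial n : ℂ))⁻¹ *
      (w ^ (n + 1) * pzQ M w ^ (n + 1))) * polygamma n := by
    filter_upwards [h1, Metric.isOpen_ball.mem_nhds hzb, isOpen_ne.mem_nhds hz0] with w h1 h2 h3
    have := pz_eq_poly hn h2 h3 (fun k hk => h1 k (Finset.mem_range.2 hk))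
    rw [Pi.mul_apply, mul_assoc, ← this, inv_mul_cancel_left₀ hc]
  have hB : AnalyticAt ℂ (fun w => ((-1) ^ (n + 1) * (Nat.factorial n : ℂ))⁻¹ *
      (w ^ (n + 1) * pzQ M w ^ (n + 1))) z := by
    apply Differentiable.analyticAt
    unfold pzQ
    fun_prop
  rw [analyticOrderAt_congr hev, analyticOrderAt_mul hB hA, hB.analyticOrderAt_eq_zero.2, zero_add]
  refine mul_ne_zero (inv_ne_zero hc) (mul_ne_zero (pow_ne_zero _ hz0) (pow_ne_zero _ ?_))
  unfold pzQ
  rw [Finset.prod_ne_zero_iff]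
  intro k hk h
  have hk1 := Nat.cast_add_one_ne_zero (R := ℂ) k
  apply hzk k hk
  field_simp at h
  linear_combination h

lemma pzE_zero_mem {n : ℕ} (hn : 2 ≤ n) {M : ℕ} {z : ℂ} (hzb : z ∈ Metric.ball (0:ℂ) M)
    (h : pzE n M z = 0) : (∀ m : ℕ, z ≠ -(m:ℂ)) ∧ polygamma n z = 0 := by
  have hz0 : z ≠ 0 := by rintro rfl; simp [pzE_zero] at h
  have hz : ∀ k < M, ((k:ℂ) + 1) + z ≠ 0 := by
    intro k hk h'
    have : z = -((k:ℂ) + 1) := by linear_combination h'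
    rw [this] at h
    exact pzE_ne hk h
  constructor
  · intro m hm
    rcases m with _ | m
    · simp at hm; exact hz0 hm
    · apply hz m
      · have : ‖z‖ < M := by simpa using hzb
        rw [hm, norm_neg, Complex.norm_natCast] at this
        have : m + 1 < M := by exact_mod_cast this
        omega
      · rw [hm]; push_cast; ring
  · have := pz_eq_poly hn hzb hz0 hz
    rw [h, mul_zero] at this
    rcases mul_eq_zero.1 this.symm with h1 | h1
    · exfalso
      refine mul_ne_zero (pow_ne_zero _ hz0) (pow_ne_zero _ ?_) h1
      unfold pzQ
      rw [Finset.prod_ne_zero_iff]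
      intro k hk h
      have hk1 := Nat.cast_add_one_ne_zero (R := ℂ) k
      apply hz k (by simpa using hk)
      field_simp at h
      linear_combination h
    · exact h1

lemma pzE_local {n : ℕ} (hn : 2 ≤ n) {M : ℕ} (hM : 0 < M) : ∃ φ : ℂ → ℂ, AnalyticAt ℂ φ 0 ∧
    ∀ᶠ z in nhds (0:ℂ), pzE n M z =
      (∏ m ∈ Finset.range M, (1 + z / ((m:ℂ) + 1))) ^ (n + 1) * (1 + z ^ (n + 1) * φ z) := by
  have h0 : (0:ℂ) ∈ Metric.ball (0:ℂ) (M:ℝ) := Metric.mem_ball_self (by exact_mod_cast hM)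
  refine ⟨fun z => (∑ k ∈ Finset.range M, (1 / ((k:ℂ) + 1 + z)) ^ (n + 1)) + pzT n M z, ?_, ?_⟩
  · refine AnalyticAt.add ?_ ((pzT_diff hn M).analyticAt (Metric.isOpen_ball.mem_nhds h0))
    refine Finset.analyticAt_fun_sum _ fun k _ => ?_
    refine AnalyticAt.pow (analyticAt_const.div (by fun_prop) ?_) _
    simpa using Nat.cast_add_one_ne_zero (R := ℂ) k
  · have h1 : ∀ᶠ w in nhds (0:ℂ), ∀ k ∈ Finset.range M, ((k:ℂ) + 1) + w ≠ 0 := by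
      rw [Filter.eventually_all_finset]
      intro k hk
      have : ContinuousAt (fun w : ℂ => ((k:ℂ) + 1) + w) 0 := by fun_prop
      exact this.eventually_ne (by simpa using Nat.cast_add_one_ne_zero (R := ℂ) k)
    filter_upwards [h1] with z hz
    exact pzE_eq fun k hk => hz k (Finset.mem_range.2 hk)

lemma pz_harm (M : ℕ) : ∑ m ∈ Finset.range M, 1 / ((m:ℝ) + 1) ≤ 2 * √M := by
  induction M with
  | zero => simp
  | succ M ih =>
    rw [Finset.sum_range_succ]
    push_cast
    have h1 : √((M:ℝ) + 1) ^ 2 = M + 1 := Real.sq_sqrt (by positivity)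
    have h2 : √(M:ℝ) ^ 2 = M := Real.sq_sqrt (by positivity)
    have h3 : 0 ≤ √(M:ℝ) := Real.sqrt_nonneg _
    have h4 : √(M:ℝ) ≤ √((M:ℝ) + 1) := Real.sqrt_le_sqrt (by linarith)
    have h5 : 1 ≤ √((M:ℝ) + 1) := by rw [Real.one_le_sqrt]; linarith [(Nat.cast_nonneg M : (0:ℝ) ≤ M)]
    set s := √(M:ℝ)
    set t := √((M:ℝ) + 1)
    have h6 : 1 / ((M:ℝ) + 1) ≤ 2 * (t - s) := by
      rw [div_le_iff₀ (by positivity), ← h1]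
      have h7 : (t - s) * (t + s) = 1 := by nlinarith
      have h8 : 0 ≤ t - s := by linarith
      nlinarith [mul_nonneg h8 (by linarith : 0 ≤ t - s), mul_nonneg h8 (by nlinarith : 0 ≤ t * t - t)]
    linarith

lemma pz_prod_bound {M : ℕ} {r : ℝ} {z : ℂ} (hz : ‖z‖ = r) (s : Finset ℕ) (hs : s ⊆ Finset.range M) :
    ‖∏ m ∈ s, (1 + z / ((m:ℂ) + 1))‖ ≤ Real.exp (r * (2 * √M)) := by
  have hr : 0 ≤ r := hz ▸ norm_nonneg z
  rw [norm_prod]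
  calc ∏ m ∈ s, ‖1 + z / ((m:ℂ) + 1)‖ ≤ ∏ m ∈ s, Real.exp (r * (1 / ((m:ℝ) + 1))) := by
        refine Finset.prod_le_prod (fun _ _ => norm_nonneg _) fun m _ => ?_
        have h1 : ‖z / ((m:ℂ) + 1)‖ = r * (1 / ((m:ℝ) + 1)) := by
          rw [norm_div, hz, mul_one_div]
          congr 1
          have := Complex.norm_natCast (m + 1)
          push_cast at this
          exact this
        calc ‖1 + z / ((m:ℂ) + 1)‖ ≤ ‖(1:ℂ)‖ + ‖z / ((m:ℂ) + 1)‖ := norm_add_le _ _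
          _ = r * (1 / ((m:ℝ) + 1)) + 1 := by rw [h1, norm_one, add_comm]
          _ ≤ _ := Real.add_one_le_exp _
    _ = Real.exp (r * ∑ m ∈ s, (1 / ((m:ℝ) + 1))) := by rw [← Real.exp_sum, Finset.mul_sum]
    _ ≤ _ := by
        apply Real.exp_le_exp.2
        apply mul_le_mul_of_nonneg_left _ hr
        exact (Finset.sum_le_sum_of_subset_of_nonneg hs (fun _ _ _ => by positivity)).trans (pz_harm M)

lemma pzE_bound {n : ℕ} (hn : 2 ≤ n) : ∃ C : ℝ, 0 ≤ C ∧ ∀ (M : ℕ) (r : ℝ) (z : ℂ), ‖z‖ = r → r < M →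
    ‖pzE n M z‖ ≤ Real.exp (((n:ℝ) + 1) * (r * (2 * √M)) + ((n:ℝ) + 1) * r + M + C) := by
  refine ⟨∑' k : ℕ, 1 / ((k:ℝ) + 1) ^ (n + 1), tsum_nonneg fun k => by positivity, ?_⟩
  intro M r z hz hr
  set C := ∑' k : ℕ, 1 / ((k:ℝ) + 1) ^ (n + 1) with hC
  have hC0 : 0 ≤ C := tsum_nonneg fun k => by positivity
  have hr0 : 0 ≤ r := hz ▸ norm_nonneg z
  have hzb : z ∈ Metric.ball (0:ℂ) (M:ℝ) := by simp [hz, hr]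
  have hT : ‖pzT n M z‖ ≤ C := pzT_bound hn hzb
  set B := Real.exp (r * (2 * √M)) with hB
  have hQ : ‖pzQ M z‖ ≤ B := pz_prod_bound hz _ subset_rfl
  have hO : ∀ k, ‖pzO M k z‖ ≤ B := by
    intro k
    unfold pzO
    rw [norm_mul]
    have h1 : ‖1 / ((k:ℂ) + 1)‖ ≤ 1 := by
      rw [norm_div, norm_one]
      have := Complex.norm_natCast (k + 1)
      push_cast at this
      rw [this, div_le_one (by positivity)]
      linarith [(Nat.cast_nonneg k : (0:ℝ) ≤ k)]
    have h2 := pz_prod_bound (M := M) hz ((Finset.range M).erase k) (Finset.erase_subset _ _)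
    calc _ ≤ 1 * B := mul_le_mul h1 h2 (norm_nonneg _) zero_le_one
      _ = B := one_mul _
  have hB0 : 0 ≤ B := (Real.exp_pos _).le
  have hS : ‖∑ k ∈ Finset.range M, pzO M k z ^ (n + 1)‖ ≤ M * B ^ (n + 1) := by
    refine (norm_sum_le _ _).trans ?_
    refine (Finset.sum_le_card_nsmul _ _ (B ^ (n + 1)) fun k _ => ?_).trans_eq (by simp)
    rw [norm_pow]
    exact pow_le_pow_left₀ (norm_nonneg _) (hO k) _
  have h1 : ‖pzE n M z‖ ≤ B ^ (n + 1) + r ^ (n + 1) * (M * B ^ (n + 1)) +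
      r ^ (n + 1) * B ^ (n + 1) * C := by
    unfold pzE
    refine (norm_add₃_le).trans ?_
    rw [norm_mul, norm_mul, norm_mul, norm_pow, norm_pow, hz]
    gcongr
  have he : r ^ (n + 1) ≤ Real.exp r ^ (n + 1) :=
    pow_le_pow_left₀ hr0 (by linarith [Real.add_one_le_exp r]) _
  have he1 : 1 ≤ Real.exp r ^ (n + 1) := one_le_pow₀ (Real.one_le_exp hr0)
  calc ‖pzE n M z‖ ≤ B ^ (n + 1) * (1 + r ^ (n + 1) * (M + C)) := by linarith [h1]
    _ ≤ B ^ (n + 1) * (Real.exp r ^ (n + 1) * (M + C + 1)) := by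
        gcongr
        have : 0 ≤ (M:ℝ) + C := by positivity
        nlinarith
    _ ≤ B ^ (n + 1) * (Real.exp r ^ (n + 1) * Real.exp (M + C)) := by
        gcongr
        exact Real.add_one_le_exp _
    _ = _ := by
        rw [hB, ← Real.exp_nat_mul, ← Real.exp_nat_mul, ← Real.exp_add, ← Real.exp_add]
        congr 1
        push_cast; ring

lemma pz_tendsto_norm {n : ℕ} (hn : 2 ≤ n) {η : ℕ → ℂ}
    (hη_mem : ∀ k, (∀ m : ℕ, η k ≠ -(m : ℂ)) ∧ polygamma n (η k) = 0)
    (hη_inj : Function.Injective η) (hmono : Monotone fun k => ‖η k‖) :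
    Filter.Tendsto (fun k => ‖η k‖) Filter.atTop Filter.atTop := by
  refine Filter.tendsto_atTop_atTop_of_monotone hmono ?_
  by_contra! hcon
  obtain ⟨b, hb⟩ := hcon
  obtain ⟨M, hM⟩ := exists_nat_gt b
  have hM0 : (0:ℝ) < M := lt_of_le_of_lt ((norm_nonneg _).trans (hb 0).le) hM
  have hinf : (Set.range η).Infinite := Set.infinite_range_of_injective hη_inj
  have hsub : Set.range η ⊆ Metric.closedBall (0:ℂ) b := by
    rintro _ ⟨k, rfl⟩
    simpa using (hb k).le
  obtain ⟨x, hx, hacc⟩ := hinf.exists_accPt_of_subset_isCompact (isCompact_closedBall _ _) hsub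
  have hxb : x ∈ Metric.ball (0:ℂ) M := Metric.closedBall_subset_ball hM hx
  have hA : AnalyticOnNhd ℂ (pzE n M) (Metric.ball 0 M) :=
    (pzE_diff hn M).analyticOnNhd Metric.isOpen_ball
  have hfreq : ∃ᶠ z in nhdsWithin x {x}ᶜ, pzE n M z = 0 := by
    rw [accPt_iff_frequently_nhdsNE] at hacc
    refine hacc.mono ?_
    rintro _ ⟨k, rfl⟩
    have hkb : η k ∈ Metric.ball (0:ℂ) M := Metric.closedBall_subset_ball hM (hsub ⟨k, rfl⟩)
    have := pz_eq_poly hn hkb (by simpa using (hη_mem k).1 0) (by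
      intro m _ h
      apply (hη_mem k).1 (m + 1)
      push_cast
      linear_combination h)
    rw [(hη_mem k).2, mul_zero] at this
    refine (mul_eq_zero.1 this).resolve_left ?_
    exact mul_ne_zero (by simp) (by exact_mod_cast n.factorial_ne_zero)
  have h0 := hA.eqOn_zero_of_preconnected_of_frequently_eq_zero
    (convex_ball (0:ℂ) (M:ℝ)).isPreconnected hxb hfreq (Metric.mem_ball_self hM0)
  rw [pzE_zero] at h0
  simp at h0

lemma pz_estimate {n : ℕ} {C R : ℝ} (hC : 0 ≤ C) (hR : 1 ≤ R) {M : ℕ} (hM : (M:ℝ) ≤ 2 * R + 2)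
    {i : ℕ} (hi : 1 ≤ i) :
    (((n:ℝ) + 1) * ((2 * R) * (2 * √M)) + ((n:ℝ) + 1) * (2 * R) + M + (C + 1)) / (R / 2) ^ (i + 1)
      ≤ ((10 * ((n:ℝ) + 1) + 5 + C) * 2 ^ (i + 1)) * (1 / √R) := by
  have hR0 : 0 < R := by linarith
  set s := √R with hs
  have hs1 : 1 ≤ s := by rw [hs, Real.one_le_sqrt]; exact hR
  have hs2 : s ^ 2 = R := Real.sq_sqrt hR0.le
  have hsM : √(M:ℝ) ≤ 2 * s := by
    rw [Real.sqrt_le_left (by positivity), mul_pow, hs2]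
    linarith
  have h1 : ((n:ℝ) + 1) * ((2 * R) * (2 * √M)) + ((n:ℝ) + 1) * (2 * R) + M + (C + 1) ≤
      (10 * ((n:ℝ) + 1) + 5 + C) * (R * s) := by
    have e1 : ((n:ℝ) + 1) * ((2 * R) * (2 * √M)) ≤ ((n:ℝ) + 1) * ((2 * R) * (2 * (2 * s))) := by
      gcongr
    have e2 : R ≤ R * s := by nlinarith
    have e3 : 1 ≤ R * s := by linarith
    have e4 : ((n:ℝ) + 1) * (2 * R) ≤ ((n:ℝ) + 1) * (2 * (R * s)) := by gcongr
    have e5 : (C + 1) * 1 ≤ (C + 1) * (R * s) := by gcongr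
    have e6 : (M:ℝ) ≤ 4 * (R * s) := by linarith
    linarith
  have h2 : R ^ 2 ≤ R ^ (i + 1) := pow_le_pow_right₀ hR (by omega)
  rw [div_pow, div_le_iff₀ (by positivity)]
  refine h1.trans ?_
  have h3 : (10 * ((n:ℝ) + 1) + 5 + C) * 2 ^ (i + 1) * (1 / s) * (R ^ (i + 1) / 2 ^ (i + 1)) =
      (10 * ((n:ℝ) + 1) + 5 + C) * (R ^ (i + 1) / s) := by
    field_simp
  rw [h3]
  gcongr
  rw [le_div_iff₀ (by positivity)]
  calc R * s * s = R ^ 2 := by rw [mul_assoc, ← sq, hs2, sq]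
    _ ≤ _ := h2

lemma pz_zeta {j : ℕ} (hj : 2 ≤ j) :
    Filter.Tendsto (fun M : ℕ => ∑ m ∈ Finset.range M, 1 / ((m:ℂ) + 1) ^ j) Filter.atTop
      (nhds (riemannZeta j)) := by
  have h1 : Summable (fun m : ℕ => 1 / (m:ℂ) ^ j) := by
    refine Summable.of_norm ?_
    simpa using (Real.summable_one_div_nat_pow (p := j)).2 (by omega)
  have h2 : Summable (fun m : ℕ => 1 / ((m:ℂ) + 1) ^ j) := by
    simpa using (summable_nat_add_iff 1).2 h1
  rw [zeta_nat_eq_tsum_of_gt_one (by omega), h1.tsum_eq_zero_add]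
  have : (0:ℂ) ^ j = 0 := zero_pow (by omega)
  simp only [Nat.cast_zero, this, div_zero, zero_add, Nat.cast_add, Nat.cast_one]
  exact h2.hasSum.tendsto_sum_nat

/-- Theorem 4.1 (b): if `(η_k)` enumerates the zeros of `ψ⁽ⁿ⁾` (with orders `l_k`) in
nondecreasing order of modulus then, for `2 ≤ j ≤ n`,
`∑_k l_k/η_k^j = (-1)^j (n+1) ζ(j)`, the series summed in this order. -/
theorem sum_inv_pow_polygamma_zeros (n : ℕ) (hn : 2 ≤ n)
    (η : ℕ → ℂ) (l : ℕ → ℕ)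
    (hη_mem : ∀ k, (∀ m : ℕ, η k ≠ -(m : ℂ)) ∧ polygamma n (η k) = 0)
    (hη_inj : Function.Injective η)
    (hη_surj : ∀ z : ℂ, (∀ m : ℕ, z ≠ -(m : ℂ)) → polygamma n z = 0 → ∃ k, η k = z)
    (hη_mono : ∀ k, ‖η k‖ ≤ ‖η (k + 1)‖)
    (hl : ∀ k, ∃ h : AnalyticAt ℂ (polygamma n) (η k), analyticOrderAt (polygamma n) (η k) = (l k : ℕ∞))
    (j : ℕ) (hj2 : 2 ≤ j) (hjn : j ≤ n) :
    Filter.Tendsto (fun N : ℕ => ∑ k ∈ Finset.range N, (l k : ℂ) / (η k) ^ j)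
      Filter.atTop (nhds ((-1) ^ j * ((n : ℂ) + 1) * riemannZeta j)) := by
  have hmono : Monotone fun k => ‖η k‖ := monotone_nat_of_le_succ hη_mono
  have hη0 : ∀ k, η k ≠ 0 := fun k => by simpa using (hη_mem k).1 0
  have hlim := pz_tendsto_norm hn hη_mem hη_inj hmono
  obtain ⟨C, hC, hbound⟩ := pzE_bound hn
  obtain ⟨i, rfl⟩ : ∃ i, j = i + 1 := ⟨j - 1, by omega⟩
  set M : ℕ → ℕ := fun N => ⌈2 * ‖η N‖⌉₊ + 1 with hMdef
  have hM1 : ∀ N, 2 * ‖η N‖ < M N := by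
    intro N
    have := Nat.le_ceil (2 * ‖η N‖)
    simp only [hMdef]; push_cast; linarith
  have hM2 : ∀ N, (M N : ℝ) ≤ 2 * ‖η N‖ + 2 := by
    intro N
    have := Nat.ceil_lt_add_one (a := 2 * ‖η N‖) (by positivity)
    simp only [hMdef]; push_cast; linarith
  have hMlim : Filter.Tendsto M Filter.atTop Filter.atTop := by
    rw [← tendsto_natCast_atTop_iff (R := ℝ)]
    refine Filter.tendsto_atTop_mono (fun N => ?_) hlim
    have := hM1 N
    have := norm_nonneg (η N)
    linarith
  set D : ℕ → ℂ := fun N => (∑ k ∈ Finset.range N, (l k : ℂ) / η k ^ (i + 1))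
      + (-1) ^ i * ((n:ℂ) + 1) * ∑ m ∈ Finset.range (M N), 1 / ((m:ℂ) + 1) ^ (i + 1) with hD
  have hDb : ∀ N, 1 ≤ ‖η N‖ → ‖D N‖ ≤ ((i + 1).factorial * 2 *
      ((10 * ((n:ℝ) + 1) + 5 + C) * 2 ^ (i + 1))) * (1 / √‖η N‖) := by
    intro N hN
    have hR : 0 < ‖η N‖ := by linarith
    have hk : ∀ k < N, ‖η k‖ ≤ ‖η N‖ := fun k hk => hmono hk.le
    have hmemb : ∀ z : ℂ, ‖z‖ ≤ ‖η N‖ → z ∈ Metric.ball (0:ℂ) (M N : ℝ) := by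
      intro z hz
      have := hM1 N
      simp only [mem_ball_zero_iff]
      linarith
    obtain ⟨g, hg, hga, hfg⟩ := pz_factor (pzE_diff hn (M N)) hη_inj (l := l) N
      (fun k h => hmemb _ (hk k h)) hη0 (fun k h => by
        obtain ⟨hA, ho⟩ := hl k
        rw [pzE_order hn (hmemb _ (hk k h)) (hη_mem k).1 hA, ho])
    obtain ⟨φ, hφ, hloc⟩ := pzE_local hn (M := M N) (Nat.succ_pos _)
    have e1 := pz_deriv (by linarith [hM1 N]) hg hη0 hφ hloc hfg (i := i) (by omega)
    have e2 := pz_main hR (hM1 N) (A := ((n:ℝ) + 1) * ((2 * ‖η N‖) * (2 * √(M N))) +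
        ((n:ℝ) + 1) * (2 * ‖η N‖) + (M N) + (C + 1)) (by positivity) hg (pzE_zero n (M N))
      (fun z hz => (hbound (M N) _ z hz (hM1 N)).trans (Real.exp_le_exp.2 (by linarith)))
      hk hη0 hga (by
        intro z hz h0
        obtain ⟨hz1, hz2⟩ := pzE_zero_mem hn (hmemb z hz.le) h0
        obtain ⟨k, rfl⟩ := hη_surj z hz1 hz2
        refine ⟨k, ?_, rfl⟩
        by_contra! hkN
        exact absurd (hmono hkN) (not_le.2 hz)) hfg i
    rw [e1, norm_mul, Complex.norm_natCast] at e2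
    have e3 := pz_estimate (n := n) hC hN (hM2 N) (i := i) (by omega)
    have e4 : (1:ℝ) ≤ i.factorial := by exact_mod_cast i.factorial_pos
    calc ‖D N‖ ≤ i.factorial * ‖D N‖ := le_mul_of_one_le_left (norm_nonneg _) e4
      _ ≤ _ := e2
      _ = (i + 1).factorial * 2 * ((((n:ℝ) + 1) * ((2 * ‖η N‖) * (2 * √(M N))) +
        ((n:ℝ) + 1) * (2 * ‖η N‖) + (M N) + (C + 1)) / (‖η N‖ / 2) ^ (i + 1)) := by ring
      _ ≤ (i + 1).factorial * 2 * (((10 * ((n:ℝ) + 1) + 5 + C) * 2 ^ (i + 1)) * (1 / √‖η N‖)) := by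
        gcongr
      _ = _ := by ring
  have hD0 : Filter.Tendsto D Filter.atTop (nhds 0) := by
    refine squeeze_zero_norm' (a := fun N => ((i + 1).factorial * 2 *
      ((10 * ((n:ℝ) + 1) + 5 + C) * 2 ^ (i + 1))) * (1 / √‖η N‖)) ?_ ?_
    · filter_upwards [hlim.eventually_ge_atTop 1] with N hN using hDb N hN
    · have h1 : Filter.Tendsto (fun N => 1 / √‖η N‖) Filter.atTop (nhds 0) := by
        simp only [one_div]
        exact (Real.tendsto_sqrt_atTop.comp hlim).inv_tendsto_atTop
      simpa using h1.const_mul ((i + 1).factorial * 2 *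
        ((10 * ((n:ℝ) + 1) + 5 + C) * 2 ^ (i + 1)))
  have hZ := ((pz_zeta hj2).comp hMlim).const_mul ((-1) ^ i * ((n:ℂ) + 1))
  have := hD0.sub hZ
  convert! this using 1
  · funext N
    simp only [hD, Function.comp_apply]
    ring
  · congr 1
    rw [pow_succ]; ring
end
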